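/- Let φ: (R,m,k) → (S,n,ℓ) be a flat local ring homomorphism between commutative Noetherian local rings which is essentially of finite type and complete intersection at n, and let M be a finitely generated S-module. If cidim-fd_R M < ∞, then cidim_S M < ∞. -/

import Mathlib

/-!
Common definitions: André–Quillen homology via the standard (comonad/polynomial)
simplicial resolution, complete-intersection (flat) dimensions via quasi-deformations,
Cohen factorizations, Koszul homology `H₁`, and related notions.
-/

universe u

open TensorProduct IsLocalRing

noncomputable section

/-! ### Flat and projective dimension -/

/-- `FlatDimLE Q n N` : the `Q`-module `N` has flat dimension at most `n`,
i.e. it admits a flat resolution of length at most `n`. -/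
def FlatDimLE (Q : Type u) [CommRing Q] : ℕ → (N : Type u) → [AddCommGroup N] → [Module Q N] → Prop
  | 0, N, _, _ => Module.Flat Q N
  | n+1, N, _, _ =>
      ∃ (F : Type u) (_ : AddCommGroup F) (_ : Module Q F) (f : F →ₗ[Q] N),
        Module.Flat Q F ∧ Function.Surjective f ∧ FlatDimLE Q n (LinearMap.ker f)

/-- `ProjDimLE Q n N` : the `Q`-module `N` has projective dimension at most `n`. -/
def ProjDimLE (Q : Type u) [CommRing Q] : ℕ → (N : Type u) → [AddCommGroup N] → [Module Q N] → Prop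
  | 0, N, _, _ => Module.Projective Q N
  | n+1, N, _, _ =>
      ∃ (F : Type u) (_ : AddCommGroup F) (_ : Module Q F) (f : F →ₗ[Q] N),
        Module.Projective Q F ∧ Function.Surjective f ∧ ProjDimLE Q n (LinearMap.ker f)

/-- The flat dimension `fd_Q N` is finite. -/
def FlatDimFinite (Q : Type u) [CommRing Q] (N : Type u) [AddCommGroup N] [Module Q N] : Prop :=
  ∃ n : ℕ, FlatDimLE Q n N

/-- The projective dimension `pd_Q N` is finite. -/
def ProjDimFinite (Q : Type u) [CommRing Q] (N : Type u) [AddCommGroup N] [Module Q N] : Prop :=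
  ∃ n : ℕ, ProjDimLE Q n N

/-! ### Regular sequences, regular local rings, complete intersection conditions -/

/-- The ideal `I` is generated by an `A`-regular sequence. -/
def GeneratedByRegularSequence (A : Type u) [CommRing A] (I : Ideal A) : Prop :=
  ∃ rs : List A, RingTheory.Sequence.IsRegular A rs ∧ Ideal.span {x | x ∈ rs} = I

/-- A (Noetherian local) ring is regular iff its maximal ideal is generated by a
regular sequence. -/
def IsRegularLocal (A : Type u) [CommRing A] : Prop :=
  IsNoetherianRing A ∧
    ∃ h : IsLocalRing A, GeneratedByRegularSequence A (@IsLocalRing.maximalIdeal A _ h)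

/-- A local homomorphism is weakly regular if it is flat with regular closed fibre. -/
def IsWeaklyRegularHom (A B : Type u) [CommRing A] [CommRing B] [IsLocalRing A]
    (f : A →+* B) : Prop :=
  IsLocalHom f ∧ (letI := f.toAlgebra; Module.Flat A B) ∧
    IsRegularLocal (B ⧸ Ideal.map f (maximalIdeal A))

/-- `R'' → f → g` is a Cohen factorization of the semi-completion of `ψ : A → B`
with respect to the (maximal) ideal `J` of `B`:  `A → R'' → B̂` with `A → R''`
weakly regular, `R''` complete Noetherian local and `R'' → B̂` surjective local. -/
def IsCohenFactorizationAt (A B : Type u) [CommRing A] [CommRing B] [IsLocalRing A]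
    (ψ : A →+* B) (J : Ideal B) (R'' : Type u) [CommRing R'']
    (f : A →+* R'') (g : R'' →+* AdicCompletion J B) : Prop :=
  g.comp f = (algebraMap B (AdicCompletion J B)).comp ψ ∧
  IsNoetherianRing R'' ∧
  (∃ h : IsLocalRing R'', IsAdicComplete (@IsLocalRing.maximalIdeal R'' _ h) R'') ∧
  IsWeaklyRegularHom A R'' f ∧
  Function.Surjective g ∧ IsLocalHom g

/-- `ψ : A → B` is complete intersection (c.i.) at the ideal `J` (typically the
maximal ideal of `B`): in a Cohen factorization `A → R'' → B̂` of the
semi-completion of `ψ`, the kernel of `R'' → B̂` is generated by a regular sequence. -/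
def IsCIAt (A B : Type u) [CommRing A] [CommRing B] [IsLocalRing A]
    (ψ : A →+* B) (J : Ideal B) : Prop :=
  ∃ (R'' : Type u) (_ : CommRing R'') (f : A →+* R'') (g : R'' →+* AdicCompletion J B),
    IsCohenFactorizationAt A B ψ J R'' f g ∧ GeneratedByRegularSequence R'' (RingHom.ker g)

/-- A Noetherian local ring is a complete intersection if its completion is the
quotient of a complete regular local ring by an ideal generated by a regular sequence. -/
def IsCompleteIntersectionRing (A : Type u) [CommRing A] : Prop :=
  IsNoetherianRing A ∧
  ∃ h : IsLocalRing A,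
    ∃ (Q : Type u) (_ : CommRing Q)
      (g : Q →+* AdicCompletion (@IsLocalRing.maximalIdeal A _ h) A),
      IsRegularLocal Q ∧ (∃ hq : IsLocalRing Q, IsAdicComplete (@IsLocalRing.maximalIdeal Q _ hq) Q) ∧
      Function.Surjective g ∧ GeneratedByRegularSequence Q (RingHom.ker g)

/-! ### Complete intersection (flat) dimensions via quasi-deformations

`R → R' ← Q` is a quasi-deformation when `R → R'` is flat local and `Q → R'` is
surjective local with kernel generated by a `Q`-regular sequence (all rings
Noetherian local).  The various complete intersection (flat) dimensions
`CI-fd`, `CI-dim`, `CI*-fd`, `CI*-dim`, `cidim-fd`, `cidim` of a module `M` are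
`inf { fd_Q(R' ⊗_R M) - pd_Q R' }` over (upper / complete intersection)
quasi-deformations; such a dimension is finite iff there is a quasi-deformation
of the appropriate kind for which both `fd_Q (R' ⊗_R M)` and `pd_Q R'` are finite. -/

/-- The conditions on `R → R' ← Q` making it a quasi-deformation. -/
def IsQuasiDeformation (R R' Q : Type u) [CommRing R] [CommRing R'] [CommRing Q]
    (f : R →+* R') (g : Q →+* R') : Prop :=
  IsLocalRing R' ∧ IsLocalRing Q ∧ IsNoetherianRing R' ∧ IsNoetherianRing Q ∧
  IsLocalHom f ∧ IsLocalHom g ∧ (letI := f.toAlgebra; Module.Flat R R') ∧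
  Function.Surjective g ∧ GeneratedByRegularSequence Q (RingHom.ker g)

/-- `CI-fd_R M < ∞` (equivalently, for finitely generated `M`, `CI-dim_R M < ∞`):
there is a quasi-deformation `R → R' ← Q` with `fd_Q (R' ⊗_R M)` and `pd_Q R'` finite. -/
def HasFiniteCIDim (R : Type u) [CommRing R] (M : Type u) [AddCommGroup M] [Module R M] : Prop :=
  ∃ (R' Q : Type u) (_ : CommRing R') (_ : CommRing Q) (f : R →+* R') (g : Q →+* R'),
    IsQuasiDeformation R R' Q f g ∧
    (letI := f.toAlgebra;
     letI := g.toAlgebra;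
     letI : Module Q (R' ⊗[R] M) := Module.compHom _ g;
     FlatDimFinite Q (R' ⊗[R] M) ∧ ProjDimFinite Q R')

/-- `CI*-fd_R M < ∞` (resp. `CI*-dim_R M < ∞`): as in `HasFiniteCIDim` but over
upper quasi-deformations, i.e. `R → R'` is weakly regular. -/
def HasFiniteUpperCIDim (R : Type u) [CommRing R] [IsLocalRing R]
    (M : Type u) [AddCommGroup M] [Module R M] : Prop :=
  ∃ (R' Q : Type u) (_ : CommRing R') (_ : CommRing Q) (f : R →+* R') (g : Q →+* R'),
    IsQuasiDeformation R R' Q f g ∧ IsWeaklyRegularHom R R' f ∧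
    (letI := f.toAlgebra;
     letI := g.toAlgebra;
     letI : Module Q (R' ⊗[R] M) := Module.compHom _ g;
     FlatDimFinite Q (R' ⊗[R] M) ∧ ProjDimFinite Q R')

/-- `cidim-fd_R M < ∞` (resp. `cidim_R M < ∞`): as in `HasFiniteCIDim` but over
complete intersection quasi-deformations, i.e. `R → R'` is c.i. at the maximal
ideal of `R'`. -/
def HasFiniteCIQDDim (R : Type u) [CommRing R] [IsLocalRing R]
    (M : Type u) [AddCommGroup M] [Module R M] : Prop :=
  ∃ (R' Q : Type u) (_ : CommRing R') (_ : CommRing Q) (hR' : IsLocalRing R')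
    (f : R →+* R') (g : Q →+* R'),
    IsQuasiDeformation R R' Q f g ∧
    IsCIAt R R' f (@IsLocalRing.maximalIdeal R' _ hR') ∧
    (letI := f.toAlgebra;
     letI := g.toAlgebra;
     letI : Module Q (R' ⊗[R] M) := Module.compHom _ g;
     FlatDimFinite Q (R' ⊗[R] M) ∧ ProjDimFinite Q R')

/-! ### André–Quillen homology

`D_n(S|R, M)` is defined as the `n`-th homology of `L ⊗_S M`, where `L` is the
cotangent complex of the `R`-algebra `S`: the complex associated to the standard
simplicial resolution `X` of `S` by polynomial `R`-algebras (the comonad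
resolution `X_n = G^{n+1} S`, `G A = R[A]`), with `L_n = S ⊗_{X_n} Ω_{X_n/R}`
the free `S`-module on the variables of `X_n` and differentials the alternating
sums of the maps induced by the face maps. -/

/-- `AQV R S n` is, for `n ≥ 1`, the `n`-th ring in the standard simplicial
polynomial resolution of `S` over `R` (and `AQV R S 0 = S` as an index set). -/
def AQV (R S : Type u) [CommRing R] : ℕ → Type u
  | 0 => S
  | n+1 => MvPolynomial (AQV R S n) R

noncomputable instance (R S : Type u) [CommRing R] (n : ℕ) : CommRing (AQV R S (n+1)) :=
  inferInstanceAs (CommRing (MvPolynomial (AQV R S n) R))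

noncomputable instance (R S : Type u) [CommRing R] (n : ℕ) : Algebra R (AQV R S (n+1)) :=
  inferInstanceAs (Algebra R (MvPolynomial (AQV R S n) R))

/-- The augmentations `X_n → S` of the standard resolution. -/
def AQaug (R S : Type u) [CommRing R] [CommRing S] [Algebra R S] :
    (n : ℕ) → (AQV R S (n+1) →ₐ[R] S)
  | 0 => MvPolynomial.aeval (id : S → S)
  | n+1 => MvPolynomial.aeval (fun v : AQV R S (n+1) => AQaug R S n v)

/-- The face maps `dᵢ : X_{n+1} → X_n` of the standard resolution: `d₀` is the
counit and `d_{i+1} = G(dᵢ)`. -/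
def AQface (R S : Type u) [CommRing R] [CommRing S] [Algebra R S] :
    (n : ℕ) → (i : ℕ) → (AQV R S (n+2) →ₐ[R] AQV R S (n+1))
  | n, 0 => MvPolynomial.aeval (id : AQV R S (n+1) → AQV R S (n+1))
  | 0, _+1 => MvPolynomial.rename ⇑(AQaug R S 0)
  | n+1, i+1 => MvPolynomial.rename ⇑(AQface R S n i)

variable (R S : Type u) [CommRing R] [CommRing S] [Algebra R S]
variable (M : Type u) [AddCommGroup M] [Module S M]

/-- The map `L_{n+1} ⊗ M → L_n ⊗ M` induced by an `R`-algebra map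
`f : X_{n+1} → X_n` on the (base-changed) Kähler differentials: the free module
on the variables `v` of `X_{n+1}` maps by `e_v ↦ ∑_w aug(∂(f Xᵥ)/∂w) • e_w`. -/
def AQind (n : ℕ) (f : AQV R S (n+2) →ₐ[R] AQV R S (n+1)) :
    (AQV R S (n+1) →₀ M) →ₗ[S] (AQV R S n →₀ M) :=
  Finsupp.lsum S fun v : AQV R S (n+1) =>
    letI : DecidableEq (AQV R S n) := Classical.decEq _
    let P : MvPolynomial (AQV R S n) R := f (MvPolynomial.X v)
    ∑ w ∈ P.vars,
      (Finsupp.lsingle w).comp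
        ((AQaug R S n ((MvPolynomial.pderiv w) P) : S) • (LinearMap.id : M →ₗ[S] M))

/-- The differential `L_{n+1} ⊗ M → L_n ⊗ M` of the cotangent complex:
the alternating sum of the maps induced by the face maps. -/
def AQdiff (n : ℕ) : (AQV R S (n+1) →₀ M) →ₗ[S] (AQV R S n →₀ M) :=
  ∑ i ∈ Finset.range (n+2), ((-1 : ℤ)^i) • AQind R S M n (AQface R S n i)

/-- Cycles of the cotangent complex with coefficients in `M`. -/
def AQcycles : (n : ℕ) → Submodule S (AQV R S n →₀ M)
  | 0 => ⊤
  | n+1 => LinearMap.ker (AQdiff R S M n)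

/-- André–Quillen homology `D_n(S|R, M)`. -/
def AQH (n : ℕ) : Type u :=
  AQcycles R S M n ⧸
    (LinearMap.range (AQdiff R S M n)).comap (AQcycles R S M n).subtype

noncomputable instance (n : ℕ) : AddCommGroup (AQH R S M n) :=
  inferInstanceAs (AddCommGroup (AQcycles R S M n ⧸
    (LinearMap.range (AQdiff R S M n)).comap (AQcycles R S M n).subtype))

/-- `AQdimLE R S d`: the André–Quillen dimension of the `R`-algebra `S` is at
most `d`, i.e. `D_n(S|R, -) = 0` for all `n > d`. -/
def AQdimLE (d : ℕ) : Prop :=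
  ∀ n : ℕ, d < n → ∀ (N : Type u) (iN : AddCommGroup N) (mN : Module S N),
    Subsingleton (@AQH R S _ _ _ N iN mN n)

/-- `AQ-dim_R S < ∞`. -/
def AQdimFinite : Prop := ∃ d : ℕ, AQdimLE R S d

/-! ### Koszul homology `H₁` -/

/-- First differential of the Koszul complex on `x : Fin c → A`. -/
def koszulD1 (A : Type u) [CommRing A] {c : ℕ} (x : Fin c → A) : (Fin c → A) →ₗ[A] A :=
  ∑ i, x i • (LinearMap.proj i : ((Fin c → A)) →ₗ[A] A)

/-- One-cycles of the Koszul complex on `x`. -/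
def koszulZ1 (A : Type u) [CommRing A] {c : ℕ} (x : Fin c → A) : Submodule A (Fin c → A) :=
  LinearMap.ker (koszulD1 A x)

/-- One-boundaries of the Koszul complex on `x` (the image of the second Koszul
differential, spanned by the elements `xᵢ eⱼ - xⱼ eᵢ`). -/
def koszulB1 (A : Type u) [CommRing A] {c : ℕ} (x : Fin c → A) : Submodule A (Fin c → A) :=
  Submodule.span A
    {v : Fin c → A | ∃ i j, v =
      x i • (Pi.single j (1 : A) : Fin c → A) - x j • (Pi.single i (1 : A) : Fin c → A)}

/-- First Koszul homology of the sequence `x : Fin c → A`. -/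
def KoszulH1 (A : Type u) [CommRing A] {c : ℕ} (x : Fin c → A) : Type u :=
  koszulZ1 A x ⧸ (koszulB1 A x).comap (koszulZ1 A x).subtype

noncomputable instance (A : Type u) [CommRing A] {c : ℕ} (x : Fin c → A) :
    AddCommGroup (KoszulH1 A x) :=
  inferInstanceAs (AddCommGroup (koszulZ1 A x ⧸ (koszulB1 A x).comap (koszulZ1 A x).subtype))

noncomputable instance (A : Type u) [CommRing A] {c : ℕ} (x : Fin c → A) :
    Module A (KoszulH1 A x) :=
  inferInstanceAs (Module A (koszulZ1 A x ⧸ (koszulB1 A x).comap (koszulZ1 A x).subtype))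

/-- `H₁(K(σ))` is a free `T̂`-module:  for any Cohen factorization
`S → S'' → T̂` of the semi-completion of `σ` and any finite generating set `x` of
`ker (S'' → T̂)`, the first Koszul homology of `x`, base-changed to `T̂`
(it is killed by `ker (S'' → T̂)`), is a free `T̂`-module. -/
def KoszulH1FreeHom (S T : Type u) [CommRing S] [CommRing T] [IsLocalRing S] [IsLocalRing T]
    (σ : S →+* T) : Prop :=
  ∀ (S'' : Type u) (_ : CommRing S'') (f : S →+* S'')
    (g : S'' →+* AdicCompletion (maximalIdeal T) T),
    IsCohenFactorizationAt S T σ (maximalIdeal T) S'' f g →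
    ∀ (c : ℕ) (x : Fin c → S''), Ideal.span (Set.range x) = RingHom.ker g →
      (letI := g.toAlgebra;
       Module.Free (AdicCompletion (maximalIdeal T) T)
         ((AdicCompletion (maximalIdeal T) T) ⊗[S''] (KoszulH1 S'' x)))

/-! ### Separability (MacLane) -/

/-- A field extension `ℓ/k` is separable (in the sense of MacLane, allowing
non-algebraic extensions) iff `K ⊗_k ℓ` is reduced for every field extension `K/k`. -/
def IsSeparableFieldExtension (k ℓ : Type u) [Field k] [Field ℓ] [Algebra k ℓ] : Prop :=
  ∀ (K : Type u) (_ : Field K) (_ : Algebra k K), IsReduced (K ⊗[k] ℓ)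

end


set_option linter.style.haveILetI false

open TensorProduct IsLocalRing

section part1
/-- inductive version of being generated by a regular sequence of length `n` -/
def GRSn : ℕ → (A : Type u) → [CommRing A] → Ideal A → Prop
  | 0, A, _, I => I = ⊥ ∧ Nontrivial A
  | n+1, A, _, I => ∃ r ∈ I, IsSMulRegular A r ∧
      GRSn n (A ⧸ Ideal.span {r}) (I.map (Ideal.Quotient.mk (Ideal.span {r})))

open scoped Pointwise in
noncomputable def quotSMulTopSelfEquiv (A : Type u) [CommRing A] (r : A) :
    QuotSMulTop r A ≃ₗ[A ⧸ Ideal.span {r}] (A ⧸ Ideal.span {r}) := by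
  have h : (r • (⊤ : Submodule A A)) = Ideal.span {r} := by
    ext x
    simp [Submodule.mem_smul_pointwise_iff_exists, Ideal.mem_span_singleton', mul_comm]
  exact
    { toFun := Submodule.quotEquivOfEq _ _ h
      invFun := (Submodule.quotEquivOfEq _ _ h).symm
      left_inv := fun x => by simp
      right_inv := fun x => by simp
      map_add' := fun x y => by simp
      map_smul' := fun a x => by
        obtain ⟨a, rfl⟩ := Ideal.Quotient.mk_surjective a
        exact (Submodule.quotEquivOfEq _ _ h).map_smul a x }

theorem isRegular_self_cons_iff {A : Type u} [CommRing A] (r : A) (rs : List A) :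
    RingTheory.Sequence.IsRegular A (r :: rs) ↔ IsSMulRegular A r ∧
      RingTheory.Sequence.IsRegular (A ⧸ Ideal.span {r})
        (rs.map (Ideal.Quotient.mk (Ideal.span {r}))) := by
  rw [RingTheory.Sequence.isRegular_cons_iff', (quotSMulTopSelfEquiv A r).isRegular_congr]

theorem GRSn_iff_list (n : ℕ) (A : Type u) [CommRing A] (I : Ideal A) :
    GRSn n A I ↔ ∃ rs : List A, rs.length = n ∧ RingTheory.Sequence.IsRegular A rs ∧
      Ideal.ofList rs = I := by
  induction n generalizing A with
  | zero =>
    constructor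
    · rintro ⟨rfl, h⟩
      exact ⟨[], rfl, RingTheory.Sequence.IsRegular.nil A A, by simp⟩
    · rintro ⟨rs, h, h1, h2⟩
      obtain rfl := List.length_eq_zero_iff.1 h
      exact ⟨by simpa using h2.symm, h1.nontrivial⟩
  | succ n ih =>
    constructor
    · rintro ⟨r, hr, hreg, h⟩
      rw [ih] at h
      obtain ⟨rs, hl, hrs, hI⟩ := h
      obtain ⟨rs', rfl⟩ : ∃ rs' : List A, rs'.map (Ideal.Quotient.mk (Ideal.span {r})) = rs :=
        ⟨rs.map (Function.surjInv Ideal.Quotient.mk_surjective), by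
          simp [List.map_map, Function.comp_def, Function.surjInv_eq]⟩
      refine ⟨r :: rs', by simpa using hl, (isRegular_self_cons_iff r rs').2 ⟨hreg, hrs⟩, ?_⟩
      rw [← Ideal.map_ofList] at hI
      have := congrArg (Ideal.comap (Ideal.Quotient.mk (Ideal.span {r}))) hI
      rw [Ideal.comap_map_of_surjective _ Ideal.Quotient.mk_surjective,
        Ideal.comap_map_of_surjective _ Ideal.Quotient.mk_surjective,
        ← RingHom.ker_eq_comap_bot, Ideal.mk_ker] at this
      rw [Ideal.ofList_cons, sup_comm, this, sup_eq_left]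
      simpa [Ideal.span_le] using hr
    · rintro ⟨rs, hl, hrs, rfl⟩
      match rs, hl with
      | r :: rs, hl =>
        rw [isRegular_self_cons_iff] at hrs
        refine ⟨r, Ideal.subset_span (by simp), hrs.1, (ih _ _).2 ⟨_, by simpa using hl, hrs.2, ?_⟩⟩
        rw [← Ideal.map_ofList, Ideal.ofList_cons, Ideal.map_sup, Ideal.map_span]
        simp


theorem GRS_iff {A : Type u} [CommRing A] {I : Ideal A} :
    GeneratedByRegularSequence A I ↔ ∃ n, GRSn n A I := by
  constructor
  · rintro ⟨rs, h, h1⟩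
    exact ⟨rs.length, (GRSn_iff_list _ _ _).2 ⟨rs, rfl, h, h1⟩⟩
  · rintro ⟨n, h⟩
    obtain ⟨rs, -, h, h1⟩ := (GRSn_iff_list _ _ _).1 h
    exact ⟨rs, h, h1⟩

theorem GRSn.ne_top {n : ℕ} {A : Type u} [CommRing A] {I : Ideal A} (h : GRSn n A I) : I ≠ ⊤ := by
  obtain ⟨rs, -, h1, rfl⟩ := (GRSn_iff_list _ _ _).1 h
  have := h1.top_ne_smul
  intro h'
  rw [h'] at this
  exact this (by simp)

theorem ker_of_equiv_span {A B : Type u} [CommRing A] [CommRing B] (e : A ≃+* B) (I : Ideal A) :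
    I.map (e : A →+* B) = I.comap (e.symm : B →+* A) := by
  exact Ideal.map_comap_of_equiv e

theorem GRSn.equiv {n : ℕ} {A B : Type u} [CommRing A] [CommRing B] (e : A ≃+* B) {I : Ideal A}
    (h : GRSn n A I) : GRSn n B (I.map (e : A →+* B)) := by
  obtain ⟨rs, h1, h2, rfl⟩ := (GRSn_iff_list _ _ _).1 h
  refine (GRSn_iff_list _ _ _).2 ⟨rs.map e, by simpa using h1, ?_, ?_⟩
  · have key : ∀ x y : A, e (x * y) = e x * e y := fun x y => by simp
    refine (AddEquiv.isRegular_congr (e := (e : A ≃+ B)) ?_).1 h2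
    rw [List.forall₂_map_right_iff, List.forall₂_same]
    intro r _ x
    simp
  · rw [Ideal.map_ofList]; rfl

theorem isSMulRegular_of_equiv {A B : Type u} [CommRing A] [CommRing B] (e : A ≃+* B) {r : A}
    (h : IsSMulRegular A r) : IsSMulRegular B (e r) := by
  intro x y hxy
  apply e.symm.injective
  apply h
  simpa using congrArg e.symm hxy

theorem GRSn.cons {n : ℕ} {A B : Type u} [CommRing A] [CommRing B] {π : A →+* B}
    (hπ : Function.Surjective π) {r : A} (hk : RingHom.ker π = Ideal.span {r})
    (hr : IsSMulRegular A r) {I : Ideal A} (hI : r ∈ I) (h : GRSn n B (I.map π)) :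
    GRSn (n+1) A I := by
  refine ⟨r, hI, hr, ?_⟩
  let e : B ≃+* A ⧸ Ideal.span {r} :=
    (RingHom.quotientKerEquivOfSurjective hπ).symm.trans (Ideal.quotEquivOfEq hk)
  have := h.equiv e
  rw [Ideal.map_map] at this
  convert this using 2
  ext x
  simp only [RingHom.coe_comp, RingHom.coe_coe, Function.comp_apply, e, RingEquiv.trans_apply]
  have : (RingHom.quotientKerEquivOfSurjective hπ).symm (π x) = Ideal.Quotient.mk _ x := by
    rw [RingEquiv.symm_apply_eq]; rfl
  rw [this]; rfl

theorem GRSn.uncons {n : ℕ} {A : Type u} [CommRing A] {I : Ideal A} (h : GRSn (n+1) A I) :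
    ∃ r ∈ I, IsSMulRegular A r ∧
      GRSn n (A ⧸ Ideal.span {r}) (I.map (Ideal.Quotient.mk (Ideal.span {r}))) := h

/-- the induced map on a quotient by an element of the kernel -/
theorem GRSn.concat {n m : ℕ} {A B : Type u} [CommRing A] [CommRing B] {π : A →+* B}
    (hπ : Function.Surjective π) (h : GRSn n A (RingHom.ker π)) {J : Ideal B} (hJ : GRSn m B J) :
    GRSn (n+m) A (J.comap π) := by
  induction n generalizing A with
  | zero =>
    obtain ⟨h, _⟩ := h
    have hb : Function.Bijective π := ⟨(RingHom.injective_iff_ker_eq_bot π).2 h, hπ⟩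
    have := hJ.equiv (RingEquiv.ofBijective π hb).symm
    rw [zero_add]
    convert this using 1
    exact (Ideal.map_comap_of_equiv (RingEquiv.ofBijective π hb).symm).symm
  | succ n ih =>
    obtain ⟨r, hr, hreg, h⟩ := h
    have hle : ∀ a ∈ Ideal.span {r}, π a = 0 := fun a ha =>
      (Ideal.span_le.2 (by simpa using hr) : Ideal.span {r} ≤ RingHom.ker π) ha
    let π' : A ⧸ Ideal.span {r} →+* B := Ideal.Quotient.lift _ π hle
    have hπ' : Function.Surjective π' := Ideal.Quotient.lift_surjective_of_surjective _ hle hπ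
    have h1 : RingHom.ker π' = (RingHom.ker π).map (Ideal.Quotient.mk (Ideal.span {r})) :=
      Ideal.ker_quotient_lift π _
    have h2 := ih hπ' (h1 ▸ h)
    have : n + 1 + m = (n + m) + 1 := by omega
    rw [this]
    refine ⟨r, ?_, hreg, ?_⟩
    · rw [Ideal.mem_comap, hr]; exact J.zero_mem
    · convert h2
      ext x
      obtain ⟨x, rfl⟩ := Ideal.Quotient.mk_surjective x
      rw [← Ideal.mem_comap, Ideal.comap_map_of_surjective _ Ideal.Quotient.mk_surjective,
        ← RingHom.ker_eq_comap_bot, Ideal.mk_ker, sup_eq_left.2]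
      · rfl
      · intro a ha
        rw [Ideal.mem_comap, hle a ha]; exact J.zero_mem

theorem exists_perm_unit {A : Type u} [CommRing A] [IsLocalRing A] (rs : List A) (v : A)
    (hv : v ∈ Ideal.ofList rs) (hv' : v ∉ maximalIdeal A * Ideal.ofList rs) :
    ∃ (r : A) (rs' : List A) (a : A), rs.Perm (r :: rs') ∧ IsUnit a ∧
      v - a * r ∈ Ideal.ofList rs' := by
  induction rs generalizing v with
  | nil => simp at hv; subst hv; simp at hv'
  | cons r rs ih =>
    rw [Ideal.ofList_cons, Submodule.mem_sup] at hv
    obtain ⟨y, hy, w, hw, rfl⟩ := hv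
    obtain ⟨a, rfl⟩ := Ideal.mem_span_singleton'.1 hy
    by_cases ha : IsUnit a
    · exact ⟨r, rs, a, List.Perm.refl _, ha, by simpa using hw⟩
    · have hw' : w ∉ maximalIdeal A * Ideal.ofList rs := by
        intro h
        apply hv'
        rw [Ideal.ofList_cons, Ideal.mul_sup]
        refine add_mem (Ideal.mem_sup_left ?_) (Ideal.mem_sup_right h)
        exact Ideal.mul_mem_mul ((mem_maximalIdeal _).2 ha) (Ideal.mem_span_singleton_self r)
      obtain ⟨s, rs', b, hp, hb, hm⟩ := ih w hw hw'
      refine ⟨s, r :: rs', b, (List.Perm.cons r hp).trans (List.Perm.swap _ _ _), hb, ?_⟩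
      have : a * r + w - b * s = a * r + (w - b * s) := by ring
      rw [this, Ideal.ofList_cons]
      exact add_mem (Ideal.mem_sup_left (Ideal.mem_span_singleton'.2 ⟨a, rfl⟩))
        (Ideal.mem_sup_right hm)

theorem ofList_perm {A : Type u} [CommRing A] {l l' : List A} (h : l.Perm l') :
    Ideal.ofList l = Ideal.ofList l' := by
  unfold Ideal.ofList
  congr 1; ext x; exact h.mem_iff

theorem GRSn.exchange {n : ℕ} {A : Type u} [CommRing A] [IsLocalRing A] [IsNoetherianRing A]
    {I : Ideal A} (h : GRSn (n+1) A I) {v : A} (hv : v ∈ I) (hv' : v ∉ maximalIdeal A * I) :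
    IsSMulRegular A v ∧
      GRSn n (A ⧸ Ideal.span {v}) (I.map (Ideal.Quotient.mk (Ideal.span {v}))) := by
  obtain ⟨rs, h1, h2, rfl⟩ := (GRSn_iff_list _ _ _).1 h
  obtain ⟨r, rs', a, hp, ha, hm⟩ := exists_perm_unit rs v hv hv'
  have hp' : rs.Perm (rs' ++ [r]) := hp.trans (List.perm_append_comm (l₁ := [r]))
  have h3 := IsLocalRing.isRegular_of_perm h2 hp'
  have hspan : Ideal.ofList (rs' ++ [v]) = Ideal.ofList (rs' ++ [r]) := by
    rw [Ideal.ofList_append, Ideal.ofList_append, Ideal.ofList_singleton, Ideal.ofList_singleton]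
    apply le_antisymm
    · refine sup_le le_sup_left ?_
      rw [Ideal.span_le, Set.singleton_subset_iff]
      have : v = (v - a * r) + a * r := by ring
      rw [SetLike.mem_coe, this]
      exact add_mem (Ideal.mem_sup_left hm) (Ideal.mem_sup_right (Ideal.mem_span_singleton'.2 ⟨a, rfl⟩))
    · refine sup_le le_sup_left ?_
      rw [Ideal.span_le, Set.singleton_subset_iff]
      obtain ⟨b, hb⟩ := ha.exists_left_inv
      have : r = b * v - b * (v - a * r) := by linear_combination (-r) * hb
      rw [SetLike.mem_coe, this]
      exact sub_mem (Ideal.mem_sup_right (Ideal.mem_span_singleton'.2 ⟨b, rfl⟩))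
        (Ideal.mem_sup_left (Ideal.mul_mem_left _ _ hm))
  have h4 : RingTheory.Sequence.IsRegular A (rs' ++ [v]) := by
    refine ⟨?_, ?_⟩
    · have h5 := h3.toIsWeaklyRegular
      rw [RingTheory.Sequence.isWeaklyRegular_append_iff,
        RingTheory.Sequence.isWeaklyRegular_singleton_iff] at h5 ⊢
      refine ⟨h5.1, ?_⟩
      intro x y hxy
      apply h5.2
      apply (ha.isSMulRegular (A ⧸ (Ideal.ofList rs' • ⊤ : Ideal A)))
      simp only at hxy ⊢
      rw [← mul_smul, ← mul_smul]
      have key : ∀ z : A ⧸ (Ideal.ofList rs' • ⊤ : Ideal A), (a * r) • z = v • z := by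
        intro z
        obtain ⟨z, rfl⟩ := Submodule.Quotient.mk_surjective _ z
        rw [← Submodule.Quotient.mk_smul, ← Submodule.Quotient.mk_smul, Submodule.Quotient.eq]
        rw [← sub_smul, ← neg_sub, neg_smul]
        exact neg_mem (Submodule.smul_mem_smul hm trivial)
      rw [key, key, hxy]
    · rw [hspan]; exact h3.top_ne_smul
  have h5 := IsLocalRing.isRegular_of_perm h4 (List.perm_append_comm (l₂ := [v]))
  rw [List.singleton_append, isRegular_self_cons_iff] at h5
  refine ⟨h5.1, (GRSn_iff_list _ _ _).2 ⟨_, ?_, h5.2, ?_⟩⟩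
  · have := hp.length_eq
    simp at this ⊢; omega
  · rw [← Ideal.map_ofList, ofList_perm hp', ← hspan, Ideal.ofList_append, Ideal.map_sup,
      Ideal.ofList_singleton, Ideal.map_span (Ideal.Quotient.mk (Ideal.span {v})) {v}]
    simp
end part1

section part2
theorem flat_elem {A B : Type u} [CommRing A] [CommRing B] {f : A →+* B} (hf : f.Flat)
    {ι : Type*} [Fintype ι] (a : ι → A) (b : ι → B) (h : ∑ i, f (a i) * b i = 0) :
    ∃ (k : ℕ) (α : ι → Fin k → A) (y : Fin k → B),
      (∀ i, b i = ∑ j, f (α i j) * y j) ∧ ∀ j, ∑ i, a i * α i j = 0 := by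
  letI := f.toAlgebra
  have : Module.Flat A B := hf
  exact Module.Flat.isTrivialRelation_of_sum_smul_eq_zero (R := A) (M := B) (f := a) (x := b) h

theorem flat_of_elem {A B : Type u} [CommRing A] [CommRing B] {f : A →+* B}
    (H : ∀ (l : ℕ) (a : Fin l → A) (b : Fin l → B), ∑ i, f (a i) * b i = 0 →
    ∃ (k : ℕ) (α : Fin l → Fin k → A) (y : Fin k → B),
      (∀ i, b i = ∑ j, f (α i j) * y j) ∧ ∀ j, ∑ i, a i * α i j = 0) : f.Flat := by
  letI := f.toAlgebra
  show Module.Flat A B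
  rw [Module.Flat.iff_forall_isTrivialRelation]
  intro l a b h
  exact H l a b h

theorem mem_map_iff_sum {A B : Type u} [CommRing A] [CommRing B] {f : A →+* B} {I : Ideal A} {x : B} :
    x ∈ I.map f ↔ ∃ (k : ℕ) (a : Fin k → A) (b : Fin k → B), (∀ i, a i ∈ I) ∧
      x = ∑ i, f (a i) * b i := by
  constructor
  · intro h
    rw [Ideal.map] at h
    induction h using Submodule.span_induction with
    | mem x h =>
      obtain ⟨a, ha, rfl⟩ := h
      exact ⟨1, fun _ => a, fun _ => 1, fun _ => ha, by simp⟩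
    | zero => exact ⟨0, fun _ => 0, fun _ => 0, fun _ => I.zero_mem, by simp⟩
    | add x y _ _ hx hy =>
      obtain ⟨k, a, b, h1, h2⟩ := hx
      obtain ⟨k', a', b', h1', h2'⟩ := hy
      refine ⟨k + k', Fin.append a a', Fin.append b b', ?_, ?_⟩
      · intro i
        refine Fin.addCases (fun i => ?_) (fun i => ?_) i <;> simp [h1, h1']
      · simp [Fin.sum_univ_add, h2, h2']
    | smul c x _ hx =>
      obtain ⟨k, a, b, h1, h2⟩ := hx
      refine ⟨k, a, fun i => c * b i, h1, ?_⟩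
      rw [h2, smul_eq_mul, Finset.mul_sum]
      exact Finset.sum_congr rfl fun i _ => by ring
  · rintro ⟨k, a, b, h1, rfl⟩
    exact Ideal.sum_mem _ fun i _ => Ideal.mul_mem_right _ _ (Ideal.mem_map_of_mem _ (h1 i))

/-- the universal flatness of quotients in a square -/
theorem flat_square {A B A1 B1 : Type u} [CommRing A] [CommRing B] [CommRing A1] [CommRing B1]
    {f : A →+* B} (hf : f.Flat) {p : A →+* A1} {q : B →+* B1} {f1 : A1 →+* B1}
    (hp : Function.Surjective p) (hq : Function.Surjective q)
    (hc : f1.comp p = q.comp f) (hk : RingHom.ker q = (RingHom.ker p).map f) : f1.Flat := by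
  have hc' : ∀ x, f1 (p x) = q (f x) := fun x => congrArg (fun g : A →+* B1 => g x) hc
  apply flat_of_elem
  intro l a b h
  choose a' ha' using fun i => hp (a i)
  choose b' hb' using fun i => hq (b i)
  obtain rfl : (fun i => p (a' i)) = a := funext ha'
  obtain rfl : (fun i => q (b' i)) = b := funext hb'
  have : ∑ i, f (a' i) * b' i ∈ RingHom.ker q := by
    rw [RingHom.mem_ker, map_sum, ← h]
    simp [hc']
  rw [hk, mem_map_iff_sum] at this
  obtain ⟨k, c, d, hc1, hcd⟩ := this
  obtain ⟨m, α, y, h1, h2⟩ := flat_elem hf (Sum.elim a' c) (Sum.elim b' (fun i => - d i)) (by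
    simp [hcd])
  refine ⟨m, fun i j => p (α (Sum.inl i) j), fun j => q (y j), fun i => ?_, fun j => ?_⟩
  · have := congrArg q (h1 (Sum.inl i))
    simpa [hc'] using this
  · have := congrArg p (h2 j)
    simp only [Fintype.sum_sum_type, Sum.elim_inl, Sum.elim_inr, map_add, map_sum, map_mul,
      map_zero] at this
    rw [Finset.sum_eq_zero (s := (Finset.univ : Finset (Fin k))), add_zero] at this
    · exact this
    · intro i _
      rw [(hc1 i : p (c i) = 0), zero_mul]

/-- colon ideals and flatness -/
theorem flat_colon {A B : Type u} [CommRing A] [CommRing B] {f : A →+* B} (hf : f.Flat)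
    {𝔞 𝔠 : Ideal A} {a : A} (h : ∀ r, a * r ∈ 𝔞 → r ∈ 𝔠) {x : B} (hx : f a * x ∈ 𝔞.map f) :
    x ∈ 𝔠.map f := by
  obtain ⟨k, c, d, hc1, hcd⟩ := mem_map_iff_sum.1 hx
  obtain ⟨m, α, y, h1, h2⟩ := flat_elem hf (Sum.elim (fun _ : Unit => a) c)
    (Sum.elim (fun _ => x) (fun i => - d i)) (by simp [hcd])
  have h3 := h1 (Sum.inl ())
  simp only [Sum.elim_inl] at h3
  rw [h3]
  refine Ideal.sum_mem _ fun j _ => Ideal.mul_mem_right _ _ (Ideal.mem_map_of_mem _ (h _ ?_))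
  have := h2 j
  simp only [Fintype.sum_sum_type, Sum.elim_inl, Sum.elim_inr, Finset.univ_unique,
    Finset.sum_singleton] at this
  rw [← neg_eq_of_add_eq_zero_left this]
  exact neg_mem (Ideal.sum_mem _ fun i _ => Ideal.mul_mem_right _ _ (hc1 i))

theorem flat_local_mem {A B : Type u} [CommRing A] [CommRing B] [IsLocalRing A] [IsLocalRing B]
    {f : A →+* B} (hf : f.Flat) [IsLocalHom f] {𝔞 : Ideal A} {x : A} (hx : f x ∈ 𝔞.map f) :
    x ∈ 𝔞 := by
  by_contra hxa
  have h1 : (1 : B) ∈ (maximalIdeal A).map f := by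
    apply flat_colon hf (𝔞 := 𝔞) (a := x)
    · intro r hr
      rw [mem_maximalIdeal]
      intro hu
      obtain ⟨s, hs⟩ := hu.exists_right_inv
      apply hxa
      have : x = x * r * s := by rw [mul_assoc, hs, mul_one]
      rw [this]; exact Ideal.mul_mem_right _ _ hr
    · simpa using hx
  have h2 : (maximalIdeal A).map f ≤ maximalIdeal B :=
    map_maximalIdeal_le f
  exact (maximalIdeal.isMaximal B).ne_top ((Ideal.eq_top_iff_one _).2 (h2 h1))

theorem flat_local_injective {A B : Type u} [CommRing A] [CommRing B] [IsLocalRing A] [IsLocalRing B]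
    {f : A →+* B} (hf : f.Flat) [IsLocalHom f] : Function.Injective f := by
  rw [injective_iff_map_eq_zero]
  intro x hx
  have := flat_local_mem hf (𝔞 := ⊥) (x := x) (by simp [hx])
  simpa using this

theorem flat_local_map_ne_top {A B : Type u} [CommRing A] [CommRing B] [IsLocalRing A] [IsLocalRing B]
    {f : A →+* B} [IsLocalHom f] {I : Ideal A} (hI : I ≠ ⊤) : I.map f ≠ ⊤ := by
  have h2 : (maximalIdeal A).map f ≤ maximalIdeal B :=
    map_maximalIdeal_le f
  intro h
  apply (maximalIdeal.isMaximal B).ne_top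
  rw [eq_top_iff, ← h]
  exact (Ideal.map_mono (le_maximalIdeal hI)).trans h2

/-- core of the local criterion: nilpotent case -/
theorem regular_mod_core {R B : Type u} [CommRing R] [IsNoetherianRing R] [CommRing B]
    {f : R →+* B} (hf : f.Flat) (m : Ideal R) [hm : m.IsMaximal] {v : B}
    (hv : ∀ b, v * b ∈ m.map f → b ∈ m.map f) (N : ℕ) (𝔞 : Ideal R) (h𝔞 : m ^ N ≤ 𝔞) :
    ∀ b, v * b ∈ 𝔞.map f → b ∈ 𝔞.map f := by
  induction 𝔞 using WellFoundedGT.induction with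
  | ind 𝔞 ih =>
    intro b hb
    by_cases htop : 𝔞 = ⊤
    · rw [htop, Ideal.map_top]; trivial
    obtain ⟨k, hk, hk'⟩ : ∃ k, m ^ (k+1) ≤ 𝔞 ∧ ¬ m ^ k ≤ 𝔞 := by
      classical
      have hex : ∃ N, m ^ N ≤ 𝔞 := ⟨N, h𝔞⟩
      have h1 := Nat.find_spec hex
      have h0 : Nat.find hex ≠ 0 := by
        intro h0
        rw [h0, pow_zero, Ideal.one_eq_top, top_le_iff] at h1
        exact htop h1
      obtain ⟨k, hk⟩ := Nat.exists_eq_succ_of_ne_zero h0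
      refine ⟨k, by rw [← Nat.succ_eq_add_one, ← hk]; exact h1, Nat.find_min hex (by omega)⟩
    obtain ⟨a, ha, ha'⟩ := Set.not_subset.1 hk'
    have hma : ∀ x ∈ m, a * x ∈ 𝔞 := fun x hx => hk (by
      rw [pow_succ]; exact Ideal.mul_mem_mul ha hx)
    have hcol : ∀ r, a * r ∈ 𝔞 → r ∈ m := by
      intro r hr
      by_contra hrm
      obtain ⟨y, i, hi, hyi⟩ := hm.exists_inv hrm
      apply ha'
      have : a = a * r * y + a * i := by linear_combination (-a) * hyi
      rw [SetLike.mem_coe, this]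
      exact add_mem (Ideal.mul_mem_right _ _ hr) (hma i hi)
    have hlt : 𝔞 < 𝔞 ⊔ Ideal.span {a} := by
      refine lt_of_le_of_ne le_sup_left fun h => ha' ?_
      rw [SetLike.mem_coe, h]
      exact Ideal.mem_sup_right (Ideal.mem_span_singleton_self a)
    have hb' : b ∈ (𝔞 ⊔ Ideal.span {a}).map f :=
      ih _ hlt (h𝔞.trans le_sup_left) b (Ideal.map_mono le_sup_left hb)
    rw [Ideal.map_sup, Ideal.map_span, Set.image_singleton, Submodule.mem_sup] at hb'
    obtain ⟨d, hd, e, he, rfl⟩ := hb'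
    obtain ⟨c, rfl⟩ := Ideal.mem_span_singleton'.1 he
    refine add_mem hd ?_
    have h1 : f a * (v * c) ∈ 𝔞.map f := by
      have : f a * (v * c) = v * (d + c * f a) - v * d := by ring
      rw [this]
      exact sub_mem hb (Ideal.mul_mem_left _ _ hd)
    have h2 : c ∈ m.map f := hv c (flat_colon hf hcol h1)
    obtain ⟨k, c', d', hc1, rfl⟩ := mem_map_iff_sum.1 h2
    rw [Finset.sum_mul]
    refine Ideal.sum_mem _ fun i _ => ?_
    have : f (c' i) * d' i * f a = d' i * f (a * c' i) := by rw [map_mul]; ring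
    rw [this]
    exact Ideal.mul_mem_left _ _ (Ideal.mem_map_of_mem _ (hma _ (hc1 i)))

theorem flat_quot_of_regular {R B B1 : Type u} [CommRing R] [CommRing B] [CommRing B1]
    {f : R →+* B} (hf : f.Flat) {v : B} {π : B →+* B1} (hπ : Function.Surjective π)
    (hk : RingHom.ker π = Ideal.span {v})
    (hv : ∀ 𝔞 : Ideal R, ∀ b, v * b ∈ 𝔞.map f → b ∈ 𝔞.map f) : (π.comp f).Flat := by
  apply flat_of_elem
  intro l a b h
  choose b' hb' using fun i => hπ (b i)
  obtain rfl : (fun i => π (b' i)) = b := funext hb'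
  have : ∑ i, f (a i) * b' i ∈ RingHom.ker π := by
    rw [RingHom.mem_ker, ← h]; simp
  rw [hk] at this
  obtain ⟨c, hc⟩ := Ideal.mem_span_singleton.1 this
  have hc' := hv (Ideal.span (Set.range a)) c (by
    rw [← hc]
    exact Ideal.sum_mem _ fun i _ => Ideal.mul_mem_right _ _
      (Ideal.mem_map_of_mem _ (Ideal.subset_span ⟨i, rfl⟩)))
  rw [Ideal.map_span, ← Set.range_comp, Ideal.mem_span_range_iff_exists_fun] at hc'
  obtain ⟨d, hd⟩ := hc'
  obtain ⟨m, α, y, h1, h2⟩ := flat_elem hf a (fun i => b' i - v * d i) (by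
    simp only [mul_sub, Finset.sum_sub_distrib]
    rw [hc, ← hd, Finset.mul_sum, sub_eq_zero]
    exact Finset.sum_congr rfl fun i _ => by simp only [Function.comp]; ring)
  refine ⟨m, α, fun j => π (y j), fun i => ?_, h2⟩
  have h3 := congrArg π (h1 i)
  have h4 : π v = 0 := by
    rw [← RingHom.mem_ker, hk]; exact Ideal.mem_span_singleton_self v
  simpa [h4] using h3

theorem krull_mem {B : Type u} [CommRing B] [IsLocalRing B] [IsNoetherianRing B] {J : Ideal B} {b : B}
    (h : ∀ j : ℕ, b ∈ J ⊔ maximalIdeal B ^ j) : b ∈ J := by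
  by_cases hJ : J = ⊤
  · rw [hJ]; trivial
  have : Nontrivial (B ⧸ J) := Ideal.Quotient.nontrivial_iff.2 hJ
  have : IsLocalRing (B ⧸ J) := IsLocalRing.of_surjective' (Ideal.Quotient.mk J) Ideal.Quotient.mk_surjective
  have h1 := Ideal.iInf_pow_eq_bot_of_isLocalRing
    ((maximalIdeal B).map (Ideal.Quotient.mk J)) (by
      rw [← lt_top_iff_ne_top]
      refine lt_of_le_of_lt ?_ (lt_top_iff_ne_top.2 (maximalIdeal.isMaximal (B ⧸ J)).ne_top)
      have : IsLocalHom (Ideal.Quotient.mk J) := IsLocalHom.of_surjective _ Ideal.Quotient.mk_surjective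
      exact map_maximalIdeal_le _)
  rw [← Ideal.Quotient.eq_zero_iff_mem, ← Ideal.mem_bot, ← h1, Ideal.mem_iInf]
  intro j
  rw [← Ideal.map_pow]
  obtain ⟨x, hx, y, hy, rfl⟩ := Submodule.mem_sup.1 (h j)
  rw [map_add, Ideal.Quotient.eq_zero_iff_mem.2 hx, zero_add]
  exact Ideal.mem_map_of_mem _ hy

theorem regular_mod_local {R B : Type u} [CommRing R] [IsNoetherianRing R] [CommRing B] [IsLocalRing R]
    [IsLocalRing B] [IsNoetherianRing B]
    {f : R →+* B} [IsLocalHom f] (hf : f.Flat) {v : B}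
    (hv : ∀ b, v * b ∈ (maximalIdeal R).map f → b ∈ (maximalIdeal R).map f) (𝔞 : Ideal R) :
    ∀ b, v * b ∈ 𝔞.map f → b ∈ 𝔞.map f := by
  intro b hb
  apply krull_mem
  intro j
  have := regular_mod_core hf (maximalIdeal R) hv j (𝔞 ⊔ maximalIdeal R ^ j) le_sup_right b
    (Ideal.map_mono le_sup_left hb)
  rw [Ideal.map_sup, Ideal.map_pow] at this
  exact sup_le_sup_left (Ideal.pow_right_mono (map_maximalIdeal_le f) j) _ this

theorem isSMulRegular_iff_mul {B : Type u} [CommRing B] {v : B} :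
    IsSMulRegular B v ↔ ∀ b, v * b = 0 → b = 0 := by
  constructor
  · intro h b hb
    exact h (by simpa using hb)
  · intro h x y hxy
    rw [← sub_eq_zero]
    apply h
    rw [mul_sub, sub_eq_zero]; exact hxy

theorem regular_of_local {R B : Type u} [CommRing R] [IsNoetherianRing R] [CommRing B] [IsLocalRing R]
    [IsLocalRing B] [IsNoetherianRing B]
    {f : R →+* B} [IsLocalHom f] (hf : f.Flat) {v : B}
    (hv : ∀ b, v * b ∈ (maximalIdeal R).map f → b ∈ (maximalIdeal R).map f) :
    IsSMulRegular B v := by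
  rw [isSMulRegular_iff_mul]
  intro b hb
  have := regular_mod_local hf hv ⊥ b (by simp [hb])
  simpa using this
end part2

section part3
theorem flat_equiv {A B : Type u} [CommRing A] [CommRing B] (e : A ≃+* B) :
    (e : A →+* B).Flat := RingHom.Flat.of_bijective (f := (e : A →+* B)) e.bijective

noncomputable def quotHom {A B : Type u} [CommRing A] [CommRing B] (f : A →+* B) (r : A) :
    A ⧸ Ideal.span {r} →+* B ⧸ Ideal.span {f r} :=
  Ideal.quotientMap _ f (by
    rw [Ideal.span_le, Set.singleton_subset_iff]
    exact Ideal.mem_span_singleton_self (f r))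

section
variable {A B : Type u} [CommRing A] [CommRing B] (f : A →+* B) (r : A)

theorem quotHom_mk (x : A) : quotHom f r (Ideal.Quotient.mk _ x) = Ideal.Quotient.mk _ (f x) := rfl

theorem quotHom_comp : (quotHom f r).comp (Ideal.Quotient.mk _) = (Ideal.Quotient.mk _).comp f := rfl

theorem quotHom_surj (hf : Function.Surjective f) : Function.Surjective (quotHom f r) := by
  intro y
  obtain ⟨y, rfl⟩ := Ideal.Quotient.mk_surjective y
  obtain ⟨x, rfl⟩ := hf y
  exact ⟨Ideal.Quotient.mk _ x, rfl⟩

theorem quotHom_ker (hf : Function.Surjective f) :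
    RingHom.ker (quotHom f r) = (RingHom.ker f).map (Ideal.Quotient.mk (Ideal.span {r})) := by
  apply le_antisymm
  · intro y hy
    obtain ⟨y, rfl⟩ := Ideal.Quotient.mk_surjective y
    rw [RingHom.mem_ker, quotHom_mk, Ideal.Quotient.eq_zero_iff_mem] at hy
    obtain ⟨c, hc⟩ := Ideal.mem_span_singleton'.1 hy
    obtain ⟨d, rfl⟩ := hf c
    have h1 : y - d * r ∈ RingHom.ker f := by
      rw [RingHom.mem_ker, map_sub, map_mul, hc, sub_self]
    have := Ideal.mem_map_of_mem (Ideal.Quotient.mk (Ideal.span {r})) h1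
    rwa [map_sub, map_mul, Ideal.Quotient.mk_singleton_self, mul_zero, sub_zero] at this
  · rw [Ideal.map_le_iff_le_comap]
    intro x hx
    rw [Ideal.mem_comap, RingHom.mem_ker, quotHom_mk, (hx : f x = 0), map_zero]

theorem quotHom_flat (hf : f.Flat) : (quotHom f r).Flat := by
  refine flat_square hf Ideal.Quotient.mk_surjective Ideal.Quotient.mk_surjective
    (quotHom_comp f r) ?_
  rw [Ideal.mk_ker, Ideal.mk_ker, Ideal.map_span, Set.image_singleton]

theorem isLocalRing_quot [IsLocalRing A] {I : Ideal A} (hI : I ≠ ⊤) : IsLocalRing (A ⧸ I) :=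
  have : Nontrivial (A ⧸ I) := Ideal.Quotient.nontrivial_iff.2 hI
  IsLocalRing.of_surjective' (Ideal.Quotient.mk I) Ideal.Quotient.mk_surjective

theorem isLocalHom_mk [IsLocalRing A] {I : Ideal A} (hI : I ≠ ⊤) :
    IsLocalHom (Ideal.Quotient.mk I) :=
  have : Nontrivial (A ⧸ I) := Ideal.Quotient.nontrivial_iff.2 hI
  IsLocalHom.of_surjective _ Ideal.Quotient.mk_surjective

theorem span_ne_top [IsLocalRing A] {r : A} (hr : r ∈ maximalIdeal A) : Ideal.span {r} ≠ ⊤ := by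
  intro h
  rw [Ideal.span_singleton_eq_top] at h
  exact hr h

variable {f}
theorem isSMulRegular_flat (hf : f.Flat) {r : A} (hr : IsSMulRegular A r) :
    IsSMulRegular B (f r) := by
  rw [isSMulRegular_iff_mul] at hr ⊢
  intro b hb
  have := flat_colon hf (𝔞 := ⊥) (𝔠 := ⊥) (a := r) (x := b) (fun s hs => by
    simpa using hr s (by simpa using hs)) (by simp [hb])
  simpa using this
end

theorem GRSn.flat {n : ℕ} {A B : Type u} [CommRing A] [CommRing B] {f : A →+* B} (hf : f.Flat)
    {I : Ideal A} (h : GRSn n A I) (hI : I.map f ≠ ⊤) : GRSn n B (I.map f) := by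
  induction n generalizing A B with
  | zero =>
    obtain ⟨rfl, _⟩ := h
    refine ⟨by simp, ?_⟩
    by_contra hc
    rw [not_nontrivial_iff_subsingleton] at hc
    exact hI (Subsingleton.elim _ _)
  | succ n ih =>
    obtain ⟨r, hr, hreg, h⟩ := h
    have e : (I.map (Ideal.Quotient.mk (Ideal.span {r}))).map (quotHom f r) =
        (I.map f).map (Ideal.Quotient.mk (Ideal.span {f r})) := by
      rw [Ideal.map_map, Ideal.map_map, quotHom_comp]
    refine ⟨f r, Ideal.mem_map_of_mem f hr, isSMulRegular_flat hf hreg, ?_⟩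
    rw [← e]
    refine ih (quotHom_flat f r hf) h ?_
    rw [e]
    intro h'
    have := congrArg (Ideal.comap (Ideal.Quotient.mk (Ideal.span {f r}))) h'
    rw [Ideal.comap_map_of_surjective _ Ideal.Quotient.mk_surjective,
      ← RingHom.ker_eq_comap_bot, Ideal.mk_ker, sup_eq_left.2, Ideal.comap_top] at this
    · exact hI this
    · rw [Ideal.span_le, Set.singleton_subset_iff]
      exact Ideal.mem_map_of_mem f hr

/-- relations modulo a subideal generated by regular element : L1 -/
theorem flat_of_flat_quot {R C C1 : Type u} [CommRing R] [CommRing C] [CommRing C1] [IsLocalRing C]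
    [IsNoetherianRing C] {f : R →+* C} {π : C →+* C1} (hπ : Function.Surjective π) {t : C}
    (ht : t ∈ maximalIdeal C) (hk : RingHom.ker π = Ideal.span {t}) (hreg : IsSMulRegular C t)
    (hf : (π.comp f).Flat) : f.Flat := by
  rw [isSMulRegular_iff_mul] at hreg
  apply flat_of_elem
  intro l a c hac
  let N : Submodule C (Fin l → C) :=
    { carrier := {c | ∑ i, f (a i) * c i = 0}
      add_mem' := fun {x y} hx hy => by
        simp only [Set.mem_ofPred_eq] at *
        simp [mul_add, Finset.sum_add_distrib, hx, hy]
      zero_mem' := by simp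
      smul_mem' := fun s x hx => by
        simp only [Set.mem_ofPred_eq] at *
        have : ∑ i, f (a i) * (s • x) i = s * ∑ i, f (a i) * x i := by
          rw [Finset.mul_sum]; exact Finset.sum_congr rfl fun i _ => by simp; ring
        rw [this, hx, mul_zero] }
  let N0 : Submodule C (Fin l → C) :=
    Submodule.span C {x | ∃ α : Fin l → R, ∑ i, a i * α i = 0 ∧ x = fun i => f (α i)}
  have hN : N ≤ N0 ⊔ maximalIdeal C • N := by
    intro c hc
    obtain ⟨k, α, y, h1, h2⟩ := flat_elem hf a (fun i => π (c i)) (by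
      have := congrArg π (hc : ∑ i, f (a i) * c i = 0)
      simpa using this)
    choose y' hy' using fun j => hπ (y j)
    have h3 : ∀ i, c i - ∑ j, f (α i j) * y' j ∈ Ideal.span {t} := by
      intro i
      rw [← hk, RingHom.mem_ker, map_sub, h1]
      simp [hy']
    choose d hd using fun i => Ideal.mem_span_singleton'.1 (h3 i)
    have h4 : c = (∑ j, y' j • (fun i => f (α i j))) + t • d := by
      ext i
      simp only [Pi.add_apply, Finset.sum_apply, Pi.smul_apply, smul_eq_mul]
      rw [mul_comm t, hd]
      simp only [mul_comm]
      ring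
    have h5 : (∑ j, y' j • (fun i => f (α i j)) : Fin l → C) ∈ N0 :=
      Submodule.sum_mem _ fun j _ => Submodule.smul_mem _ _
        (Submodule.subset_span ⟨fun i => α i j, h2 j, rfl⟩)
    have h6 : N0 ≤ N := by
      rw [Submodule.span_le]
      rintro _ ⟨α, h, rfl⟩
      show ∑ i, f (a i) * f (α i) = 0
      simp only [← map_mul, ← map_sum, h, map_zero]
    have h7 : t • d ∈ N := by
      have : t • d = c - (∑ j, y' j • (fun i => f (α i j))) := by rw [eq_sub_iff_add_eq, h4]; abel
      rw [this]
      exact sub_mem hc (h6 h5)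
    have h8 : d ∈ N := by
      show ∑ i, f (a i) * d i = 0
      apply hreg
      rw [← (h7 : ∑ i, f (a i) * (t • d) i = 0), Finset.mul_sum]
      exact Finset.sum_congr rfl fun i _ => by simp; ring
    rw [h4]
    exact add_mem (Submodule.mem_sup_left h5) (Submodule.mem_sup_right
      (Submodule.smul_mem_smul ht h8))
  have hN' : N ≤ N0 := Submodule.le_of_le_smul_of_le_jacobson_bot
    (IsNoetherian.noetherian N) (IsLocalRing.maximalIdeal_le_jacobson _) hN
  have hc : c ∈ N0 := hN' hac
  clear hN hN' hac
  induction hc using Submodule.span_induction with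
  | mem x h =>
    obtain ⟨α, h, rfl⟩ := h
    exact ⟨1, fun i _ => α i, fun _ => 1, by simp, by simpa using h⟩
  | zero => exact ⟨0, fun _ _ => 0, fun _ => 0, by simp, by simp⟩
  | add x y _ _ hx hy =>
    obtain ⟨k, α, b, h1, h2⟩ := hx
    obtain ⟨k', α', b', h1', h2'⟩ := hy
    refine ⟨k + k', fun i => Fin.append (α i) (α' i), Fin.append b b', fun i => ?_, fun j => ?_⟩
    · simp [Fin.sum_univ_add, h1, h1']
    · refine Fin.addCases (fun i => ?_) (fun i => ?_) j <;> simp [h2, h2']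
  | smul s x _ hx =>
    obtain ⟨k, α, b, h1, h2⟩ := hx
    refine ⟨k, α, fun i => s * b i, fun i => ?_, h2⟩
    rw [Pi.smul_apply, h1, smul_eq_mul, Finset.mul_sum]
    exact Finset.sum_congr rfl fun i _ => by ring

theorem regular_mod_of_flat_quot {R C C1 : Type u} [CommRing R] [CommRing C] [CommRing C1]
    {f : R →+* C} {π : C →+* C1} (hπ : Function.Surjective π) {t : C}
    (hk : RingHom.ker π = Ideal.span {t}) (hreg : IsSMulRegular C t)
    (hf : (π.comp f).Flat) (𝔞 : Ideal R) (c : C) (hc : t * c ∈ 𝔞.map f) : c ∈ 𝔞.map f := by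
  rw [isSMulRegular_iff_mul] at hreg
  obtain ⟨l, a, b, ha, hab⟩ := mem_map_iff_sum.1 hc
  have ht0 : π t = 0 := by rw [← RingHom.mem_ker, hk]; exact Ideal.mem_span_singleton_self t
  obtain ⟨k, α, y, h1, h2⟩ := flat_elem hf a (fun i => π (b i)) (by
      have := congrArg π hab
      simpa [ht0] using this.symm)
  choose y' hy' using fun j => hπ (y j)
  have h3 : ∀ i, b i - ∑ j, f (α i j) * y' j ∈ Ideal.span {t} := by
    intro i
    rw [← hk, RingHom.mem_ker, map_sub, h1]
    simp [hy']
  choose d hd using fun i => Ideal.mem_span_singleton'.1 (h3 i)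
  have h4 : ∀ i, b i = (∑ j, f (α i j) * y' j) + d i * t := fun i => by rw [hd]; ring
  have h5 : c = ∑ i, f (a i) * d i := by
    rw [← sub_eq_zero]
    apply hreg
    rw [mul_sub, hab, sub_eq_zero]
    simp only [h4, mul_add, Finset.sum_add_distrib, Finset.mul_sum]
    rw [Finset.sum_comm, Finset.sum_eq_zero, zero_add]
    · exact Finset.sum_congr rfl fun i _ => by ring
    · intro j _
      have := congrArg (fun z => f z * y' j) (h2 j)
      simp only [map_sum, map_mul, Finset.sum_mul, map_zero, zero_mul] at this
      rw [← this]
      exact Finset.sum_congr rfl fun i _ => by ring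
  rw [h5]
  exact Ideal.sum_mem _ fun i _ => Ideal.mul_mem_right _ _ (Ideal.mem_map_of_mem _ (ha i))

theorem flat_of_flat_GRSn {n : ℕ} {R C : Type u} [CommRing R] [CommRing C] [IsLocalRing C]
    [IsNoetherianRing C] {f : R →+* C} {J : Ideal C} (hJ : GRSn n C J)
    (hf : ((Ideal.Quotient.mk J).comp f).Flat) : f.Flat ∧ ∀ (𝔞 : Ideal R) (D : Type u) [CommRing D]
      (p : C →+* D), Function.Surjective p → RingHom.ker p = 𝔞.map f → J.map p ≠ ⊤ →
      GRSn n D (J.map p) := by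
  induction n generalizing C with
  | zero =>
    obtain ⟨rfl, _⟩ := hJ
    constructor
    · have := flat_equiv (RingEquiv.quotientBot C)
      have h2 := hf.comp this
      exact h2
    · intro 𝔞 D _ p hp hk hD
      refine ⟨by simp, ?_⟩
      by_contra hc
      rw [not_nontrivial_iff_subsingleton] at hc
      exact hD (Subsingleton.elim _ _)
  | succ n ih =>
    have hJt := hJ.ne_top
    obtain ⟨r, hr, hreg, h⟩ := hJ
    have hrm : r ∈ maximalIdeal C := le_maximalIdeal hJt hr
    have := isLocalRing_quot (span_ne_top hrm)
    have hle : Ideal.span {r} ≤ J := by rwa [Ideal.span_le, Set.singleton_subset_iff]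
    obtain ⟨h1, h2⟩ := ih (f := (Ideal.Quotient.mk (Ideal.span {r})).comp f) h (by
      have e := (DoubleQuot.quotQuotEquivQuotOfLE hle).symm
      have h3 := hf.comp (flat_equiv (DoubleQuot.quotQuotEquivQuotOfLE hle).symm)
      exact h3)
    have hflat := flat_of_flat_quot Ideal.Quotient.mk_surjective hrm (Ideal.mk_ker) hreg h1
    refine ⟨hflat, ?_⟩
    intro 𝔞 D _ p hp hk hD
    have h3 := h2 𝔞 (D ⧸ Ideal.span {p r}) (quotHom p r) (quotHom_surj p r hp) (by
      rw [quotHom_ker _ _ hp, hk, Ideal.map_map])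
    have e : (J.map (Ideal.Quotient.mk (Ideal.span {r}))).map (quotHom p r) =
        (J.map p).map (Ideal.Quotient.mk (Ideal.span {p r})) := by
      rw [Ideal.map_map, Ideal.map_map, quotHom_comp]
    rw [e] at h3
    refine ⟨p r, Ideal.mem_map_of_mem p hr, ?_, h3 ?_⟩
    · rw [isSMulRegular_iff_mul]
      intro b hb
      obtain ⟨b, rfl⟩ := hp b
      rw [← RingHom.mem_ker, hk]
      apply regular_mod_of_flat_quot Ideal.Quotient.mk_surjective Ideal.mk_ker hreg h1
      rw [← hk, RingHom.mem_ker, map_mul, hb]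
    · intro h'
      have := congrArg (Ideal.comap (Ideal.Quotient.mk (Ideal.span {p r}))) h'
      rw [Ideal.comap_map_of_surjective _ Ideal.Quotient.mk_surjective,
        ← RingHom.ker_eq_comap_bot, Ideal.mk_ker, sup_eq_left.2, Ideal.comap_top] at this
      · exact hD this
      · rw [Ideal.span_le, Set.singleton_subset_iff]
        exact Ideal.mem_map_of_mem p hr

/-- if the fibre of `N` vanishes and `B/N` is flat then `N = 0` -/
theorem eq_bot_of_flat_quot {R B : Type u} [CommRing R] [CommRing B] [IsLocalRing B]
    [IsNoetherianRing B] [IsLocalRing R] {f : R →+* B} [IsLocalHom f] {N : Ideal B}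
    (hf : ((Ideal.Quotient.mk N).comp f).Flat) (hN : N ≤ (maximalIdeal R).map f) : N = ⊥ := by
  have key : N ≤ maximalIdeal B • N := by
    intro x hx
    obtain ⟨l, a, b, ha, rfl⟩ := mem_map_iff_sum.1 (hN hx)
    obtain ⟨k, α, y, h1, h2⟩ := flat_elem hf a (fun i => Ideal.Quotient.mk N (b i)) (by
      have := Ideal.Quotient.eq_zero_iff_mem.2 hx
      simpa using this)
    choose y' hy' using fun j => Ideal.Quotient.mk_surjective (y j)
    have h3 : ∀ i, b i - ∑ j, f (α i j) * y' j ∈ N := by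
      intro i
      rw [← Ideal.Quotient.eq_zero_iff_mem, map_sub, h1]
      simp [hy']
    have h4 : ∑ i, f (a i) * b i = ∑ i, f (a i) * (b i - ∑ j, f (α i j) * y' j) := by
      simp only [mul_sub, Finset.sum_sub_distrib, Finset.mul_sum]
      rw [Finset.sum_comm (f := fun i j => f (a i) * (f (α i j) * y' j))]
      rw [Finset.sum_eq_zero (f := fun j => ∑ i, f (a i) * (f (α i j) * y' j)), sub_zero]
      intro j _
      have := congrArg (fun z => f z * y' j) (h2 j)
      simp only [map_sum, map_mul, Finset.sum_mul, map_zero, zero_mul] at this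
      rw [← this]
      exact Finset.sum_congr rfl fun i _ => by ring
    rw [h4]
    exact Ideal.sum_mem _ fun i _ => Submodule.smul_mem_smul
      (map_maximalIdeal_le f (Ideal.mem_map_of_mem _ (ha i))) (h3 i)
  exact Submodule.eq_bot_of_le_smul_of_le_jacobson_bot _ _ (IsNoetherian.noetherian N) key
    (IsLocalRing.maximalIdeal_le_jacobson _)

theorem GRSn.lift {n : ℕ} {R B D : Type u} [CommRing R] [CommRing B] [CommRing D] [IsLocalRing B]
    [IsNoetherianRing B] [IsLocalRing R] [IsNoetherianRing R] {f : R →+* B} [IsLocalHom f]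
    (hf : f.Flat) {N : Ideal B} (hN : ((Ideal.Quotient.mk N).comp f).Flat)
    {p : B →+* D} (hp : Function.Surjective p) (hk : RingHom.ker p = (maximalIdeal R).map f)
    (h : GRSn n D (N.map p)) : GRSn n B N := by
  induction n generalizing B D with
  | zero =>
    refine ⟨eq_bot_of_flat_quot (f := f) hN ?_, inferInstance⟩
    rw [← hk]
    intro x hx
    rw [RingHom.mem_ker, ← Ideal.mem_bot, ← h.1]
    exact Ideal.mem_map_of_mem p hx
  | succ n ih =>
    have hNt : N ≠ ⊤ := by
      rintro rfl
      exact h.ne_top (Ideal.map_top p)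
    obtain ⟨r', hr', hreg, h⟩ := h
    obtain ⟨r, hr, rfl⟩ := (Ideal.mem_map_iff_of_surjective p hp).1 hr'
    have hv : ∀ b, r * b ∈ (maximalIdeal R).map f → b ∈ (maximalIdeal R).map f := by
      intro b hb
      rw [← hk, RingHom.mem_ker] at hb ⊢
      rw [isSMulRegular_iff_mul] at hreg
      apply hreg
      rw [← map_mul, hb]
    have hrm : r ∈ maximalIdeal B := le_maximalIdeal hNt hr
    have := isLocalRing_quot (span_ne_top hrm)
    have := isLocalHom_mk (span_ne_top hrm)
    have hle : Ideal.span {r} ≤ N := by rwa [Ideal.span_le, Set.singleton_subset_iff]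
    refine ⟨r, hr, regular_of_local hf hv, ?_⟩
    refine ih (f := (Ideal.Quotient.mk (Ideal.span {r})).comp f) (p := quotHom p r) ?_ ?_
      (quotHom_surj p r hp) ?_ ?_
    · exact flat_quot_of_regular hf Ideal.Quotient.mk_surjective Ideal.mk_ker
        (regular_mod_local hf hv)
    · have h3 := hN.comp (flat_equiv (DoubleQuot.quotQuotEquivQuotOfLE hle).symm)
      exact h3
    · rw [quotHom_ker _ _ hp, hk, Ideal.map_map]
    · rw [Ideal.map_map, quotHom_comp, ← Ideal.map_map]
      exact h

theorem quotHom_isLocalHom {A B : Type u} [CommRing A] [CommRing B] [IsLocalRing A] [IsLocalRing B]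
    (f : A →+* B) [IsLocalHom f] {r : A} (hr : r ∈ maximalIdeal A) : IsLocalHom (quotHom f r) := by
  have h2 : f r ∈ maximalIdeal B := map_maximalIdeal_le f (Ideal.mem_map_of_mem f hr)
  have := isLocalHom_mk (span_ne_top h2)
  have := isLocalHom_mk (span_ne_top hr)
  constructor
  intro a ha
  obtain ⟨a, rfl⟩ := Ideal.Quotient.mk_surjective a
  rw [quotHom_mk] at ha
  have h3 := isUnit_of_map_unit f a (isUnit_of_map_unit (Ideal.Quotient.mk _) _ ha)
  exact h3.map _

theorem GRSn.desc {n : ℕ} {A B : Type u} [CommRing A] [CommRing B] [IsLocalRing A] [IsLocalRing B]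
    [IsNoetherianRing A] [IsNoetherianRing B] {f : A →+* B} [IsLocalHom f] (hf : f.Flat)
    {I : Ideal A} (h : GRSn n B (I.map f)) : GRSn n A I := by
  induction n generalizing A B with
  | zero =>
    refine ⟨?_, inferInstance⟩
    rw [eq_bot_iff]
    intro x hx
    apply flat_local_mem hf
    rw [Ideal.map_bot, ← h.1]
    exact Ideal.mem_map_of_mem f hx
  | succ n ih =>
    obtain ⟨x, hx, hx'⟩ : ∃ x ∈ I, f x ∉ maximalIdeal B * I.map f := by
      by_contra hcon
      push Not at hcon
      have h1 : I.map f ≤ maximalIdeal B • I.map f := by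
        rw [Ideal.map_le_iff_le_comap]
        exact hcon
      have h2 := Submodule.eq_bot_of_le_smul_of_le_jacobson_bot _ _
        (IsNoetherian.noetherian (I.map f)) h1 (IsLocalRing.maximalIdeal_le_jacobson _)
      obtain ⟨r, hr, hreg, -⟩ := h
      rw [h2, Ideal.mem_bot] at hr
      subst hr
      rw [isSMulRegular_iff_mul] at hreg
      exact one_ne_zero (hreg 1 (by simp))
    have hIt : I ≠ ⊤ := by
      rintro rfl
      exact h.ne_top (Ideal.map_top f)
    have hxm : x ∈ maximalIdeal A := le_maximalIdeal hIt hx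
    have hxm' : f x ∈ maximalIdeal B := map_maximalIdeal_le f (Ideal.mem_map_of_mem f hxm)
    obtain ⟨h1, h2⟩ := h.exchange (Ideal.mem_map_of_mem f hx) hx'
    have := isLocalRing_quot (span_ne_top hxm)
    have := isLocalRing_quot (span_ne_top hxm')
    have := quotHom_isLocalHom f hxm
    refine ⟨x, hx, ?_, ?_⟩
    · rw [isSMulRegular_iff_mul] at h1 ⊢
      intro b hb
      apply flat_local_injective hf
      rw [map_zero]
      apply h1
      rw [← map_mul, hb, map_zero]
    · apply ih (quotHom_flat f x hf)
      rw [Ideal.map_map, quotHom_comp, ← Ideal.map_map]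
      exact h2
end part3

section part4
theorem GRSn.congr_surj {n : ℕ} {C D D' : Type u} [CommRing C] [CommRing D] [CommRing D']
    {p : C →+* D} {p' : C →+* D'} (hp : Function.Surjective p) (hp' : Function.Surjective p')
    (hk : RingHom.ker p = RingHom.ker p') {J : Ideal C} (h : GRSn n D (J.map p)) :
    GRSn n D' (J.map p') := by
  let e : D ≃+* D' := (RingHom.quotientKerEquivOfSurjective hp).symm.trans
    ((Ideal.quotEquivOfEq hk).trans (RingHom.quotientKerEquivOfSurjective hp'))
  have := h.equiv e
  rw [Ideal.map_map] at this
  convert this using 2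
  ext x
  have h1 : (RingHom.quotientKerEquivOfSurjective hp).symm (p x) = Ideal.Quotient.mk _ x := by
    rw [RingEquiv.symm_apply_eq]; rfl
  simp only [RingHom.coe_comp, RingHom.coe_coe, Function.comp_apply, e, RingEquiv.trans_apply]
  rw [h1]; rfl

/-- flat with regular closed fibre of dimension `n` -/
def WRn (n : ℕ) {R B : Type u} [CommRing R] [CommRing B] [IsLocalRing R] [IsLocalRing B]
    (f : R →+* B) : Prop :=
  f.Flat ∧ GRSn n (B ⧸ (maximalIdeal R).map f)
    ((maximalIdeal B).map (Ideal.Quotient.mk ((maximalIdeal R).map f)))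

theorem WRn.fibre {n : ℕ} {R B D : Type u} [CommRing R] [CommRing B] [CommRing D] [IsLocalRing R]
    [IsLocalRing B] {f : R →+* B} (h : WRn n f) {p : B →+* D} (hp : Function.Surjective p)
    (hk : RingHom.ker p = (maximalIdeal R).map f) : GRSn n D ((maximalIdeal B).map p) :=
  h.2.congr_surj Ideal.Quotient.mk_surjective hp (by rw [Ideal.mk_ker, hk])

theorem WRn.of_fibre {n : ℕ} {R B D : Type u} [CommRing R] [CommRing B] [CommRing D] [IsLocalRing R]
    [IsLocalRing B] {f : R →+* B} (h : f.Flat) {p : B →+* D} (hp : Function.Surjective p)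
    (hk : RingHom.ker p = (maximalIdeal R).map f) (hD : GRSn n D ((maximalIdeal B).map p)) :
    WRn n f :=
  ⟨h, hD.congr_surj hp Ideal.Quotient.mk_surjective (by rw [Ideal.mk_ker, hk])⟩

theorem maximalIdeal_quot_span {A : Type u} [CommRing A] [IsLocalRing A] {I : Ideal A}
    [IsLocalRing (A ⧸ I)] :
    (maximalIdeal A).map (Ideal.Quotient.mk I) = maximalIdeal (A ⧸ I) :=
  map_maximalIdeal_of_surjective _ Ideal.Quotient.mk_surjective

theorem GRSn.succ_maximal_ne {n : ℕ} {V : Type u} [CommRing V] [IsLocalRing V] [IsNoetherianRing V]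
    (h : GRSn (n+1) V (maximalIdeal V)) : ¬ maximalIdeal V ≤ maximalIdeal V * maximalIdeal V := by
  intro h1
  have h2 := Submodule.eq_bot_of_le_smul_of_le_jacobson_bot _ _
        (IsNoetherian.noetherian (maximalIdeal V)) h1 (IsLocalRing.maximalIdeal_le_jacobson _)
  obtain ⟨r, hr, hreg, -⟩ := h
  rw [h2, Ideal.mem_bot] at hr
  subst hr
  rw [isSMulRegular_iff_mul] at hreg
  exact one_ne_zero (hreg 1 (by simp))

theorem regular_ker_bot {n k : ℕ} {V V1 : Type u} [CommRing V] [CommRing V1] [IsLocalRing V]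
    [IsNoetherianRing V] [IsLocalRing V1] [IsNoetherianRing V1] {π : V →+* V1}
    (hπ : Function.Surjective π) (h : GRSn n V (maximalIdeal V)) (h1 : GRSn k V1 (maximalIdeal V1))
    (hk : RingHom.ker π ≤ maximalIdeal V * maximalIdeal V) : RingHom.ker π = ⊥ := by
  induction n generalizing V V1 k with
  | zero =>
    rw [h.1] at hk
    simpa using hk
  | succ n ih =>
    have : IsLocalHom π := IsLocalHom.of_surjective π hπ
    obtain ⟨x, hx, hx'⟩ := Set.not_subset.1 h.succ_maximal_ne
    have hm : (maximalIdeal V).map π = maximalIdeal V1 := map_maximalIdeal_of_surjective π hπ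
    have hx1 : π x ∈ maximalIdeal V1 := map_maximalIdeal_le π (Ideal.mem_map_of_mem π hx)
    have hx1' : π x ∉ maximalIdeal V1 * maximalIdeal V1 := by
      intro hc
      rw [← hm, ← Ideal.map_mul, Ideal.mem_map_iff_of_surjective π hπ] at hc
      obtain ⟨y, hy, hyx⟩ := hc
      apply hx'
      have : x = y + (x - y) := by ring
      rw [SetLike.mem_coe, this]
      refine add_mem hy (hk ?_)
      rw [RingHom.mem_ker, map_sub, hyx, sub_self]
    match k, h1 with
    | 0, h1 =>
      rw [h1.1] at hx1 hx1'
      rw [Ideal.mem_bot] at hx1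
      rw [hx1] at hx1'
      exact absurd (Submodule.zero_mem _) hx1'
    | k+1, h1 =>
      obtain ⟨hr, h2⟩ := h.exchange hx hx'
      obtain ⟨hr1, h3⟩ := h1.exchange hx1 hx1'
      have := isLocalRing_quot (span_ne_top hx)
      have := isLocalRing_quot (span_ne_top hx1)
      rw [maximalIdeal_quot_span] at h2 h3
      have h4 := ih (quotHom_surj π x hπ) h2 h3 (by
        rw [quotHom_ker π x hπ, ← maximalIdeal_quot_span, ← Ideal.map_mul]
        exact Ideal.map_mono hk)
      rw [quotHom_ker π x hπ] at h4
      refine Submodule.eq_bot_of_le_smul_of_le_jacobson_bot (maximalIdeal V) _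
        (IsNoetherian.noetherian (RingHom.ker π)) ?_ (IsLocalRing.maximalIdeal_le_jacobson _)
      intro y hy
      have h5 : y ∈ Ideal.span {x} := by
        rw [← Ideal.Quotient.eq_zero_iff_mem, ← Ideal.mem_bot, ← h4]
        exact Ideal.mem_map_of_mem _ hy
      obtain ⟨c, rfl⟩ := Ideal.mem_span_singleton'.1 h5
      rw [mul_comm]
      refine Submodule.smul_mem_smul hx ?_
      rw [isSMulRegular_iff_mul] at hr1
      apply hr1
      rw [← map_mul, mul_comm]
      exact hy

theorem regular_ker_GRS {n k : ℕ} {V V1 : Type u} [CommRing V] [CommRing V1] [IsLocalRing V]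
    [IsNoetherianRing V] [IsLocalRing V1] [IsNoetherianRing V1] {π : V →+* V1}
    (hπ : Function.Surjective π) (h : GRSn n V (maximalIdeal V)) (h1 : GRSn k V1 (maximalIdeal V1)) :
    ∃ l, GRSn l V (RingHom.ker π) := by
  induction n generalizing V with
  | zero =>
    refine ⟨0, ?_, inferInstance⟩
    have := le_maximalIdeal (RingHom.ker_ne_top π)
    rw [h.1] at this
    simpa using this
  | succ n ih =>
    by_cases hk : RingHom.ker π ≤ maximalIdeal V * maximalIdeal V
    · exact ⟨0, regular_ker_bot hπ h h1 hk, inferInstance⟩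
    · obtain ⟨x, hx, hx'⟩ := Set.not_subset.1 hk
      have hxm : x ∈ maximalIdeal V := le_maximalIdeal (RingHom.ker_ne_top π) hx
      obtain ⟨hr, h2⟩ := h.exchange hxm hx'
      have := isLocalRing_quot (span_ne_top hxm)
      rw [maximalIdeal_quot_span] at h2
      have hle : ∀ a ∈ Ideal.span {x}, π a = 0 := fun a ha =>
        (Ideal.span_le.2 (by simpa using hx) : Ideal.span {x} ≤ RingHom.ker π) ha
      obtain ⟨l, hl⟩ := ih (π := Ideal.Quotient.lift _ π hle)
        (Ideal.Quotient.lift_surjective_of_surjective _ hle hπ) h2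
      refine ⟨l + 1, x, hx, hr, ?_⟩
      have hker : RingHom.ker (Ideal.Quotient.lift (Ideal.span {x}) π hle) =
        (RingHom.ker π).map (Ideal.Quotient.mk _) := Ideal.ker_quotient_lift π _
      rwa [hker] at hl

/-- F12 -/
theorem WRn.ker_GRS {n k : ℕ} {R B A : Type u} [CommRing R] [CommRing B] [CommRing A]
    [IsLocalRing R] [IsNoetherianRing R] [IsLocalRing B] [IsNoetherianRing B] [IsLocalRing A]
    [IsNoetherianRing A] {f : R →+* B} [IsLocalHom f] {π : B →+* A} (hπ : Function.Surjective π)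
    (hf : WRn n f) (h : WRn k (π.comp f)) : ∃ l, GRSn l B (RingHom.ker π) := by
  have : IsLocalHom π := IsLocalHom.of_surjective π hπ
  have ht : (maximalIdeal R).map f ≠ ⊤ := flat_local_map_ne_top (maximalIdeal.isMaximal R).ne_top
  have ht1 : (maximalIdeal R).map (π.comp f) ≠ ⊤ :=
    flat_local_map_ne_top (maximalIdeal.isMaximal R).ne_top
  have := isLocalRing_quot ht
  have := isLocalRing_quot ht1
  let q : B ⧸ (maximalIdeal R).map f →+* A ⧸ (maximalIdeal R).map (π.comp f) :=
    Ideal.quotientMap _ π (by rw [← Ideal.map_le_iff_le_comap, Ideal.map_map])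
  have hq : Function.Surjective q := Ideal.quotientMap_surjective hπ
  obtain ⟨l, hl⟩ := regular_ker_GRS (π := q) hq (by rw [← maximalIdeal_quot_span]; exact hf.2)
    (by rw [← maximalIdeal_quot_span]; exact h.2)
  refine ⟨l, GRSn.lift (f := f) (D := B ⧸ (maximalIdeal R).map f) hf.1 ?_
    Ideal.Quotient.mk_surjective Ideal.mk_ker ?_⟩
  · have := h.1.comp (flat_equiv (RingHom.quotientKerEquivOfSurjective hπ).symm)
    convert this using 1
    ext x
    simp only [RingHom.coe_comp, RingHom.coe_coe, Function.comp_apply]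
    symm
    rw [RingEquiv.symm_apply_eq]; rfl
  · convert hl using 1
    apply le_antisymm
    · rw [Ideal.map_le_iff_le_comap]
      intro x hx
      rw [Ideal.mem_comap, RingHom.mem_ker, Ideal.quotientMap_mk, (hx : π x = 0), map_zero]
    · intro y hy
      obtain ⟨y, rfl⟩ := Ideal.Quotient.mk_surjective y
      rw [RingHom.mem_ker, Ideal.quotientMap_mk, Ideal.Quotient.eq_zero_iff_mem, ← Ideal.map_map,
        Ideal.mem_map_iff_of_surjective π hπ] at hy
      obtain ⟨z, hz, hzy⟩ := hy
      have h5 : y - z ∈ RingHom.ker π := by rw [RingHom.mem_ker, map_sub, hzy, sub_self]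
      have h6 := Ideal.mem_map_of_mem (Ideal.Quotient.mk ((maximalIdeal R).map f)) h5
      rwa [map_sub, Ideal.Quotient.eq_zero_iff_mem.2 hz, sub_zero] at h6

/-- F13 -/
theorem WRn.map_GRS {n k l : ℕ} {R B A : Type u} [CommRing R] [CommRing B] [CommRing A]
    [IsLocalRing R] [IsNoetherianRing R] [IsLocalRing B] [IsNoetherianRing B] [IsLocalRing A]
    [IsNoetherianRing A] {f : R →+* B} [IsLocalHom f] {π : B →+* A} (hπ : Function.Surjective π)
    (hf : WRn n f) (h : WRn k (π.comp f)) {I : Ideal B} (hI : RingHom.ker π ≤ I)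
    (hIG : GRSn l B I) : ∃ l', GRSn l' A (I.map π) := by
  induction n generalizing B l with
  | zero =>
    have h1 := hf.2.1
    have h2 : RingHom.ker π = ⊥ := by
      refine eq_bot_of_flat_quot (f := f) ?_ ?_
      · have := h.1.comp (flat_equiv (RingHom.quotientKerEquivOfSurjective hπ).symm)
        convert this using 1
        ext x
        simp only [RingHom.coe_comp, RingHom.coe_coe, Function.comp_apply]
        symm
        rw [RingEquiv.symm_apply_eq]; rfl
      · intro x hx
        rw [← Ideal.Quotient.eq_zero_iff_mem, ← Ideal.mem_bot, ← h1]
        exact Ideal.mem_map_of_mem _ (le_maximalIdeal (RingHom.ker_ne_top π) hx)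
    have hb : Function.Bijective π := ⟨(RingHom.injective_iff_ker_eq_bot π).2 h2, hπ⟩
    exact ⟨l, hIG.equiv (RingEquiv.ofBijective π hb)⟩
  | succ n ih =>
    have : IsLocalHom π := IsLocalHom.of_surjective π hπ
    have ht : (maximalIdeal R).map f ≠ ⊤ := flat_local_map_ne_top (maximalIdeal.isMaximal R).ne_top
    have ht1 : (maximalIdeal R).map (π.comp f) ≠ ⊤ :=
      flat_local_map_ne_top (maximalIdeal.isMaximal R).ne_top
    have := isLocalRing_quot ht
    have := isLocalRing_quot ht1
    let q : B ⧸ (maximalIdeal R).map f →+* A ⧸ (maximalIdeal R).map (π.comp f) :=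
      Ideal.quotientMap _ π (by rw [← Ideal.map_le_iff_le_comap, Ideal.map_map])
    have hq : Function.Surjective q := Ideal.quotientMap_surjective hπ
    have hkq : RingHom.ker q = (RingHom.ker π).map (Ideal.Quotient.mk ((maximalIdeal R).map f)) := by
      apply le_antisymm
      · intro y hy
        obtain ⟨y, rfl⟩ := Ideal.Quotient.mk_surjective y
        rw [RingHom.mem_ker, Ideal.quotientMap_mk, Ideal.Quotient.eq_zero_iff_mem, ← Ideal.map_map,
          Ideal.mem_map_iff_of_surjective π hπ] at hy
        obtain ⟨z, hz, hzy⟩ := hy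
        have h5 : y - z ∈ RingHom.ker π := by rw [RingHom.mem_ker, map_sub, hzy, sub_self]
        have h6 := Ideal.mem_map_of_mem (Ideal.Quotient.mk ((maximalIdeal R).map f)) h5
        rwa [map_sub, Ideal.Quotient.eq_zero_iff_mem.2 hz, sub_zero] at h6
      · rw [Ideal.map_le_iff_le_comap]
        intro x hx
        rw [Ideal.mem_comap, RingHom.mem_ker, Ideal.quotientMap_mk, (hx : π x = 0), map_zero]
    have hV : GRSn (n+1) _ (maximalIdeal (B ⧸ (maximalIdeal R).map f)) := by
      rw [← maximalIdeal_quot_span]; exact hf.2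
    by_cases hk : RingHom.ker q ≤ maximalIdeal _ * maximalIdeal _
    · have h0 := regular_ker_bot hq hV (by rw [← maximalIdeal_quot_span]; exact h.2) hk
      have h2 : RingHom.ker π = ⊥ := by
        refine eq_bot_of_flat_quot (f := f) ?_ ?_
        · have := h.1.comp (flat_equiv (RingHom.quotientKerEquivOfSurjective hπ).symm)
          convert this using 1
          ext x
          simp only [RingHom.coe_comp, RingHom.coe_coe, Function.comp_apply]
          symm
          rw [RingEquiv.symm_apply_eq]; rfl
        · intro x hx
          rw [← Ideal.Quotient.eq_zero_iff_mem, ← Ideal.mem_bot, ← h0, hkq]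
          exact Ideal.mem_map_of_mem _ hx
      have hb : Function.Bijective π := ⟨(RingHom.injective_iff_ker_eq_bot π).2 h2, hπ⟩
      exact ⟨l, hIG.equiv (RingEquiv.ofBijective π hb)⟩
    · obtain ⟨x', hx, hx'⟩ := Set.not_subset.1 hk
      rw [SetLike.mem_coe, hkq,
        Ideal.mem_map_iff_of_surjective _ Ideal.Quotient.mk_surjective] at hx
      obtain ⟨x, hx, rfl⟩ := hx
      have hxm : x ∈ maximalIdeal B := le_maximalIdeal (RingHom.ker_ne_top π) hx
      have hxV : Ideal.Quotient.mk ((maximalIdeal R).map f) x ∈ maximalIdeal _ := by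
        rw [← maximalIdeal_quot_span]; exact Ideal.mem_map_of_mem _ hxm
      obtain ⟨hr, h2⟩ := hV.exchange hxV hx'
      have := isLocalRing_quot (span_ne_top hxm)
      have := isLocalHom_mk (span_ne_top hxm)
      have hv : ∀ b, x * b ∈ (maximalIdeal R).map f → b ∈ (maximalIdeal R).map f := by
        intro b hb
        rw [← Ideal.Quotient.eq_zero_iff_mem] at hb ⊢
        rw [isSMulRegular_iff_mul] at hr
        apply hr
        rw [← map_mul, hb]
      have hle : ∀ a ∈ Ideal.span {x}, π a = 0 := fun a ha =>
        (Ideal.span_le.2 (by simpa using hx) : Ideal.span {x} ≤ RingHom.ker π) ha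
      have hmem : x ∉ maximalIdeal B * I := by
        intro hc
        apply hx'
        have hc' : x ∈ maximalIdeal B * maximalIdeal B :=
          Ideal.mul_mono_right (le_maximalIdeal hIG.ne_top) hc
        rw [← maximalIdeal_quot_span, ← Ideal.map_mul]
        exact Ideal.mem_map_of_mem _ hc'
      match l, hIG with
      | 0, hIG =>
        exfalso
        apply hmem
        have := hI hx
        rw [hIG.1, Ideal.mem_bot] at this
        rw [this]; exact zero_mem _
      | l+1, hIG =>
        obtain ⟨-, h3⟩ := hIG.exchange (hI hx) hmem
        have h4 := ih (B := B ⧸ Ideal.span {x}) (f := (Ideal.Quotient.mk (Ideal.span {x})).comp f)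
          (π := Ideal.Quotient.lift _ π hle)
          (Ideal.Quotient.lift_surjective_of_surjective _ hle hπ) ?_ ?_ ?_ h3
        · rw [Ideal.map_map] at h4
          exact h4
        · refine WRn.of_fibre (p := quotHom (Ideal.Quotient.mk ((maximalIdeal R).map f)) x)
            (flat_quot_of_regular hf.1 Ideal.Quotient.mk_surjective Ideal.mk_ker
              (regular_mod_local hf.1 hv)) (quotHom_surj _ _ Ideal.Quotient.mk_surjective) ?_ ?_
          · rw [quotHom_ker _ _ Ideal.Quotient.mk_surjective, Ideal.mk_ker, Ideal.map_map]
          · rw [← maximalIdeal_quot_span, Ideal.map_map, quotHom_comp, ← Ideal.map_map,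
              maximalIdeal_quot_span]
            exact h2
        · exact h
        · have hker : RingHom.ker (Ideal.Quotient.lift (Ideal.span {x}) π hle) =
            (RingHom.ker π).map (Ideal.Quotient.mk _) := Ideal.ker_quotient_lift π _
          rw [hker]
          exact Ideal.map_mono hI
end part4

section part5
theorem exists_max_not_fg {A : Type u} [CommRing A] {J : Ideal A} (hJ : ¬ J.FG) :
    ∃ I : Ideal A, Maximal (fun K : Ideal A => ¬ K.FG) I := by
  obtain ⟨M, -, hM⟩ := zorn_le_nonempty₀ {K : Ideal A | ¬ K.FG} (fun C hC₁ hC₂ I hI => by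
    refine ⟨sSup C, ?_, fun z hz => le_sSup hz⟩
    rintro ⟨G, hG⟩
    obtain ⟨J, J_mem_C, G_subset_J⟩ : ∃ J ∈ C, (G : Set A) ⊆ J := by
      refine hC₂.directedOn.exists_mem_subset_of_finset_subset_biUnion ⟨I, hI⟩ (fun _ hx ↦ ?_)
      simp only [Set.mem_iUnion, SetLike.mem_coe, exists_prop]
      exact (Submodule.mem_sSup_of_directed ⟨I, hI⟩ hC₂.directedOn).1 <|
        hG ▸ Submodule.subset_span hx
    refine hC₁ J_mem_C ⟨G, le_antisymm (Ideal.span_le.2 G_subset_J) ?_⟩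
    exact hG ▸ le_sSup J_mem_C) J hJ
  exact ⟨M, hM⟩

theorem complete_fg_aux {A : Type u} [CommRing A] (I : Ideal A) [IsAdicComplete I A]
    {q : Ideal A} {x : A} (hx : x ∈ I) (s : Finset A)
    (h : ∀ y ∈ q, ∃ z ∈ q, ∃ c : A → A, y = ∑ a ∈ s, c a * a + x * z) (hs : ∀ a ∈ s, a ∈ q) :
    q = Ideal.span (s : Set A) := by
  refine le_antisymm (fun y hy => ?_) (Ideal.span_le.2 hs)
  choose! z hz c hc using h
  let Y : ℕ → A := fun n => Nat.rec y (fun _ w => z w) n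
  have hY : ∀ n, Y n ∈ q := fun n => by
    induction n with
    | zero => exact hy
    | succ n ih => exact hz _ ih
  let P : A → ℕ → A := fun a n => ∑ k ∈ Finset.range n, x ^ k * c (Y k) a
  have hP : ∀ n, y = ∑ a ∈ s, P a n * a + x ^ n * Y n := fun n => by
    induction n with
    | zero => simp [P, Y]
    | succ n ih =>
      have h1 : Y n = ∑ a ∈ s, c (Y n) a * a + x * Y (n + 1) := hc _ (hY n)
      rw [ih]
      conv_lhs => rw [h1]
      simp only [P, Finset.sum_range_succ, add_mul, Finset.sum_add_distrib, mul_add,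
        Finset.mul_sum, mul_assoc, pow_succ]
      ring
  have hlim : ∀ a, ∃ L : A, ∀ n, P a n - L ∈ I ^ n := fun a => by
    obtain ⟨L, hL⟩ := IsPrecomplete.prec' (I := I) (M := A) (P a) (by
      intro m n hmn
      rw [SModEq.sub_mem, smul_eq_mul, Ideal.mul_top, ← neg_sub, neg_mem_iff]
      simp only [P]
      rw [← Finset.sum_range_add_sum_Ico _ hmn, add_sub_cancel_left]
      refine Ideal.sum_mem _ fun k hk => Ideal.mul_mem_right _ _ ?_
      exact Ideal.pow_le_pow_right (Finset.mem_Ico.1 hk).1 (Ideal.pow_mem_pow hx k))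
    exact ⟨L, fun n => by simpa [SModEq.sub_mem] using hL n⟩
  choose L hL using hlim
  have : y - ∑ a ∈ s, L a * a = 0 := by
    refine IsHausdorff.haus (I := I) (M := A) inferInstance _ fun n => ?_
    rw [SModEq.zero, smul_eq_mul, Ideal.mul_top]
    have h2 : y - ∑ a ∈ s, L a * a = ∑ a ∈ s, (P a n - L a) * a + x ^ n * Y n := by
      conv_lhs => rw [hP n]
      simp only [sub_mul, Finset.sum_sub_distrib]
      ring
    rw [h2]
    exact Ideal.add_mem _ (Ideal.sum_mem _ fun a _ => Ideal.mul_mem_right _ _ (hL a n))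
      (Ideal.mul_mem_right _ _ (Ideal.pow_mem_pow hx n))
  rw [sub_eq_zero.1 this]
  exact Ideal.sum_mem _ fun a ha => Ideal.mul_mem_left _ _ (Ideal.subset_span ha)

theorem noeth_of_complete {A : Type u} [CommRing A] (I : Ideal A) (hI : I.FG) [IsAdicComplete I A]
    (h : IsNoetherianRing (A ⧸ I)) : IsNoetherianRing A := by
  by_contra hA
  have : ∃ J : Ideal A, ¬ J.FG := by
    by_contra! h
    exact hA ⟨h⟩
  obtain ⟨J, hJ⟩ := this
  obtain ⟨q, hq⟩ := exists_max_not_fg hJ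
  have hqp := Ideal.isOka_fg.isPrime_of_maximal_not hq
  by_cases hIq : I ≤ q
  · refine hq.prop (Ideal.fg_of_fg_map_of_fg_inf_ker_of_surjective
      (f := Ideal.Quotient.mk I) ?_ ?_ Ideal.Quotient.mk_surjective)
    · exact h.1 _
    · rw [Ideal.mk_ker, inf_eq_right.2 hIq]
      exact hI
  · obtain ⟨x, hx, hxq⟩ := Set.not_subset.1 hIq
    have h1 : (q ⊔ Ideal.span {x}).FG := of_not_not <|
      hq.not_prop_of_gt (Submodule.lt_sup_iff_notMem.2 hxq)
    have h2 : q ⊔ Ideal.span {x} = Ideal.span (q ∪ {x} : Set A) := by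
      rw [Ideal.span_union, Ideal.span_eq]
    rw [h2] at h1
    classical
    obtain ⟨s, hs, hs'⟩ := (Submodule.fg_span_iff_fg_span_finset_subset _).1 h1
    refine hq.prop ⟨s.erase x, (complete_fg_aux I hx (q := q) (s.erase x) ?_ ?_).symm⟩
    · intro y hy
      have hys : y ∈ Ideal.span (s : Set A) := by
        have : y ∈ Ideal.span (q ∪ {x} : Set A) := Ideal.subset_span (Or.inl hy)
        rw [Ideal.span, hs'] at this
        exact this
      have hle : Ideal.span (s : Set A) ≤ Ideal.span (s.erase x : Set A) ⊔ Ideal.span {x} := by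
        rw [← Ideal.span_union]
        refine Ideal.span_mono fun a ha => ?_
        by_cases hax : a = x
        · right; simp [hax]
        · left; simp [hax]; exact ha
      obtain ⟨u, hu, v, hv, huv⟩ := Submodule.mem_sup.1 (hle hys)
      obtain ⟨w, rfl⟩ := Ideal.mem_span_singleton'.1 hv
      obtain ⟨c, hc⟩ := Submodule.mem_span_finset.1 hu
      have huq : u ∈ q := by
        refine (Ideal.span_le.2 ?_ : Ideal.span (s.erase x : Set A) ≤ q) hu
        intro a ha
        have ha' := Finset.mem_erase.1 ha
        rcases hs ha'.2 with h | h
        · exact h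
        · exact absurd h ha'.1
      have hwq : w * x ∈ q := by
        have : w * x = y - u := by rw [← huv]; ring
        rw [this]; exact q.sub_mem hy huq
      refine ⟨w, (hqp.mem_or_mem hwq).resolve_right hxq, c, ?_⟩
      rw [← huv, ← hc.2, mul_comm w x]
      simp
    · intro a ha
      have ha' := Finset.mem_erase.1 ha
      rcases hs ha'.2 with h | h
      · exact h
      · exact absurd h ha'.1

theorem noeth_adicCompletion {A : Type u} [CommRing A] (I : Ideal A) (hI : I.FG)
    (h : IsNoetherianRing (A ⧸ I)) : IsNoetherianRing (AdicCompletion I A) := by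
  have := AdicCompletion.isAdicComplete_self I hI
  refine noeth_of_complete (I.map (algebraMap A (AdicCompletion I A))) (hI.map _) ?_
  rw [← AdicCompletion.ker_evalOneₐ_eq_map I hI]
  exact isNoetherianRing_of_ringEquiv _ (RingHom.quotientKerEquivOfSurjective
    (f := (AdicCompletion.evalOneₐ I).toRingHom) (AdicCompletion.evalOneₐ_surjective I)).symm
end part5

section part6
theorem lift_minpoly {C K L : Type u} [CommRing C] [Field K] [Field L] [Algebra K L] (e : C →+* K)
    (he : Function.Surjective e) (x : L) (hx : IsIntegral K x) :
    ∃ f : Polynomial C, f.Monic ∧ Polynomial.eval₂ ((algebraMap K L).comp e) x f = 0 ∧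
      ∀ R : Polynomial C, R.degree < f.degree →
        Polynomial.eval₂ ((algebraMap K L).comp e) x R = 0 → ∀ i, e (R.coeff i) = 0 := by
  obtain ⟨q, hq1, hq2, hq3⟩ := Polynomial.lifts_and_degree_eq_and_monic (f := e)
    (p := minpoly K x) (by
      rw [Polynomial.lifts_iff_coeff_lifts]
      intro n; exact he _) (minpoly.monic hx)
  refine ⟨q, hq3, ?_, ?_⟩
  · rw [← Polynomial.eval₂_map, hq1]
    exact minpoly.aeval K x
  · intro R hR h0 i
    rw [← Polynomial.eval₂_map] at h0
    have : R.map e = 0 := by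
      by_contra hne
      have h1 := minpoly.degree_le_of_ne_zero K x hne h0
      have h2 := Polynomial.degree_map_le (p := R) (f := e)
      rw [← hq2] at h1
      exact absurd (h1.trans h2) (not_le.2 hR)
    rw [← Polynomial.coeff_map, this, Polynomial.coeff_zero]

theorem monic_mem_map_C {A : Type u} [CommRing A] {J : Ideal A} {f p : Polynomial A} (hf : f.Monic)
    (h : f * p ∈ J.map Polynomial.C) : p ∈ J.map Polynomial.C := by
  have hk : RingHom.ker (Polynomial.mapRingHom (Ideal.Quotient.mk J)) = J.map Polynomial.C := by
    rw [Polynomial.ker_mapRingHom, Ideal.mk_ker]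
  rw [← hk, RingHom.mem_ker] at h ⊢
  rw [map_mul] at h
  have := (hf.map (Ideal.Quotient.mk J)).isRegular.left
  apply this
  simpa using h

theorem monic_supported_regular {κ ι : Type u} [Field κ] [DecidableEq ι] {t : ι} {T D : Set ι}
    (hT : t ∉ T)
    {f : Polynomial (MvPolynomial T κ)} (hf : f.Monic) {F : ι → MvPolynomial ι κ}
    (hF : F t = Polynomial.eval₂ (MvPolynomial.rename ((↑) : T → ι)).toRingHom (MvPolynomial.X t) f)
    (hD : ∀ s ∈ D, F s ∈ MvPolynomial.supported κ T)
    {p : MvPolynomial ι κ} (hp : F t * p ∈ Ideal.span (F '' D)) : p ∈ Ideal.span (F '' D) := by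
  let Φ : MvPolynomial ι κ →ₐ[κ] Polynomial (MvPolynomial ι κ) :=
    MvPolynomial.aeval (fun s => if s = t then Polynomial.X else Polynomial.C (MvPolynomial.X s))
  let Ψ : Polynomial (MvPolynomial ι κ) →ₐ[MvPolynomial ι κ] MvPolynomial ι κ :=
    Polynomial.aeval (MvPolynomial.X t)
  have hΨΦ : ∀ p, Ψ (Φ p) = p := by
    intro p
    have : (Ψ.restrictScalars κ).comp Φ = AlgHom.id κ _ := by
      ext s
      by_cases hs : s = t
      · simp [Φ, Ψ, hs]
      · simp [Φ, Ψ, hs]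
    exact congrArg (fun g : MvPolynomial ι κ →ₐ[κ] MvPolynomial ι κ => g p) this
  have hΦr : ∀ q : MvPolynomial T κ, Φ (MvPolynomial.rename (↑) q) =
      Polynomial.C (MvPolynomial.rename (↑) q) := by
    intro q
    have : Φ.comp (MvPolynomial.rename ((↑) : T → ι)) =
        (Polynomial.CAlgHom (R := κ) (A := MvPolynomial ι κ)).comp (MvPolynomial.rename (↑)) := by
      ext s
      have : (s : ι) ≠ t := fun h => hT (h ▸ s.2)
      simp [Φ, this]
    exact congrArg (fun g : MvPolynomial T κ →ₐ[κ] Polynomial (MvPolynomial ι κ) => g q) this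
  have hΦt : Φ (F t) = f.map (MvPolynomial.rename ((↑) : T → ι)).toRingHom := by
    rw [hF]
    have h1 := Polynomial.hom_eval₂ f (MvPolynomial.rename ((↑) : T → ι)).toRingHom
      Φ.toRingHom (MvPolynomial.X t)
    refine Eq.trans h1 ?_
    have h2 : Φ.toRingHom (MvPolynomial.X t) = Polynomial.X := by simp [Φ]
    have h3 : Φ.toRingHom.comp (MvPolynomial.rename ((↑) : T → ι)).toRingHom =
        Polynomial.C.comp (MvPolynomial.rename ((↑) : T → ι)).toRingHom :=
      RingHom.ext fun q => hΦr q
    rw [h2, h3, Polynomial.map]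
  have hJ : (Ideal.span (F '' D)).map Φ.toRingHom ≤ (Ideal.span (F '' D)).map Polynomial.C := by
    rw [Ideal.map_span, Ideal.span_le]
    rintro _ ⟨_, ⟨s, hs, rfl⟩, rfl⟩
    have := hD s hs
    rw [MvPolynomial.supported_eq_range_rename] at this
    obtain ⟨q, hq⟩ := this
    have h4 : Φ.toRingHom (F s) = Polynomial.C (F s) := by
      rw [← hq]; exact hΦr q
    rw [h4]
    exact Ideal.mem_map_of_mem _ (Ideal.subset_span ⟨s, hs, rfl⟩)
  have h5 : Φ (F t) * Φ p ∈ (Ideal.span (F '' D)).map Polynomial.C := by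
    rw [← map_mul]
    exact hJ (Ideal.mem_map_of_mem Φ.toRingHom hp)
  rw [hΦt] at h5
  have h6 := monic_mem_map_C (hf.map _) h5
  have h7 := Ideal.mem_map_of_mem Ψ.toRingHom h6
  rw [Ideal.map_map] at h7
  have h8 : Ψ.toRingHom.comp Polynomial.C = RingHom.id _ := by ext <;> simp [Ψ]
  rw [h8, Ideal.map_id] at h7
  rw [← hΨΦ p]
  exact h7

theorem field_rel {κ L ι : Type u} [Field κ] [Field L] [Algebra κ L] [Algebra.IsAlgebraic κ L]
    [LinearOrder ι] [WellFoundedLT ι] (v : ι → L) :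
    ∃ F : ι → MvPolynomial ι κ,
      RingHom.ker (MvPolynomial.aeval (R := κ) v) = Ideal.span (Set.range F) ∧
      ∀ (t : ι) (D : Set ι), (∀ s ∈ D, s < t) → ∀ p, F t * p ∈ Ideal.span (F '' D) →
        p ∈ Ideal.span (F '' D) := by
  classical
  have H : ∀ t : ι, ∃ f : Polynomial (MvPolynomial (Set.Iio t) κ), f.Monic ∧
      Polynomial.eval₂ (MvPolynomial.aeval (R := κ) (fun s : Set.Iio t => v s)).toRingHom (v t) f = 0 ∧
      ∀ R : Polynomial (MvPolynomial (Set.Iio t) κ), R.degree < f.degree →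
      Polynomial.eval₂ (MvPolynomial.aeval (R := κ) (fun s : Set.Iio t => v s)).toRingHom (v t) R = 0 →
        ∀ i, MvPolynomial.aeval (R := κ) (fun s : Set.Iio t => v s) (R.coeff i) = 0 := by
    intro t
    let K := IntermediateField.adjoin κ (Set.range (fun s : Set.Iio t => v s))
    have hK : (MvPolynomial.aeval (R := κ) (fun s : Set.Iio t => v s)).range = K.toSubalgebra := by
      rw [IntermediateField.adjoin_toSubalgebra_of_isAlgebraic
        (fun x _ => Algebra.IsAlgebraic.isAlgebraic x), Algebra.adjoin_range_eq_range_aeval]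
    let e : MvPolynomial (Set.Iio t) κ →ₐ[κ] K :=
      (MvPolynomial.aeval (R := κ) (fun s : Set.Iio t => v s)).codRestrict K.toSubalgebra
        (fun x => hK ▸ ⟨x, rfl⟩)
    have he : Function.Surjective e := by
      rintro ⟨y, hy⟩
      have : y ∈ (MvPolynomial.aeval (R := κ) (fun s : Set.Iio t => v s)).range := by
        rw [hK]; exact hy
      obtain ⟨x, hx⟩ := this
      exact ⟨x, Subtype.ext hx⟩
    obtain ⟨f, h1, h2, h3⟩ := lift_minpoly e.toRingHom he (v t)
      (Algebra.IsIntegral.isIntegral (R := K) (v t))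
    have hc : (algebraMap K L).comp e.toRingHom =
      (MvPolynomial.aeval (R := κ) (fun s : Set.Iio t => v s)).toRingHom := by
      ext <;> rfl
    rw [hc] at h2 h3
    refine ⟨f, h1, h2, fun R hR h0 i => ?_⟩
    have := h3 R hR h0 i
    exact congrArg (fun x : K => (x : L)) this
  choose f hf1 hf2 hf3 using H
  let ψ : (t : ι) → Polynomial (MvPolynomial (Set.Iio t) κ) →+* MvPolynomial ι κ := fun t =>
    Polynomial.eval₂RingHom (MvPolynomial.rename ((↑) : Set.Iio t → ι)).toRingHom (MvPolynomial.X t)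
  have hψ : ∀ t p, MvPolynomial.aeval v (ψ t p) = Polynomial.eval₂
      (MvPolynomial.aeval (R := κ) (fun s : Set.Iio t => v s)).toRingHom (v t) p := by
    intro t p
    have h1 := Polynomial.hom_eval₂ p (MvPolynomial.rename ((↑) : Set.Iio t → ι)).toRingHom
      (MvPolynomial.aeval (R := κ) v).toRingHom (MvPolynomial.X t)
    refine Eq.trans h1 ?_
    have h2 : (MvPolynomial.aeval (R := κ) v).toRingHom (MvPolynomial.X t) = v t := by simp
    have h3 : (MvPolynomial.aeval (R := κ) v).toRingHom.comp
        (MvPolynomial.rename ((↑) : Set.Iio t → ι)).toRingHom =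
        (MvPolynomial.aeval (R := κ) (fun s : Set.Iio t => v s)).toRingHom := by
      refine RingHom.ext fun q => ?_
      exact MvPolynomial.aeval_rename _ _ q
    rw [h2, h3]
  have hψs : ∀ t p, ψ t p ∈ MvPolynomial.supported κ (Set.Iic t) := by
    intro t p
    induction p using Polynomial.induction_on' with
    | add p q hp hq => rw [map_add]; exact add_mem hp hq
    | monomial n a =>
      have : ψ t (Polynomial.monomial n a) =
        MvPolynomial.rename (↑) a * MvPolynomial.X t ^ n := by simp [ψ]
      rw [this]
      refine mul_mem ?_ (pow_mem ?_ _)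
      · have : MvPolynomial.rename ((↑) : Set.Iio t → ι) a ∈ MvPolynomial.supported κ (Set.Iio t) := by
          rw [MvPolynomial.supported_eq_range_rename]; exact ⟨a, rfl⟩
        exact MvPolynomial.supported_mono Set.Iio_subset_Iic_self this
      · exact MvPolynomial.X_mem_supported.2 (Set.mem_Iic.2 le_rfl)
  have hψe : ∀ t, ∀ q ∈ MvPolynomial.supported κ (Set.Iic t), ∃ p, ψ t p = q := by
    intro t q hq
    rw [MvPolynomial.supported_eq_adjoin_X] at hq
    induction hq using Algebra.adjoin_induction with
    | mem x hx =>
      obtain ⟨s, hs, rfl⟩ := hx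
      rcases (Set.mem_Iic.1 hs).lt_or_eq with h | h
      · exact ⟨Polynomial.C (MvPolynomial.X ⟨s, h⟩), by simp [ψ]⟩
      · exact ⟨Polynomial.X, by simp [ψ, h]⟩
    | algebraMap r => exact ⟨Polynomial.C (MvPolynomial.C r), by simp [ψ]⟩
    | add x y _ _ hx hy =>
      obtain ⟨a, rfl⟩ := hx
      obtain ⟨b, rfl⟩ := hy
      exact ⟨a + b, map_add _ _ _⟩
    | mul x y _ _ hx hy =>
      obtain ⟨a, rfl⟩ := hx
      obtain ⟨b, rfl⟩ := hy
      exact ⟨a * b, map_mul _ _ _⟩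
  refine ⟨fun t => ψ t (f t), le_antisymm ?_ ?_, ?_⟩
  · have key : ∀ t, ∀ q ∈ MvPolynomial.supported κ (Set.Iic t), MvPolynomial.aeval v q = 0 →
        q ∈ Ideal.span (Set.range fun t => ψ t (f t)) := by
      intro t
      induction t using WellFoundedLT.induction with
      | ind t ih =>
        intro q hq h0
        obtain ⟨P, rfl⟩ := hψe t q hq
        have hdiv := Polynomial.modByMonic_add_div P (f t)
        have hev : Polynomial.eval₂ (MvPolynomial.aeval (R := κ)
            (fun s : Set.Iio t => v s)).toRingHom (v t) (P %ₘ f t) = 0 := by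
          rw [hψ] at h0
          rw [← hdiv] at h0
          rw [Polynomial.eval₂_add, Polynomial.eval₂_mul, hf2, zero_mul, add_zero] at h0
          exact h0
        have hc := hf3 t (P %ₘ f t) (Polynomial.degree_modByMonic_lt _ (hf1 t)) hev
        rw [← hdiv, map_add, map_mul]
        refine Ideal.add_mem _ ?_ (Ideal.mul_mem_right _ _ (Ideal.subset_span ⟨t, rfl⟩))
        have hsum : ψ t (P %ₘ f t) = ∑ i ∈ (P %ₘ f t).support,
            MvPolynomial.rename (↑) ((P %ₘ f t).coeff i) * MvPolynomial.X t ^ i := by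
          simp [ψ, Polynomial.eval₂_eq_sum, Polynomial.sum]
        rw [hsum]
        refine Ideal.sum_mem _ fun i _ => Ideal.mul_mem_right _ _ ?_
        set c := (P %ₘ f t).coeff i
        have hcs : MvPolynomial.rename ((↑) : Set.Iio t → ι) c ∈
            MvPolynomial.supported κ (Set.Iio t) := by
          rw [MvPolynomial.supported_eq_range_rename]; exact ⟨c, rfl⟩
        have hc0 : MvPolynomial.aeval v (MvPolynomial.rename ((↑) : Set.Iio t → ι) c) = 0 := by
          rw [MvPolynomial.aeval_rename]; exact hc i
        set d := MvPolynomial.rename ((↑) : Set.Iio t → ι) c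
        rw [MvPolynomial.mem_supported] at hcs
        by_cases hne : d.vars.Nonempty
        · refine ih (d.vars.max' hne) (hcs (Finset.max'_mem _ hne)) d ?_ hc0
          rw [MvPolynomial.mem_supported]
          intro s hs
          exact Finset.le_max' _ _ hs
        · rw [Finset.not_nonempty_iff_eq_empty] at hne
          rw [MvPolynomial.vars_eq_empty_iff_eq_C] at hne
          obtain ⟨r, hr⟩ : ∃ r, d = MvPolynomial.C r := ⟨_, hne⟩
          rw [hr] at hc0 ⊢
          have : r = 0 := by simpa using hc0
          simp [this]
    intro q hq
    by_cases hne : q.vars.Nonempty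
    · refine key (q.vars.max' hne) q ?_ hq
      rw [MvPolynomial.mem_supported]
      intro s hs
      exact Finset.le_max' _ _ hs
    · rw [Finset.not_nonempty_iff_eq_empty, MvPolynomial.vars_eq_empty_iff_eq_C] at hne
      obtain ⟨r, hr⟩ : ∃ r, q = MvPolynomial.C r := ⟨_, hne⟩
      rw [hr] at hq ⊢
      have : r = 0 := by simpa using hq
      simp [this]
  · rw [Ideal.span_le]
    rintro _ ⟨t, rfl⟩
    show MvPolynomial.aeval v (ψ t (f t)) = 0
    rw [hψ, hf2]
  · intro t D hD p hp
    refine monic_supported_regular (T := Set.Iio t) (by simp) (hf1 t) rfl ?_ hp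
    intro s hs
    refine MvPolynomial.supported_mono ?_ (hψs s (f s))
    intro r hr
    exact lt_of_le_of_lt hr (hD s hs)
end part6

section part7
theorem ext_completion {B T : Type u} [CommRing B] [CommRing T] (I : Ideal B) (J : Ideal T)
    [IsAdicComplete J T] (h : B →+* T) (hI : I.map h ≤ J) :
    ∃ g : AdicCompletion I B →+* T, g.comp (algebraMap B (AdicCompletion I B)) = h := by
  have hle : ∀ n, I ^ n ≤ (J ^ n).comap h := fun n => by
    rw [← Ideal.map_le_iff_le_comap, Ideal.map_pow]
    exact Ideal.pow_right_mono hI n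
  let f : (n : ℕ) → AdicCompletion I B →+* T ⧸ J ^ n := fun n =>
    (Ideal.quotientMap (J ^ n) h (hle n)).comp (AdicCompletion.evalₐ I n).toRingHom
  have hf : ∀ {m n : ℕ} (hle : m ≤ n), (Ideal.Quotient.factorPow J hle).comp (f n) = f m := by
    intro m n hmn
    ext x
    obtain ⟨y, rfl⟩ := AdicCompletion.mk_surjective I B x
    have h1 : Ideal.Quotient.mk (I ^ m) (y.val n) = Ideal.Quotient.mk (I ^ m) (y.val m) :=
      AdicCompletion.Ideal.mk_eq_mk I hmn y
    have h2 : Ideal.Quotient.mk (J ^ m) (h (y.val n)) = Ideal.Quotient.mk (J ^ m) (h (y.val m)) := by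
      rw [Ideal.Quotient.eq] at h1 ⊢
      rw [← map_sub]
      exact hle m h1
    simpa [f, AdicCompletion.evalₐ_mk] using h2
  refine ⟨IsAdicComplete.liftRingHom J f hf, RingHom.ext fun x => ?_⟩
  have h0 : ∀ z : T, (∀ n, Ideal.Quotient.mk (J ^ n) z = 0) → z = 0 := fun z hz => by
    refine IsHausdorff.haus (I := J) (M := T) inferInstance _ fun n => ?_
    rw [SModEq.zero, smul_eq_mul, Ideal.mul_top]
    exact Ideal.Quotient.eq_zero_iff_mem.1 (hz n)
  rw [← sub_eq_zero]
  refine h0 _ fun n => ?_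
  rw [map_sub, RingHom.comp_apply, IsAdicComplete.mk_liftRingHom]
  have : AdicCompletion.evalₐ I n (algebraMap B (AdicCompletion I B) x) =
    Ideal.Quotient.mk (I ^ n) x := by
    rw [AlgHom.commutes]; rfl
  simp [f, this]

theorem flat_iterate {R G ι : Type u} [CommRing R] [IsNoetherianRing R] [CommRing G]
    [LinearOrder ι] {m : Ideal R} [m.IsMaximal] {N : ℕ} (hN : m ^ N = ⊥) {f : R →+* G}
    (hf : f.Flat) {E : ι → G}
    (hE : ∀ (t : ι) (D : Set ι), (∀ s ∈ D, s < t) → ∀ b, E t * b ∈ m.map f ⊔ Ideal.span (E '' D) →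
        b ∈ m.map f ⊔ Ideal.span (E '' D)) (D : Finset ι) :
    ((Ideal.Quotient.mk (Ideal.span (E '' D))).comp f).Flat := by
  induction D using Finset.induction_on_max with
  | empty =>
    refine flat_square (p := RingHom.id R) hf Function.surjective_id Ideal.Quotient.mk_surjective
      rfl ?_
    have h0 : RingHom.ker (RingHom.id R) = ⊥ := by ext; simp
    rw [h0, Ideal.map_bot, Ideal.mk_ker]
    simp
  | insert t D hD ih =>
    let J := Ideal.span (E '' (D : Set ι))
    let J' := Ideal.span (E '' ((insert t D : Finset ι) : Set ι))
    have hJJ : J ≤ J' := Ideal.span_mono (Set.image_mono (by simp))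
    have hsup : J' = J ⊔ Ideal.span {E t} := by
      simp only [J, J', ← Ideal.span_union]
      congr 1
      ext x; simp [Set.image_insert_eq]
    have := flat_quot_of_regular ih (π := Ideal.Quotient.factor hJJ)
      (v := Ideal.Quotient.mk J (E t)) (Ideal.Quotient.factor_surjective hJJ) (by
        rw [Ideal.Quotient.factor_ker, hsup, Ideal.map_sup, Ideal.map_quotient_self, bot_sup_eq,
          Ideal.map_span, Set.image_singleton]) (by
        intro 𝔞
        refine regular_mod_core ih m ?_ N 𝔞 (hN ▸ bot_le)
        intro b hb
        obtain ⟨b, rfl⟩ := Ideal.Quotient.mk_surjective b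
        rw [← Ideal.map_map, ← map_mul] at hb
        rw [← Ideal.map_map]
        have hmem : ∀ x, Ideal.Quotient.mk J x ∈ (m.map f).map (Ideal.Quotient.mk J) ↔
            x ∈ m.map f ⊔ J := by
          intro x
          rw [← Ideal.mem_comap, Ideal.comap_map_of_surjective' _ Ideal.Quotient.mk_surjective,
            Ideal.mk_ker]
        exact (hmem b).2 (hE t D (fun s hs => hD s hs) b ((hmem _).1 hb)))
    rw [← RingHom.comp_assoc, Ideal.Quotient.factor_comp_mk] at this
    exact this

theorem flat_limit {R G ι : Type u} [CommRing R] [CommRing G] {f : R →+* G} {E : ι → G}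
    (h : ∀ D : Finset ι, ((Ideal.Quotient.mk (Ideal.span (E '' D))).comp f).Flat) :
    ((Ideal.Quotient.mk (Ideal.span (Set.range E))).comp f).Flat := by
  classical
  apply flat_of_elem
  intro l a b hab
  choose b' hb' using fun i => Ideal.Quotient.mk_surjective (b i)
  obtain rfl : b = fun i => Ideal.Quotient.mk _ (b' i) := funext fun i => (hb' i).symm
  have h1 : ∑ i, f (a i) * b' i ∈ Ideal.span (Set.range E) := by
    rw [← Ideal.Quotient.eq_zero_iff_mem, map_sum, ← hab]
    simp
  obtain ⟨s, hs, hs'⟩ := Submodule.mem_span_finite_of_mem_span h1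
  obtain ⟨D, -, hD⟩ := Finset.subset_set_image_iff.1 (show (s : Set G) ⊆ E '' Set.univ by simpa using hs)
  have h2 : ∑ i, f (a i) * b' i ∈ Ideal.span (E '' (D : Set ι)) := by
    rw [← Finset.coe_image, hD]; exact hs'
  obtain ⟨k, α, y, hy, hα⟩ := flat_elem (h D) a (fun i => Ideal.Quotient.mk _ (b' i)) (by
    rw [← Ideal.Quotient.eq_zero_iff_mem, map_sum] at h2
    simpa using h2)
  have hle : Ideal.span (E '' (D : Set ι)) ≤ Ideal.span (Set.range E) :=
    Ideal.span_mono (Set.image_subset_range _ _)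
  refine ⟨k, α, fun j => Ideal.Quotient.factor hle (y j), fun i => ?_, hα⟩
  have := congrArg (Ideal.Quotient.factor hle) (hy i)
  simpa using this

theorem flat_local_crit {Λ S : Type u} [CommRing Λ] [CommRing S] [IsNoetherianRing Λ]
    [IsNoetherianRing S] [IsLocalRing S] (μ : Ideal Λ) {j : Λ →+* S}
    (hμ : μ.map j ≤ maximalIdeal S)
    (H : ∀ N : ℕ, ∃ (Λ1 S1 : Type u) (_ : CommRing Λ1) (_ : CommRing S1) (p : Λ →+* Λ1)
      (q : S →+* S1) (f : Λ1 →+* S1), Function.Surjective p ∧ Function.Surjective q ∧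
      f.comp p = q.comp j ∧ f.Flat ∧ RingHom.ker p ≤ μ ^ N ∧ RingHom.ker q ≤ (μ ^ N).map j) :
    j.Flat := by
  apply flat_of_elem
  intro l a s hs
  let W : Submodule S (Fin l → S) := Submodule.span S
    {w | ∃ z : Fin l → Λ, ∑ i, a i * z i = 0 ∧ w = fun i => j (z i)}
  have hsW : s ∈ W := by
    suffices h : ∀ n, ∃ w ∈ W, ∀ i, s i - w i ∈ maximalIdeal S ^ n by
      have h1 := Ideal.iInf_pow_smul_eq_bot_of_isLocalRing (R := S) (M := (Fin l → S) ⧸ W)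
        (maximalIdeal S) (maximalIdeal.isMaximal S).ne_top
      have h2 : (Submodule.Quotient.mk s : (Fin l → S) ⧸ W) ∈
          (⨅ i : ℕ, maximalIdeal S ^ i • ⊤ : Submodule S ((Fin l → S) ⧸ W)) := by
        rw [Submodule.mem_iInf]
        intro n
        obtain ⟨w, hw, hsw⟩ := h n
        have h3 : (Submodule.Quotient.mk s : (Fin l → S) ⧸ W) = W.mkQ (s - w) := by
          rw [map_sub, W.mkQ_apply w, (Submodule.Quotient.mk_eq_zero W).2 hw, sub_zero]; rfl
        rw [h3]
        have h4 : s - w = ∑ i, (s i - w i) • (Pi.single i 1 : Fin l → S) := by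
          ext i; simp [Finset.sum_apply, Pi.single_apply]
        rw [h4, map_sum]
        refine Submodule.sum_mem _ fun i _ => ?_
        rw [map_smul]
        exact Submodule.smul_mem_smul (hsw i) trivial
      rw [h1, Submodule.mem_bot, Submodule.Quotient.mk_eq_zero] at h2
      exact h2
    intro n
    let A : Ideal Λ := Ideal.span (Set.range a)
    obtain ⟨k, hk⟩ := Ideal.exists_pow_inf_eq_pow_smul μ (A : Submodule Λ Λ)
    have hAR : ∀ c : Fin l → Λ, ∑ i, a i * c i ∈ μ ^ (n + k) → ∃ d : Fin l → Λ,
        (∀ i, d i ∈ μ ^ n) ∧ ∑ i, a i * (c i - d i) = 0 := by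
      intro c hc
      have h1 : ∑ i, a i * c i ∈ μ ^ n * A := by
        have h2 := hk (n + k) (Nat.le_add_left _ _)
        have h3 : ∑ i, a i * c i ∈ (μ ^ (n + k) • ⊤ ⊓ A : Submodule Λ Λ) := by
          refine ⟨by simpa using hc, Ideal.sum_mem _ fun i _ => Ideal.mul_mem_right _ _ ?_⟩
          exact Ideal.subset_span ⟨i, rfl⟩
        rw [h2, Nat.add_sub_cancel] at h3
        exact Submodule.smul_mono le_rfl inf_le_right h3
      obtain ⟨d, hd, hd'⟩ := (Submodule.mem_ideal_smul_span_iff_exists_sum _ a _).1 h1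
      refine ⟨d, hd, ?_⟩
      simp only [mul_sub, Finset.sum_sub_distrib, sub_eq_zero]
      rw [← hd', Finsupp.sum_fintype _ _ (by simp)]
      simp [mul_comm]
    obtain ⟨Λ1, S1, _, _, p, q, f, hp, hq, hc, hf, hkp, hkq⟩ := H (n + k)
    have hc' : ∀ x, f (p x) = q (j x) := fun x => congrArg (fun g : Λ →+* S1 => g x) hc
    obtain ⟨r, α, y, h1, h2⟩ := flat_elem hf (fun i => p (a i)) (fun i => q (s i)) (by
      simp only [hc', ← map_mul, ← map_sum, hs, map_zero])
    choose α' hα' using fun i t => hp (α i t)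
    choose y' hy' using fun t => hq (y t)
    have h3 : ∀ t, ∑ i, a i * α' i t ∈ μ ^ (n + k) := fun t => hkp (by
      rw [RingHom.mem_ker, map_sum, ← h2 t]
      simp [hα'])
    choose d hd hd' using fun t => hAR (fun i => α' i t) (h3 t)
    refine ⟨∑ t, y' t • (fun i => j (α' i t - d t i)), Submodule.sum_mem _ fun t _ =>
      Submodule.smul_mem _ _ (Submodule.subset_span ⟨_, hd' t, rfl⟩), fun i => ?_⟩
    have h4 : s i - ∑ t, j (α' i t) * y' t ∈ (μ ^ (n + k)).map j := hkq (by
      rw [RingHom.mem_ker, map_sub, h1 i, map_sum, sub_eq_zero]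
      refine Finset.sum_congr rfl fun t _ => ?_
      rw [map_mul, hy', ← hc', hα'])
    have h5 : ∀ N, (μ ^ N).map j ≤ maximalIdeal S ^ N := fun N => by
      rw [Ideal.map_pow]; exact Ideal.pow_right_mono hμ N
    have h6 : s i - (∑ t, y' t • (fun i => j (α' i t - d t i))) i =
        (s i - ∑ t, j (α' i t) * y' t) + ∑ t, j (d t i) * y' t := by
      simp only [Finset.sum_apply, Pi.smul_apply, smul_eq_mul, map_sub, mul_sub,
        Finset.sum_sub_distrib]
      simp only [mul_comm (y' _)]
      ring
    rw [h6]
    refine Ideal.add_mem _ (Ideal.pow_le_pow_right (Nat.le_add_right _ _) (h5 _ h4)) ?_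
    exact Ideal.sum_mem _ fun t _ => Ideal.mul_mem_right _ _ (h5 n (Ideal.mem_map_of_mem j (hd t i)))
  obtain ⟨k, y, w, hw⟩ := Submodule.mem_span_set'.1 hsW
  choose z hz hz' using fun t => (w t).2
  refine ⟨k, fun i t => z t i, y, fun i => ?_, fun t => hz t⟩
  rw [← hw]
  simp only [Finset.sum_apply, Pi.smul_apply, smul_eq_mul]
  refine Finset.sum_congr rfl fun t _ => ?_
  rw [hz' t, mul_comm]
end part7

section part8
theorem core_flat {Λ G ι : Type u} [CommRing Λ] [IsNoetherianRing Λ] [CommRing G]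
    [LinearOrder ι] {μ : Ideal Λ} [hμ : μ.IsMaximal] {f : Λ →+* G}
    (hf : f.Flat) {E : ι → G}
    (hE : ∀ (t : ι) (D : Set ι), (∀ s ∈ D, s < t) → ∀ b, E t * b ∈ μ.map f ⊔ Ideal.span (E '' D) →
        b ∈ μ.map f ⊔ Ideal.span (E '' D)) (N : ℕ) :
    ∃ (Λ1 S1 : Type u) (_ : CommRing Λ1) (_ : CommRing S1) (p : Λ →+* Λ1)
      (q : (G ⧸ Ideal.span (Set.range E)) →+* S1) (f1 : Λ1 →+* S1),
      Function.Surjective p ∧ Function.Surjective q ∧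
      f1.comp p = q.comp ((Ideal.Quotient.mk _).comp f) ∧ f1.Flat ∧ RingHom.ker p = μ ^ (N + 1) ∧
      RingHom.ker q = (μ ^ (N + 1)).map ((Ideal.Quotient.mk (Ideal.span (Set.range E))).comp f) := by
  let a := μ ^ (N + 1)
  have hle : a ≤ (a.map f).comap f := Ideal.le_comap_map
  let r : Λ ⧸ a →+* G ⧸ a.map f := Ideal.quotientMap (a.map f) f hle
  have hrc : r.comp (Ideal.Quotient.mk a) = (Ideal.Quotient.mk (a.map f)).comp f :=
    Ideal.quotientMap_comp_mk hle
  have hr : r.Flat := flat_square hf Ideal.Quotient.mk_surjective Ideal.Quotient.mk_surjective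
    hrc (by rw [Ideal.mk_ker, Ideal.mk_ker])
  let m : Ideal (Λ ⧸ a) := μ.map (Ideal.Quotient.mk a)
  have hm : m.IsMaximal := by
    refine (Ideal.map_eq_top_or_isMaximal_of_surjective (Ideal.Quotient.mk a)
      Ideal.Quotient.mk_surjective hμ).resolve_left fun h => ?_
    have h1 := Ideal.comap_map_of_surjective' (Ideal.Quotient.mk a) Ideal.Quotient.mk_surjective μ
    rw [h, Ideal.comap_top, Ideal.mk_ker, sup_eq_left.2 (Ideal.pow_le_self (Nat.succ_ne_zero N))] at h1
    exact hμ.ne_top h1.symm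
  have hmN : m ^ (N + 1) = ⊥ := by
    rw [← Ideal.map_pow, Ideal.map_quotient_self]
  let E' : ι → G ⧸ a.map f := fun t => Ideal.Quotient.mk _ (E t)
  have hker : ∀ x (D : Set ι), Ideal.Quotient.mk (a.map f) x ∈ m.map r ⊔ Ideal.span (E' '' D) ↔
      x ∈ μ.map f ⊔ Ideal.span (E '' D) := by
    intro x D
    have h1 : m.map r ⊔ Ideal.span (E' '' D) =
        (μ.map f ⊔ Ideal.span (E '' D)).map (Ideal.Quotient.mk (a.map f)) := by
      rw [Ideal.map_sup, Ideal.map_span, Ideal.map_map, Ideal.map_map, hrc, ← Set.image_comp]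
      rfl
    rw [h1, ← Ideal.mem_comap, Ideal.comap_map_of_surjective' _ Ideal.Quotient.mk_surjective,
      Ideal.mk_ker, sup_eq_left.2]
    exact le_sup_of_le_left (Ideal.map_mono (Ideal.pow_le_self (Nat.succ_ne_zero N)))
  have hfl := flat_limit (flat_iterate hmN hr (E := E') (by
    intro t D hD b hb
    obtain ⟨b, rfl⟩ := Ideal.Quotient.mk_surjective b
    rw [← map_mul, hker] at hb
    rw [hker]
    exact hE t D hD b hb))
  let q0 : G →+* (G ⧸ a.map f) ⧸ Ideal.span (Set.range E') :=
    (Ideal.Quotient.mk _).comp (Ideal.Quotient.mk _)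
  have hq0 : RingHom.ker q0 = a.map f ⊔ Ideal.span (Set.range E) := by
    have h1 : Ideal.span (Set.range E') =
        (Ideal.span (Set.range E)).map (Ideal.Quotient.mk (a.map f)) := by
      rw [Ideal.map_span, ← Set.range_comp]; rfl
    rw [← RingHom.comap_ker, Ideal.mk_ker, h1,
      Ideal.comap_map_of_surjective' _ Ideal.Quotient.mk_surjective, Ideal.mk_ker, sup_comm]
  have hq1 : ∀ x ∈ Ideal.span (Set.range E), q0 x = 0 := fun x hx => by
    rw [← RingHom.mem_ker, hq0]; exact Ideal.mem_sup_right hx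
  refine ⟨_, _, inferInstance, inferInstance, Ideal.Quotient.mk a, Ideal.Quotient.lift _ q0 hq1,
    (Ideal.Quotient.mk _).comp r, Ideal.Quotient.mk_surjective,
    Ideal.Quotient.lift_surjective_of_surjective _ hq1
      (Ideal.Quotient.mk_surjective.comp Ideal.Quotient.mk_surjective), ?_, hfl, Ideal.mk_ker, ?_⟩
  · rw [RingHom.comp_assoc, hrc, ← RingHom.comp_assoc, ← RingHom.comp_assoc,
      Ideal.Quotient.lift_comp_mk]
  · have h2 : RingHom.ker (Ideal.Quotient.lift (Ideal.span (Set.range E)) q0 hq1) =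
      (RingHom.ker q0).map (Ideal.Quotient.mk _) := Ideal.ker_quotient_lift q0 _
    rw [h2, hq0, Ideal.map_sup, Ideal.map_quotient_self, sup_bot_eq, Ideal.map_map]
end part8

section part9
theorem completion_package {B : Type u} [CommRing B] (I : Ideal B) [hm : I.IsMaximal] (hI : I.FG) :
    IsNoetherianRing (AdicCompletion I B) ∧ ∃ _ : IsLocalRing (AdicCompletion I B),
      IsAdicComplete (maximalIdeal (AdicCompletion I B)) (AdicCompletion I B) ∧
      maximalIdeal (AdicCompletion I B) = I.map (algebraMap B (AdicCompletion I B)) := by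
  have hN : IsNoetherianRing (B ⧸ I) := by
    letI := Ideal.Quotient.field I
    infer_instance
  have h1 := noeth_adicCompletion I hI hN
  have h2 := AdicCompletion.isAdicComplete_self I hI
  have h3 : (I.map (algebraMap B (AdicCompletion I B))).IsMaximal := by
    rw [← AdicCompletion.ker_evalOneₐ_eq_map I hI]
    letI := Ideal.Quotient.field I
    exact RingHom.ker_isMaximal_of_surjective (AdicCompletion.evalOneₐ I).toRingHom
      (AdicCompletion.evalOneₐ_surjective I)
  have h4 : IsLocalRing (AdicCompletion I B) := isLocalRing_of_isAdicComplete_maximal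
    (I.map (algebraMap B (AdicCompletion I B)))
  have h5 := (IsLocalRing.eq_maximalIdeal h3)
  refine ⟨h1, h4, ?_, h5.symm⟩
  rw [← h5]; exact h2

theorem mem_of_evalA_eq_zero {B : Type u} [CommRing B] {I : Ideal B} (hfg : I.FG) {n : ℕ}
    {x : AdicCompletion I B} (hx0 : AdicCompletion.evalₐ I n x = 0) :
    x ∈ (I ^ n).map (algebraMap B (AdicCompletion I B)) := by
  have h := AdicCompletion.pow_smul_top_eq_ker_eval (M := B) (n := n) hfg
  have hx2 : x ∈ LinearMap.ker (AdicCompletion.eval I B n) := by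
    rw [LinearMap.mem_ker]
    have := AdicCompletion.factor_evalₐ_eq_eval (I := I) (n := n) x (by simp)
    rw [← this, hx0, map_zero]
  rw [← h] at hx2
  rw [← Submodule.restrictScalars_mem B, ← Ideal.smul_top_eq_map]
  exact hx2

theorem flat_completion {Λ B : Type u} [CommRing Λ] [CommRing B] [IsNoetherianRing Λ]
    {μ : Ideal Λ} {f : Λ →+* B} {I : Ideal B} (hI : μ.map f = I) [hm : I.IsMaximal] (hfg : I.FG)
    (H : ∀ N : ℕ, ∃ (Λ1 S1 : Type u) (_ : CommRing Λ1) (_ : CommRing S1) (p : Λ →+* Λ1)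
      (q : B →+* S1) (f1 : Λ1 →+* S1), Function.Surjective p ∧ Function.Surjective q ∧
      f1.comp p = q.comp f ∧ f1.Flat ∧ RingHom.ker p = μ ^ (N + 1) ∧
      RingHom.ker q = (μ ^ (N + 1)).map f) :
    ((algebraMap B (AdicCompletion I B)).comp f).Flat := by
  obtain ⟨h1, h2, h3, h4⟩ := completion_package I hfg
  refine flat_local_crit μ ?_ ?_
  · rw [← Ideal.map_map, hI, h4]
  · intro N
    obtain ⟨Λ1, S1, _, _, p, q, f1, hp, hq, hc, hf, hkp, hkq⟩ := H N
    have hkq' : RingHom.ker q = I ^ (N + 1) := by rw [hkq, Ideal.map_pow, hI]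
    let q' : (B ⧸ I ^ (N + 1)) →+* S1 := Ideal.Quotient.lift _ q (fun a ha => by
      rw [← RingHom.mem_ker, hkq']; exact ha)
    refine ⟨Λ1, S1, inferInstance, inferInstance, p,
      q'.comp (AdicCompletion.evalₐ I (N + 1)).toRingHom, f1, hp, ?_, ?_, hf, ?_, ?_⟩
    · rw [RingHom.coe_comp]
      exact Function.Surjective.comp (Ideal.Quotient.lift_surjective_of_surjective _ _ hq)
        (AdicCompletion.surjective_evalₐ I (N + 1))
    · rw [hc]
      ext x
      have : (AdicCompletion.evalₐ I (N + 1)) (algebraMap B (AdicCompletion I B) (f x)) =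
        Ideal.Quotient.mk _ (f x) := AlgHom.commutes _ _
      simp only [RingHom.comp_apply]
      erw [this]
      rfl
    · rw [hkp]; exact Ideal.pow_le_pow_right (Nat.le_succ N)
    · intro x hx
      have hx0 : AdicCompletion.evalₐ I (N + 1) x = 0 := by
        obtain ⟨y, hy⟩ := Ideal.Quotient.mk_surjective (AdicCompletion.evalₐ I (N + 1) x)
        rw [← hy]
        rw [Ideal.Quotient.eq_zero_iff_mem, ← hkq', RingHom.mem_ker]
        have : q' (AdicCompletion.evalₐ I (N + 1) x) = 0 := hx
        rw [← hy] at this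
        exact this
      have hx1 := mem_of_evalA_eq_zero hfg hx0
      have hx3 : x ∈ (I ^ N).map (algebraMap B (AdicCompletion I B)) :=
        Ideal.map_mono (Ideal.pow_le_pow_right (Nat.le_succ N)) hx1
      rw [← Ideal.map_map, Ideal.map_pow, hI]
      exact hx3
end part9

section part10
theorem cohen_core {Λ Λ' T : Type u} [CommRing Λ] [CommRing Λ'] [CommRing T] [IsNoetherianRing Λ]
    [IsLocalRing T] [IsAdicComplete (maximalIdeal T) T]
    {μ : Ideal Λ} [hμ : μ.IsMaximal] {i : Λ →+* Λ'} (hi : i.Flat) [hμ' : (μ.map i).IsMaximal]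
    {g : Λ' →+* T} (hg : μ.map (g.comp i) = maximalIdeal T)
    (halg : ∀ x : ResidueField T, ∃ P : Polynomial Λ',
      P.map (Ideal.Quotient.mk (μ.map i)) ≠ 0 ∧ P.eval₂ ((residue T).comp g) x = 0) :
    ∃ (S2 : Type u) (_ : CommRing S2) (_ : IsNoetherianRing S2) (_ : IsLocalRing S2)
      (j : Λ' →+* S2) (π : S2 →+* T), IsAdicComplete (maximalIdeal S2) S2 ∧
      (j.comp i).Flat ∧ μ.map (j.comp i) = maximalIdeal S2 ∧ Function.Surjective π ∧
      π.comp j = g := by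
  classical
  letI : Field (Λ' ⧸ μ.map i) := Ideal.Quotient.field _
  have hgk : ∀ a ∈ μ.map i, ((residue T).comp g) a = 0 := by
    intro a ha
    have : g a ∈ maximalIdeal T := by
      rw [← hg, ← Ideal.map_map]; exact Ideal.mem_map_of_mem g ha
    rw [RingHom.comp_apply, residue_eq_zero_iff]; exact this
  let s : (Λ' ⧸ μ.map i) →+* ResidueField T := Ideal.Quotient.lift _ ((residue T).comp g) hgk
  letI : Algebra (Λ' ⧸ μ.map i) (ResidueField T) := s.toAlgebra
  have hs : s.comp (Ideal.Quotient.mk (μ.map i)) = (residue T).comp g := Ideal.Quotient.lift_comp_mk _ _ _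
  haveI : Algebra.IsAlgebraic (Λ' ⧸ μ.map i) (ResidueField T) := ⟨fun x => by
    obtain ⟨P, hP, hP0⟩ := halg x
    refine ⟨_, hP, ?_⟩
    rw [Polynomial.aeval_def, Polynomial.eval₂_map]
    change P.eval₂ (s.comp (Ideal.Quotient.mk (μ.map i))) x = 0
    rw [hs, hP0]⟩
  obtain ⟨inst, hwf⟩ := exists_wellFoundedLT T
  obtain ⟨F, hF, hreg⟩ := field_rel (κ := Λ' ⧸ μ.map i) (L := ResidueField T) (ι := T) (residue T)
  let ev : MvPolynomial T Λ' →+* T := MvPolynomial.eval₂Hom g id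
  have hevC : ev.comp MvPolynomial.C = g := MvPolynomial.eval₂Hom_comp_C _ _
  have hev : Function.Surjective ev := fun t => ⟨MvPolynomial.X t, by simp [ev]⟩
  let φ : MvPolynomial T Λ' →+* MvPolynomial T (Λ' ⧸ μ.map i) :=
    MvPolynomial.map (Ideal.Quotient.mk (μ.map i))
  have hφ : Function.Surjective φ := MvPolynomial.map_surjective _ Ideal.Quotient.mk_surjective
  let f : Λ →+* MvPolynomial T Λ' := MvPolynomial.C.comp i
  have hkφ : RingHom.ker φ = μ.map f := by
    rw [MvPolynomial.ker_map, Ideal.mk_ker, ← Ideal.map_map]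
  have hμev : (μ.map f).map ev = maximalIdeal T := by
    rw [Ideal.map_map, ← RingHom.comp_assoc, hevC, hg]
  let av : MvPolynomial T (Λ' ⧸ μ.map i) →+* ResidueField T :=
    (MvPolynomial.aeval (R := Λ' ⧸ μ.map i) (residue T)).toRingHom
  have hav : av.comp φ = (residue T).comp ev := by
    apply MvPolynomial.ringHom_ext
    · intro r
      have h1 : φ (MvPolynomial.C r) = MvPolynomial.C (Ideal.Quotient.mk _ r) := MvPolynomial.map_C _ _
      have h2 : ev (MvPolynomial.C r) = g r := RingHom.congr_fun hevC r
      have h3 : av (MvPolynomial.C (Ideal.Quotient.mk _ r)) = s (Ideal.Quotient.mk _ r) :=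
        MvPolynomial.aeval_C _ _
      rw [RingHom.comp_apply, RingHom.comp_apply, h1, h2, h3]
      exact RingHom.congr_fun hs r
    · intro t
      have h1 : φ (MvPolynomial.X t) = MvPolynomial.X t := MvPolynomial.map_X _ _
      have h2 : ev (MvPolynomial.X t) = t := by simp [ev]
      have h3 : av (MvPolynomial.X t) = residue T t := MvPolynomial.aeval_X _ _
      rw [RingHom.comp_apply, RingHom.comp_apply, h1, h2, h3]
  have hkav : RingHom.ker av = Ideal.span (Set.range F) := hF
  have hlift : ∀ t : T, ∃ E : MvPolynomial T Λ', φ E = F t ∧ ev E = 0 := by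
    intro t
    obtain ⟨E0, hE0⟩ := hφ (F t)
    have h1 : ev E0 ∈ maximalIdeal T := by
      rw [← residue_eq_zero_iff, ← RingHom.comp_apply, ← hav, RingHom.comp_apply, hE0,
        ← RingHom.mem_ker, hkav]
      exact Ideal.subset_span ⟨t, rfl⟩
    rw [← hμev, Ideal.mem_map_iff_of_surjective _ hev] at h1
    obtain ⟨c, hc, hc2⟩ := h1
    rw [← hkφ, RingHom.mem_ker] at hc
    exact ⟨E0 - c, by rw [map_sub, hc, sub_zero, hE0], by rw [map_sub, hc2, sub_self]⟩
  choose E hE1 hE2 using hlift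
  have hf : f.Flat := by
    have : (MvPolynomial.C : Λ' →+* MvPolynomial T Λ').Flat := by
      have : Module.Flat Λ' (MvPolynomial T Λ') := inferInstance
      exact (RingHom.flat_algebraMap_iff).mpr this
    exact RingHom.Flat.comp hi this
  have hEim : ∀ D : Set T, (Ideal.span (E '' D)).map φ = Ideal.span (F '' D) := by
    intro D
    rw [Ideal.map_span, Set.image_image]
    simp_rw [hE1]
  have hmem : ∀ (D : Set T) (b), b ∈ μ.map f ⊔ Ideal.span (E '' D) ↔ φ b ∈ Ideal.span (F '' D) := by
    intro D b
    rw [← hEim, ← Ideal.mem_comap, Ideal.comap_map_of_surjective' φ hφ, hkφ, sup_comm]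
  have hE : ∀ (t : T) (D : Set T), (∀ s ∈ D, s < t) → ∀ b, E t * b ∈ μ.map f ⊔ Ideal.span (E '' D) →
        b ∈ μ.map f ⊔ Ideal.span (E '' D) := by
    intro t D hD b hb
    rw [hmem] at hb ⊢
    rw [map_mul, hE1] at hb
    exact hreg t D hD _ hb
  let mkE := Ideal.Quotient.mk (Ideal.span (Set.range E))
  let IB : Ideal (MvPolynomial T Λ' ⧸ Ideal.span (Set.range E)) := μ.map (mkE.comp f)
  have hevE : ∀ a ∈ Ideal.span (Set.range E), ev a = 0 := by
    have : Ideal.span (Set.range E) ≤ RingHom.ker ev := by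
      rw [Ideal.span_le]; rintro _ ⟨t, rfl⟩; exact hE2 t
    exact fun a ha => this ha
  let evB : (MvPolynomial T Λ' ⧸ Ideal.span (Set.range E)) →+* T := Ideal.Quotient.lift _ ev hevE
  have hevB : evB.comp mkE = ev := Ideal.Quotient.lift_comp_mk _ _ _
  have hevBs : Function.Surjective evB := Ideal.Quotient.lift_surjective_of_surjective _ _ hev
  have hIBT : IB.map evB = maximalIdeal T := by
    rw [← hμev, Ideal.map_map, Ideal.map_map, ← RingHom.comp_assoc, hevB]
  have hIBk : IB = RingHom.ker ((residue T).comp evB) := by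
    apply le_antisymm
    · intro x hx
      rw [RingHom.mem_ker, RingHom.comp_apply, residue_eq_zero_iff, ← hIBT]
      exact Ideal.mem_map_of_mem _ hx
    · intro x hx
      obtain ⟨y, rfl⟩ := Ideal.Quotient.mk_surjective x
      have h1 : φ y ∈ Ideal.span (F '' Set.univ) := by
        rw [Set.image_univ, ← hkav, RingHom.mem_ker, ← RingHom.comp_apply, hav, RingHom.comp_apply, ← hevB]
        exact hx
      rw [← hmem, Set.image_univ] at h1
      have h2 := Ideal.mem_map_of_mem mkE h1
      have h3 : (Ideal.span (Set.range E)).map mkE = ⊥ := Ideal.map_quotient_self _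
      rw [Ideal.map_sup, h3, sup_bot_eq, Ideal.map_map] at h2
      exact h2
  haveI hIBm : IB.IsMaximal := by
    rw [hIBk]
    exact RingHom.ker_isMaximal_of_surjective _ (residue_surjective.comp hevBs)
  have hfg : IB.FG := Ideal.FG.map (IsNoetherian.noetherian μ) _
  obtain ⟨h1, h2, h3, h4⟩ := completion_package IB hfg
  obtain ⟨π, hπ⟩ := ext_completion IB (maximalIdeal T) evB hIBT.le
  refine ⟨AdicCompletion IB _, inferInstance, h1, h2, (algebraMap _ _).comp (mkE.comp MvPolynomial.C), π, h3, ?_, ?_, ?_, ?_⟩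
  · exact flat_completion (f := mkE.comp f) rfl hfg (fun N => core_flat hf hE N)
  · rw [h4, Ideal.map_map]; rfl
  · intro t
    obtain ⟨b, hb⟩ := hevBs t
    exact ⟨algebraMap _ _ b, by rw [← hb, ← hπ]; rfl⟩
  · rw [← RingHom.comp_assoc, hπ, ← RingHom.comp_assoc, hevB, hevC]
end part10

section part11
theorem cohen_mid {Λ T : Type u} [CommRing Λ] [CommRing T] [IsNoetherianRing Λ]
    [IsLocalRing T] [IsAdicComplete (maximalIdeal T) T]
    {μ : Ideal Λ} [hμ : μ.IsMaximal] {g : Λ →+* T} (hg : μ.map g = maximalIdeal T) :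
    ∃ (S2 : Type u) (_ : CommRing S2) (_ : IsNoetherianRing S2) (_ : IsLocalRing S2)
      (j : Λ →+* S2) (π : S2 →+* T), IsAdicComplete (maximalIdeal S2) S2 ∧
      j.Flat ∧ μ.map j = maximalIdeal S2 ∧ Function.Surjective π ∧ π.comp j = g := by
  classical
  letI : Field (Λ ⧸ μ) := Ideal.Quotient.field _
  have hgk : ∀ a ∈ μ, ((residue T).comp g) a = 0 := by
    intro a ha
    rw [RingHom.comp_apply, residue_eq_zero_iff, ← hg]; exact Ideal.mem_map_of_mem g ha
  let s : (Λ ⧸ μ) →+* ResidueField T := Ideal.Quotient.lift _ ((residue T).comp g) hgk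
  letI : Algebra (Λ ⧸ μ) (ResidueField T) := s.toAlgebra
  have hs : s.comp (Ideal.Quotient.mk μ) = (residue T).comp g := Ideal.Quotient.lift_comp_mk _ _ _
  obtain ⟨b, bv, hb⟩ := exists_isTranscendenceBasis' (Λ ⧸ μ) (ResidueField T)
  let lf : b → T := fun t => Function.surjInv (residue_surjective (R := T)) (bv t)
  have hlf : ∀ t, residue T (lf t) = bv t := fun t => Function.surjInv_eq residue_surjective _
  let g1 : MvPolynomial b Λ →+* T := MvPolynomial.eval₂Hom g lf
  have hg1C : g1.comp MvPolynomial.C = g := MvPolynomial.eval₂Hom_comp_C _ _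
  let φ : MvPolynomial b Λ →+* MvPolynomial b (Λ ⧸ μ) := MvPolynomial.map (Ideal.Quotient.mk μ)
  have hφ : Function.Surjective φ := MvPolynomial.map_surjective _ Ideal.Quotient.mk_surjective
  have hkφ : RingHom.ker φ = μ.map MvPolynomial.C := by
    rw [MvPolynomial.ker_map, Ideal.mk_ker]
  let av : MvPolynomial b (Λ ⧸ μ) →+* ResidueField T :=
    (MvPolynomial.aeval (R := Λ ⧸ μ) bv).toRingHom
  have hav : av.comp φ = (residue T).comp g1 := by
    apply MvPolynomial.ringHom_ext
    · intro r
      have h1 : φ (MvPolynomial.C r) = MvPolynomial.C (Ideal.Quotient.mk _ r) := MvPolynomial.map_C _ _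
      have h2 : g1 (MvPolynomial.C r) = g r := RingHom.congr_fun hg1C r
      have h3 : av (MvPolynomial.C (Ideal.Quotient.mk _ r)) = s (Ideal.Quotient.mk _ r) :=
        MvPolynomial.aeval_C _ _
      rw [RingHom.comp_apply, RingHom.comp_apply, h1, h2, h3]
      exact RingHom.congr_fun hs r
    · intro t
      have h1 : φ (MvPolynomial.X t) = MvPolynomial.X t := MvPolynomial.map_X _ _
      have h2 : g1 (MvPolynomial.X t) = lf t := by simp [g1]
      have h3 : av (MvPolynomial.X t) = bv t := MvPolynomial.aeval_X _ _
      rw [RingHom.comp_apply, RingHom.comp_apply, h1, h2, h3, hlf]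
  have hinj : Function.Injective av := hb.1
  let 𝔓 : Ideal (MvPolynomial b Λ) := RingHom.ker ((residue T).comp g1)
  have h𝔓 : 𝔓 = μ.map MvPolynomial.C := by
    rw [← hkφ]
    ext x
    change ((residue T).comp g1) x = 0 ↔ φ x = 0
    rw [← hav, RingHom.comp_apply]
    exact ⟨fun h => hinj (by rw [h, map_zero]), fun h => by rw [h, map_zero]⟩
  haveI h𝔓p : 𝔓.IsPrime := RingHom.ker_isPrime _
  let Λ' := Localization.AtPrime 𝔓
  let i : Λ →+* Λ' := (algebraMap (MvPolynomial b Λ) Λ').comp MvPolynomial.C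
  have hi : i.Flat := by
    refine RingHom.Flat.comp ?_ ?_
    · have : Module.Flat Λ (MvPolynomial b Λ) := inferInstance
      exact (RingHom.flat_algebraMap_iff).mpr this
    · have : Module.Flat (MvPolynomial b Λ) Λ' := IsLocalization.flat Λ' 𝔓.primeCompl
      exact (RingHom.flat_algebraMap_iff).mpr this
  have hμi : μ.map i = maximalIdeal Λ' := by
    rw [← Ideal.map_map, ← h𝔓, Localization.AtPrime.map_eq_maximalIdeal]
  haveI : (μ.map i).IsMaximal := by rw [hμi]; infer_instance
  have hu : ∀ y : 𝔓.primeCompl, IsUnit (g1 y) := by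
    intro y
    by_contra hy
    apply y.2
    change ((residue T).comp g1) y = 0
    rw [RingHom.comp_apply, residue_eq_zero_iff]
    exact (mem_maximalIdeal _).mpr hy
  let g2 : Λ' →+* T := IsLocalization.lift hu
  have hg2 : g2.comp (algebraMap _ Λ') = g1 := IsLocalization.lift_comp hu
  have hg2i : g2.comp i = g := by
    change g2.comp ((algebraMap (MvPolynomial b Λ) Λ').comp MvPolynomial.C) = g
    rw [← RingHom.comp_assoc, hg2, hg1C]
  have halg : ∀ x : ResidueField T, ∃ P : Polynomial Λ',
      P.map (Ideal.Quotient.mk (μ.map i)) ≠ 0 ∧ P.eval₂ ((residue T).comp g2) x = 0 := by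
    intro x
    obtain ⟨p, hp, hpx⟩ := hb.isAlgebraic.isAlgebraic x
    let e := hb.1.aevalEquiv
    let es : Algebra.adjoin (Λ ⧸ μ) (Set.range bv) →+* MvPolynomial b (Λ ⧸ μ) := e.symm.toAlgHom.toRingHom
    have hes : av.comp es = algebraMap _ _ := by
      ext y
      obtain ⟨z, rfl⟩ := e.surjective y
      change av (e.symm (e z)) = _
      rw [e.symm_apply_apply]
      exact (hb.1.algebraMap_aevalEquiv z).symm
    let p1 : Polynomial (MvPolynomial b (Λ ⧸ μ)) := p.map es
    obtain ⟨P0, hP0⟩ := Polynomial.map_surjective φ hφ p1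
    refine ⟨P0.map (algebraMap _ Λ'), ?_, ?_⟩
    · intro h0
      apply hp
      have h1 : p1 = 0 := by
        rw [← hP0]
        ext1 n
        have h2 := congrArg (fun q => Polynomial.coeff q n) h0
        simp only [Polynomial.coeff_map, Polynomial.coeff_zero, Ideal.Quotient.eq_zero_iff_mem, hμi] at h2 ⊢
        rw [IsLocalization.AtPrime.to_map_mem_maximal_iff Λ' 𝔓, h𝔓, ← hkφ] at h2
        exact h2
      exact Polynomial.map_injective es e.symm.injective (h1.trans (Polynomial.map_zero es).symm)
    · rw [Polynomial.eval₂_map, RingHom.comp_assoc, hg2, ← hav, ← Polynomial.eval₂_map, hP0,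
        Polynomial.eval₂_map, hes]
      exact hpx
  obtain ⟨S2, c, n, l, j, π, h1, h2, h3, h4, h5⟩ :=
    cohen_core (μ := μ) (i := i) hi (g := g2) (by rw [hg2i, hg]) halg
  exact ⟨S2, c, n, l, j.comp i, π, h1, h2, h3, h4, by rw [← RingHom.comp_assoc, h5, hg2i]⟩

theorem GRSn_X {A : Type u} [CommRing A] [Nontrivial A] : ∀ r : ℕ,
    GRSn r (MvPolynomial (Fin r) A) (Ideal.span (Set.range MvPolynomial.X))
  | 0 => ⟨by simp, inferInstance⟩
  | r+1 => by
    have ih := GRSn_X (A := A) r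
    let e : MvPolynomial (Fin (r+1)) A ≃+* Polynomial (MvPolynomial (Fin r) A) :=
      (MvPolynomial.finSuccEquiv A r).toRingEquiv
    have key : GRSn (r+1) (Polynomial (MvPolynomial (Fin r) A))
        ((Ideal.span (Set.range MvPolynomial.X)).map
          (e : MvPolynomial (Fin (r+1)) A →+* Polynomial (MvPolynomial (Fin r) A))) := by
      have hmap : (Ideal.span (Set.range (MvPolynomial.X (R := A) (σ := Fin (r+1))))).map
          (e : MvPolynomial (Fin (r+1)) A →+* Polynomial (MvPolynomial (Fin r) A)) =
          Ideal.span {Polynomial.X} ⊔ Ideal.span (Set.range fun i => Polynomial.C (MvPolynomial.X i)) := by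
        rw [Ideal.map_span, ← Ideal.span_union, ← Set.range_comp, Fin.range_fin_succ]
        congr 1
        have e0 : e (MvPolynomial.X 0) = Polynomial.X :=
          MvPolynomial.finSuccEquiv_X_zero
        have e1 : ∀ i : Fin r, e (MvPolynomial.X i.succ) =
          Polynomial.C (MvPolynomial.X i) := fun i => MvPolynomial.finSuccEquiv_X_succ
        ext x
        simp [Fin.tail, e0, e1]
      have hsurj : Function.Surjective
          (Polynomial.constantCoeff (R := MvPolynomial (Fin r) A)) :=
        Polynomial.constantCoeff_surjective
      refine GRSn.cons (r := Polynomial.X) hsurj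
        (Polynomial.ker_constantCoeff) ?_ ?_ ?_
      · exact isSMulRegular_iff_mul.mpr fun b hb => by simpa using hb
      · rw [hmap]; exact Ideal.mem_sup_left (Ideal.mem_span_singleton_self _)
      · rw [hmap, Ideal.map_sup, Ideal.map_span, Ideal.map_span, ← Set.range_comp]
        convert ih
        simp only [Set.image_singleton, Polynomial.constantCoeff_apply, Polynomial.coeff_X_zero,
          Ideal.span_singleton_zero, bot_sup_eq]
        congr 2
        ext i
        simp
    have := key.equiv e.symm
    rw [Ideal.map_map] at this
    convert this
    rw [RingEquiv.symm_comp, Ideal.map_id]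

theorem cohen_exists {S T : Type u} [CommRing S] [CommRing T] [IsNoetherianRing S] [IsLocalRing S]
    [IsNoetherianRing T] [IsLocalRing T] [IsAdicComplete (maximalIdeal T) T]
    (h : S →+* T) [IsLocalHom h] :
    ∃ (S2 : Type u) (_ : CommRing S2) (_ : IsNoetherianRing S2) (_ : IsLocalRing S2)
      (f : S →+* S2) (π : S2 →+* T) (n : ℕ), IsAdicComplete (maximalIdeal S2) S2 ∧
      IsLocalHom f ∧ WRn n f ∧ Function.Surjective π ∧ π.comp f = h := by
  obtain ⟨r, y, hy⟩ := Submodule.fg_iff_exists_fin_generating_family.mp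
    (IsNoetherian.noetherian (maximalIdeal T))
  change Ideal.span (Set.range y) = maximalIdeal T at hy
  let g : MvPolynomial (Fin r) S →+* T := MvPolynomial.eval₂Hom h y
  have hgC : g.comp MvPolynomial.C = h := MvPolynomial.eval₂Hom_comp_C _ _
  have hgX : ∀ i, g (MvPolynomial.X i) = y i := fun i => by simp [g]
  let cc : MvPolynomial (Fin r) S →+* ResidueField S := (residue S).comp MvPolynomial.constantCoeff
  have hcc : Function.Surjective cc := residue_surjective.comp (fun s => ⟨MvPolynomial.C s, by simp⟩)
  let μ : Ideal (MvPolynomial (Fin r) S) := RingHom.ker cc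
  have hres : (residue T).comp g = (ResidueField.map h).comp cc := by
    apply MvPolynomial.ringHom_ext
    · intro s
      have : g (MvPolynomial.C s) = h s := RingHom.congr_fun hgC s
      rw [RingHom.comp_apply, this]
      simp [cc]
    · intro i
      rw [RingHom.comp_apply, hgX]
      have : residue T (y i) = 0 := by
        rw [residue_eq_zero_iff, ← hy]; exact Ideal.subset_span ⟨i, rfl⟩
      rw [this]
      simp [cc]
  have hμX : ∀ i, MvPolynomial.X i ∈ μ := fun i => by
    change cc _ = 0
    simp [cc]
  have hμ : μ = (maximalIdeal S).map MvPolynomial.C ⊔ Ideal.span (Set.range MvPolynomial.X) := by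
    apply le_antisymm
    · intro p hp
      have h1 : MvPolynomial.constantCoeff p ∈ maximalIdeal S := by
        rw [← residue_eq_zero_iff]; exact hp
      have h2 : p - MvPolynomial.C (MvPolynomial.constantCoeff p) ∈
          Ideal.span (Set.range (MvPolynomial.X (R := S) (σ := Fin r))) := by
        clear hp h1
        induction p using MvPolynomial.induction_on with
        | C a => simp
        | add p q hp hq =>
          rw [map_add, map_add, add_sub_add_comm]
          exact Ideal.add_mem _ hp hq
        | mul_X p i hp =>
          simp only [map_mul, MvPolynomial.constantCoeff_X, mul_zero, map_zero, sub_zero]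
          exact Ideal.mul_mem_left _ _ (Ideal.subset_span ⟨i, rfl⟩)
      have := Ideal.add_mem _ (Ideal.mem_sup_left
        (Ideal.mem_map_of_mem (MvPolynomial.C (σ := Fin r)) h1)) (Ideal.mem_sup_right h2)
      simpa using this
    · refine sup_le ?_ (Ideal.span_le.mpr ?_)
      · rw [Ideal.map_le_iff_le_comap]
        intro s hs
        change cc _ = 0
        simpa [cc] using hs
      · rintro _ ⟨i, rfl⟩; exact hμX i
  haveI : μ.IsMaximal := RingHom.ker_isMaximal_of_surjective _ hcc
  have hg : μ.map g = maximalIdeal T := by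
    apply le_antisymm
    · rw [Ideal.map_le_iff_le_comap]
      intro p hp
      rw [Ideal.mem_comap, ← residue_eq_zero_iff, ← RingHom.comp_apply, hres, RingHom.comp_apply]
      have : cc p = 0 := hp
      rw [this, map_zero]
    · rw [← hy, Ideal.span_le]
      rintro _ ⟨i, rfl⟩
      rw [← hgX]; exact Ideal.mem_map_of_mem g (hμX i)
  obtain ⟨S2, c, n, l, j, π, h1, h2, h3, h4, h5⟩ := cohen_mid hg
  have hπf : π.comp (j.comp MvPolynomial.C) = h := by rw [← RingHom.comp_assoc, h5, hgC]
  have hloc : IsLocalHom (j.comp MvPolynomial.C) := by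
    have : IsLocalHom (π.comp (j.comp MvPolynomial.C)) := by rw [hπf]; infer_instance
    exact isLocalHom_of_comp _ π
  refine ⟨S2, c, n, l, j.comp MvPolynomial.C, π, r, h1, hloc, ?_, h4, hπf⟩
  have hC : (MvPolynomial.C : S →+* MvPolynomial (Fin r) S).Flat := by
    have : Module.Flat S (MvPolynomial (Fin r) S) := inferInstance
    exact (RingHom.flat_algebraMap_iff).mpr this
  let I2 := (maximalIdeal S).map (j.comp MvPolynomial.C)
  let p : MvPolynomial (Fin r) S →+* MvPolynomial (Fin r) (ResidueField S) := MvPolynomial.map (residue S)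
  have hp : Function.Surjective p := MvPolynomial.map_surjective _ residue_surjective
  have hkp : RingHom.ker p = (maximalIdeal S).map MvPolynomial.C := by
    rw [MvPolynomial.ker_map, ker_residue]
  let q := Ideal.Quotient.mk I2
  have hkq : RingHom.ker q = (RingHom.ker p).map j := by
    rw [Ideal.mk_ker, hkp, Ideal.map_map]
  let f1 : MvPolynomial (Fin r) (ResidueField S) →+* S2 ⧸ I2 := RingHom.liftOfSurjective p hp
    ⟨q.comp j, by
      rw [← RingHom.comap_ker, hkq]; exact Ideal.le_comap_map⟩
  have hf1 : f1.comp p = q.comp j := RingHom.liftOfRightInverse_comp _ _ _ _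
  have hff : f1.Flat := flat_square h2 hp Ideal.Quotient.mk_surjective hf1 hkq
  refine ⟨RingHom.Flat.comp hC h2, ?_⟩
  have hm : (maximalIdeal S2).map q = (Ideal.span (Set.range MvPolynomial.X)).map f1 := by
    have e : (Ideal.span (Set.range MvPolynomial.X)).map p =
        Ideal.span (Set.range (MvPolynomial.X (σ := Fin r) (R := ResidueField S))) := by
      rw [Ideal.map_span, ← Set.range_comp]
      congr 2
      ext1 i
      exact MvPolynomial.map_X _ _
    have h0 : (((maximalIdeal S).map MvPolynomial.C).map j).map q = ⊥ := by
      have e2 : ((maximalIdeal S).map MvPolynomial.C).map j = I2 := Ideal.map_map _ _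
      rw [e2]; exact Ideal.map_quotient_self I2
    rw [← h3, hμ, Ideal.map_sup, Ideal.map_sup, h0, bot_sup_eq,
      ← e, Ideal.map_map, Ideal.map_map, hf1]
  change GRSn r (S2 ⧸ I2) ((maximalIdeal S2).map q)
  rw [hm]
  refine (GRSn_X r).flat hff ?_
  rw [← hm]
  have : I2 ≠ ⊤ := flat_local_map_ne_top (maximalIdeal.isMaximal S).ne_top
  haveI := isLocalRing_quot this
  rw [maximalIdeal_quot_span]
  exact (maximalIdeal.isMaximal _).ne_top
end part11

section part12
theorem noeth_module_of_surj {D A : Type u} [CommRing D] [CommRing A] [Algebra D A]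
    [IsNoetherianRing A] (h : Function.Surjective (algebraMap D A)) : IsNoetherian D A := by
  refine ⟨fun N => ?_⟩
  let N' : Ideal A := { N with
    smul_mem' := fun c x hx => by
      obtain ⟨d, rfl⟩ := h c
      rw [smul_eq_mul, ← Algebra.smul_def]
      exact N.smul_mem d hx }
  obtain ⟨s, hs⟩ := (IsNoetherian.noetherian N' : N'.FG)
  refine ⟨s, ?_⟩
  have := Submodule.restrictScalars_span D A h (s : Set A)
  rw [← this, hs]
  rfl

theorem noeth_of_two {D A1 A2 : Type u} [CommRing D] [CommRing A1] [CommRing A2]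
    [IsNoetherianRing A1] [IsNoetherianRing A2] {q1 : D →+* A1} {q2 : D →+* A2}
    (h1 : Function.Surjective q1) (h2 : Function.Surjective q2)
    (hi : ∀ d, q1 d = 0 → q2 d = 0 → d = 0) : IsNoetherianRing D := by
  letI := q1.toAlgebra
  letI := q2.toAlgebra
  haveI : IsNoetherian D A1 := noeth_module_of_surj h1
  haveI : IsNoetherian D A2 := noeth_module_of_surj h2
  let L : D →ₗ[D] A1 × A2 := (Algebra.linearMap D A1).prod (Algebra.linearMap D A2)
  refine isNoetherian_of_injective L ?_
  rw [← LinearMap.ker_eq_bot, LinearMap.ker_eq_bot']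
  intro d hd
  exact hi d (congrArg Prod.fst hd) (congrArg Prod.snd hd)

theorem completion_ext {B C : Type u} [CommRing B] [CommRing C] [IsLocalRing C] [IsNoetherianRing C]
    {I : Ideal B} (hI : I.FG) {g g' : AdicCompletion I B →+* C}
    (h : g.comp (algebraMap B (AdicCompletion I B)) = g'.comp (algebraMap B (AdicCompletion I B)))
    (hm : I.map (g.comp (algebraMap B (AdicCompletion I B))) ≤ maximalIdeal C) : g = g' := by
  ext x
  rw [← sub_eq_zero, ← Ideal.mem_bot]
  apply krull_mem
  intro n
  refine Ideal.mem_sup_right ?_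
  obtain ⟨b, hb⟩ := Ideal.Quotient.mk_surjective (AdicCompletion.evalₐ I n x)
  have h1 : x - algebraMap B (AdicCompletion I B) b ∈ (I ^ n).map (algebraMap B (AdicCompletion I B)) := by
    apply mem_of_evalA_eq_zero hI
    rw [map_sub, sub_eq_zero, ← hb]
    exact (AlgHom.commutes (AdicCompletion.evalₐ I n) b).symm
  have h2 : ∀ k : AdicCompletion I B →+* C,
      I.map (k.comp (algebraMap B (AdicCompletion I B))) ≤ maximalIdeal C →
      k (x - algebraMap B (AdicCompletion I B) b) ∈ maximalIdeal C ^ n := by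
    intro k hk
    have := Ideal.mem_map_of_mem k h1
    rw [Ideal.map_map, Ideal.map_pow] at this
    exact Ideal.pow_right_mono hk n this
  have h3 := Ideal.sub_mem _ (h2 g hm) (h2 g' (by rw [← h]; exact hm))
  have h4 : g (algebraMap B (AdicCompletion I B) b) = g' (algebraMap B (AdicCompletion I B) b) :=
    RingHom.congr_fun h b
  rw [map_sub, map_sub, h4, sub_sub_sub_cancel_right] at h3
  exact h3

theorem E_rel {l n1 n2 : ℕ} {R A1 A2 C : Type u} [CommRing R] [CommRing A1] [CommRing A2] [CommRing C]
    [IsLocalRing R] [IsNoetherianRing R] [IsLocalRing A1] [IsNoetherianRing A1] [IsLocalRing A2]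
    [IsNoetherianRing A2] [IsAdicComplete (maximalIdeal A1) A1] [IsAdicComplete (maximalIdeal A2) A2]
    {f1 : R →+* A1} {f2 : R →+* A2} [IsLocalHom f1] [IsLocalHom f2] (hf1 : WRn n1 f1) (hf2 : WRn n2 f2)
    {p1 : A1 →+* C} {p2 : A2 →+* C} (hp1 : Function.Surjective p1) (hp2 : Function.Surjective p2)
    (hc : p1.comp f1 = p2.comp f2) (h : GRSn l A1 (RingHom.ker p1)) :
    ∃ l', GRSn l' A2 (RingHom.ker p2) := by
  have hCn : Nontrivial C := by
    by_contra hC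
    rw [not_nontrivial_iff_subsingleton] at hC
    apply h.ne_top
    rw [Ideal.eq_top_iff_one, RingHom.mem_ker]
    exact Subsingleton.elim _ _
  haveI : IsLocalRing C := IsLocalRing.of_surjective' p1 hp1
  haveI : IsNoetherianRing C := isNoetherianRing_of_surjective _ _ p1 hp1
  haveI : IsLocalHom p1 := IsLocalHom.of_surjective p1 hp1
  haveI : IsLocalHom p2 := IsLocalHom.of_surjective p2 hp2
  let D : Subring (A1 × A2) := RingHom.eqLocus (p1.comp (RingHom.fst A1 A2)) (p2.comp (RingHom.snd A1 A2))
  have hD : ∀ d : D, p1 d.1.1 = p2 d.1.2 := fun d => d.2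
  let q1 : D →+* A1 := (RingHom.fst A1 A2).comp D.subtype
  let q2 : D →+* A2 := (RingHom.snd A1 A2).comp D.subtype
  have hq1 : Function.Surjective q1 := fun a => by
    obtain ⟨b, hb⟩ := hp2 (p1 a)
    exact ⟨⟨(a, b), hb.symm⟩, rfl⟩
  have hq2 : Function.Surjective q2 := fun b => by
    obtain ⟨a, ha⟩ := hp1 (p2 b)
    exact ⟨⟨(a, b), ha⟩, rfl⟩
  have hq : p1.comp q1 = p2.comp q2 := by ext d; exact hD d
  haveI : IsNoetherianRing D := noeth_of_two hq1 hq2 (fun d h1 h2 => Subtype.ext (Prod.ext h1 h2))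
  have hunit : ∀ d : D, IsUnit (q1 d) → IsUnit d := by
    intro d hd
    have h2 : IsUnit (q2 d) := by
      have : IsUnit (p2 (q2 d)) := by
        rw [← RingHom.comp_apply, ← hq]; exact hd.map p1
      exact isUnit_of_map_unit p2 _ this
    obtain ⟨u, hu⟩ := hd.exists_right_inv
    obtain ⟨v, hv⟩ := h2.exists_right_inv
    have huv : p1 u = p2 v := by
      have e1 : p1 (q1 d) * p1 u = 1 := by rw [← map_mul, hu, map_one]
      have e2 : p1 (q1 d) * p2 v = 1 := by
        rw [← RingHom.comp_apply, hq, RingHom.comp_apply, ← map_mul, hv, map_one]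
      calc p1 u = p1 u * (p1 (q1 d) * p2 v) := by rw [e2, mul_one]
        _ = (p1 (q1 d) * p1 u) * p2 v := by ring
        _ = p2 v := by rw [e1, one_mul]
    refine IsUnit.of_mul_eq_one (⟨(u, v), huv⟩ : D) (Subtype.ext (Prod.ext hu hv))
  haveI : IsLocalHom q1 := ⟨hunit⟩
  haveI : Nontrivial D := hq1.nontrivial
  haveI : IsLocalRing D := IsLocalRing.of_nonunits_add (fun a b ha hb hab => by
    have h1 : q1 a ∈ nonunits A1 := fun h => ha (hunit _ h)
    have h2 : q1 b ∈ nonunits A1 := fun h => hb (hunit _ h)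
    exact IsLocalRing.nonunits_add h1 h2 (by rw [← map_add]; exact hab.map q1))
  haveI : IsLocalHom q2 := IsLocalHom.of_surjective q2 hq2
  let r : R →+* D := (f1.prod f2).codRestrict D (fun x => RingHom.congr_fun hc x)
  have hr1 : q1.comp r = f1 := rfl
  have hr2 : q2.comp r = f2 := rfl
  haveI : IsLocalHom r := by
    have : IsLocalHom (q1.comp r) := by rw [hr1]; infer_instance
    exact isLocalHom_of_comp _ q1
  let D' := AdicCompletion (maximalIdeal D) D
  have hfg : (maximalIdeal D).FG := IsNoetherian.noetherian _
  obtain ⟨hN, hL, hA, hM⟩ := completion_package (maximalIdeal D) hfg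
  obtain ⟨g1, hg1⟩ := ext_completion (maximalIdeal D) (maximalIdeal A1) q1 (IsLocalRing.map_maximalIdeal_le q1)
  obtain ⟨g2, hg2⟩ := ext_completion (maximalIdeal D) (maximalIdeal A2) q2 (IsLocalRing.map_maximalIdeal_le q2)
  have hgs1 : Function.Surjective g1 := by
    have : Function.Surjective (g1.comp (algebraMap D _)) := by rw [hg1]; exact hq1
    exact Function.Surjective.of_comp this
  have hgs2 : Function.Surjective g2 := by
    have : Function.Surjective (g2.comp (algebraMap D _)) := by rw [hg2]; exact hq2
    exact Function.Surjective.of_comp this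
  have hgg : p1.comp g1 = p2.comp g2 := by
    apply completion_ext hfg
    · rw [RingHom.comp_assoc, RingHom.comp_assoc, hg1, hg2, hq]
    · rw [RingHom.comp_assoc, hg1]
      exact IsLocalRing.map_maximalIdeal_le (p1.comp q1)
  haveI : IsLocalHom g1 := IsLocalHom.of_surjective g1 hgs1
  haveI : IsLocalHom ((algebraMap D D').comp r) := by
    have : IsLocalHom (g1.comp ((algebraMap D D').comp r)) := by
      rw [← RingHom.comp_assoc, hg1, hr1]; infer_instance
    exact isLocalHom_of_comp _ g1
  obtain ⟨R3, _, _, _, f, π, n, -, hloc, hW, hπ, hπf⟩ := cohen_exists ((algebraMap D D').comp r)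
  have e1 : (g1.comp π).comp f = f1 := by
    rw [RingHom.comp_assoc, hπf, ← RingHom.comp_assoc, hg1, hr1]
  have e2 : (g2.comp π).comp f = f2 := by
    rw [RingHom.comp_assoc, hπf, ← RingHom.comp_assoc, hg2, hr2]
  have s1 : Function.Surjective (g1.comp π) := hgs1.comp hπ
  have s2 : Function.Surjective (g2.comp π) := hgs2.comp hπ
  obtain ⟨k, hk⟩ := WRn.ker_GRS s1 hW (by rw [e1]; exact hf1)
  have h5 := GRSn.concat s1 hk h
  have h6 : (RingHom.ker p1).comap (g1.comp π) = (RingHom.ker p2).comap (g2.comp π) := by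
    rw [RingHom.comap_ker, RingHom.comap_ker, ← RingHom.comp_assoc, ← RingHom.comp_assoc, hgg]
  rw [h6] at h5
  obtain ⟨l', h7⟩ := WRn.map_GRS s2 hW (by rw [e2]; exact hf2)
    (Ideal.ker_le_comap _) h5
  rw [Ideal.map_comap_of_surjective _ s2] at h7
  exact ⟨l', h7⟩
end part12

section part13
structure Unr {B C : Type u} [CommRing B] [CommRing C] [IsLocalRing B] [IsLocalRing C]
    (c : B →+* C) : Prop where
  flat : c.Flat
  loc : IsLocalHom c
  map_eq : (maximalIdeal B).map c = maximalIdeal C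
  res : ∀ x, ∃ y, x - c y ∈ maximalIdeal C

theorem Unr.id {B : Type u} [CommRing B] [IsLocalRing B] : Unr (RingHom.id B) :=
  ⟨RingHom.Flat.id B, ⟨fun _ h => h⟩, Ideal.map_id _, fun x => ⟨x, by simp⟩⟩

theorem Unr.comp {B C D : Type u} [CommRing B] [CommRing C] [CommRing D] [IsLocalRing B]
    [IsLocalRing C] [IsLocalRing D] {c : B →+* C} {d : C →+* D} (hc : Unr c) (hd : Unr d) :
    Unr (d.comp c) := by
  have := hc.loc
  have := hd.loc
  refine ⟨hc.flat.comp hd.flat, inferInstance, ?_, fun x => ?_⟩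
  · rw [← Ideal.map_map, hc.map_eq, hd.map_eq]
  · obtain ⟨y, hy⟩ := hd.res x
    obtain ⟨z, hz⟩ := hc.res y
    refine ⟨z, ?_⟩
    have : x - (d.comp c) z = (x - d y) + d (y - c z) := by simp
    rw [this]
    refine Ideal.add_mem _ hy ?_
    rw [← hd.map_eq]
    exact Ideal.mem_map_of_mem d hz

theorem Unr.quot {B C B1 C1 : Type u} [CommRing B] [CommRing C] [CommRing B1] [CommRing C1]
    [IsLocalRing B] [IsLocalRing C] [IsLocalRing B1] [IsLocalRing C1] {c : B →+* C} (hc : Unr c)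
    {p : B →+* B1} {q : C →+* C1} {c1 : B1 →+* C1}
    (hp : Function.Surjective p) (hq : Function.Surjective q)
    (h : c1.comp p = q.comp c) (hk : RingHom.ker q = (RingHom.ker p).map c) : Unr c1 := by
  have := IsLocalHom.of_surjective p hp
  have := IsLocalHom.of_surjective q hq
  have := hc.loc
  have hm1 := map_maximalIdeal_of_surjective p hp
  have hm2 := map_maximalIdeal_of_surjective q hq
  have hm : (maximalIdeal B1).map c1 = maximalIdeal C1 := by
    rw [← hm1, Ideal.map_map, h, ← Ideal.map_map, hc.map_eq, hm2]
  refine ⟨flat_square hc.flat hp hq h hk, ?_, hm, fun x => ?_⟩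
  · apply ((local_hom_TFAE c1).out 0 2).2
    rw [hm]
  · obtain ⟨x, rfl⟩ := hq x
    obtain ⟨y, hy⟩ := hc.res x
    refine ⟨p y, ?_⟩
    have h2 : c1 (p y) = q (c y) := congrArg (fun g : B →+* C1 => g y) h
    rw [h2, ← map_sub, ← hm2]
    exact Ideal.mem_map_of_mem q hy

theorem Unr.completion {B : Type u} [CommRing B] [IsLocalRing B] [IsNoetherianRing B]
    [IsLocalRing (AdicCompletion (maximalIdeal B) B)] :
    Unr (algebraMap B (AdicCompletion (maximalIdeal B) B)) := by
  have hfg : (maximalIdeal B).FG := IsNoetherian.noetherian _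
  obtain ⟨h1, h2, h3, h4⟩ := completion_package (maximalIdeal B) hfg
  refine ⟨RingHom.flat_algebraMap_iff.mpr inferInstance, ?_, h4.symm, fun x => ?_⟩
  · apply ((local_hom_TFAE _).out 0 2).2
    rw [← h4]
  · obtain ⟨a, ha⟩ := Ideal.Quotient.mk_surjective (AdicCompletion.evalₐ (maximalIdeal B) 1 x)
    refine ⟨a, ?_⟩
    have := mem_of_evalA_eq_zero hfg (n := 1) (x := x - algebraMap _ _ a)
      (by rw [map_sub, ← ha]; simp [AdicCompletion.algebraMap_apply])
    rw [pow_one] at this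
    rw [h4]
    exact this

theorem comp_lemma {A B C : Type u} [CommRing A] [CommRing B] [CommRing C] [IsLocalRing A]
    [IsLocalRing B] [IsLocalRing C] [IsNoetherianRing A] [IsNoetherianRing C]
    [IsAdicComplete (maximalIdeal C) C]
    {p : A →+* B} (hp : Function.Surjective p) {c : B →+* C} (hc : Unr c) :
    ∃ g : AdicCompletion (maximalIdeal A) A →+* C, Function.Surjective g ∧
      g.comp (algebraMap A _) = c.comp p ∧ RingHom.ker g = (RingHom.ker p).map (algebraMap A _) := by
  have hfg : (maximalIdeal A).FG := IsNoetherian.noetherian _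
  obtain ⟨h1, h2, h3, h4⟩ := completion_package (maximalIdeal A) hfg
  have := IsLocalHom.of_surjective p hp
  have := hc.loc
  have hmp := map_maximalIdeal_of_surjective p hp
  have hcp : (maximalIdeal A).map (c.comp p) = maximalIdeal C := by
    rw [← Ideal.map_map, hmp, hc.map_eq]
  obtain ⟨g, hg⟩ := ext_completion (maximalIdeal A) (maximalIdeal C) (c.comp p) hcp.le
  have hg' : ∀ a, g (algebraMap _ _ a) = c (p a) := fun a => congrArg (fun g : A →+* C => g a) hg
  have hmg : (maximalIdeal (AdicCompletion (maximalIdeal A) A)).map g = maximalIdeal C := by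
    rw [h4, Ideal.map_map, hg, hcp]
  refine ⟨g, ?_, hg, le_antisymm ?_ ?_⟩
  · have : IsHausdorff ((maximalIdeal (AdicCompletion (maximalIdeal A) A)).map g) C := by
      rw [hmg]; infer_instance
    refine surjective_of_mk_map_comp_surjective (I := maximalIdeal _) g ?_
    intro y
    obtain ⟨y, rfl⟩ := Ideal.Quotient.mk_surjective y
    obtain ⟨b, hb⟩ := hc.res y
    obtain ⟨a, rfl⟩ := hp b
    refine ⟨algebraMap _ _ a, ?_⟩
    rw [RingHom.comp_apply, hg', eq_comm, Ideal.Quotient.mk_eq_mk_iff_sub_mem, hmg]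
    exact hb
  · intro x hx
    apply krull_mem
    intro n
    obtain ⟨a, ha⟩ := Ideal.Quotient.mk_surjective (AdicCompletion.evalₐ (maximalIdeal A) n x)
    have hxa := mem_of_evalA_eq_zero hfg (n := n) (x := x - algebraMap _ _ a)
      (by rw [map_sub, ← ha]; simp [AdicCompletion.algebraMap_apply])
    have e1 : c (p a) ∈ ((maximalIdeal B) ^ n).map c := by
      have := Ideal.mem_map_of_mem g hxa
      rw [Ideal.map_map, hg, Ideal.map_pow, hcp, map_sub, (RingHom.mem_ker).1 hx, zero_sub, hg',
        neg_mem_iff] at this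
      rw [Ideal.map_pow, hc.map_eq]
      exact this
    have e2 := flat_local_mem hc.flat e1
    rw [← hmp, ← Ideal.map_pow, Ideal.mem_map_iff_of_surjective p hp] at e2
    obtain ⟨b, hb, hba⟩ := e2
    have hk : a - b ∈ RingHom.ker p := by rw [RingHom.mem_ker, map_sub, hba, sub_self]
    have : x = algebraMap _ _ (a - b) + (algebraMap A _ b + (x - algebraMap _ _ a)) := by
      rw [map_sub]; ring
    rw [this]
    refine Submodule.add_mem_sup (Ideal.mem_map_of_mem _ hk) ?_
    rw [h4, ← Ideal.map_pow]
    exact Ideal.add_mem _ (Ideal.mem_map_of_mem _ hb) hxa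
  · rw [Ideal.map_le_iff_le_comap]
    intro a ha
    rw [Ideal.mem_comap, RingHom.mem_ker, hg', (RingHom.mem_ker).1 ha, map_zero]

theorem WRn.unr {n : ℕ} {R A B : Type u} [CommRing R] [CommRing A] [CommRing B] [IsLocalRing R]
    [IsLocalRing A] [IsLocalRing B] {f : R →+* A} [IsLocalHom f] (hf : WRn n f) {c : A →+* B}
    (hc : Unr c) : WRn n (c.comp f) := by
  have := hc.loc
  refine ⟨hf.1.comp hc.flat, ?_⟩
  have hle : (maximalIdeal R).map f ≤ RingHom.ker
      ((Ideal.Quotient.mk ((maximalIdeal R).map (c.comp f))).comp c) := by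
    rw [← RingHom.comap_ker, Ideal.mk_ker, ← Ideal.map_le_iff_le_comap, Ideal.map_map]
  let c1 := Ideal.Quotient.lift ((maximalIdeal R).map f)
    ((Ideal.Quotient.mk ((maximalIdeal R).map (c.comp f))).comp c) hle
  have h1 : c1.comp (Ideal.Quotient.mk _) = (Ideal.Quotient.mk _).comp c :=
    Ideal.Quotient.lift_comp_mk _ _ _
  have hfl : c1.Flat := flat_square hc.flat Ideal.Quotient.mk_surjective Ideal.Quotient.mk_surjective
    h1 (by rw [Ideal.mk_ker, Ideal.mk_ker, Ideal.map_map])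
  have h2 : ((maximalIdeal A).map (Ideal.Quotient.mk ((maximalIdeal R).map f))).map c1 =
      (maximalIdeal B).map (Ideal.Quotient.mk ((maximalIdeal R).map (c.comp f))) := by
    rw [Ideal.map_map, h1, ← hc.map_eq, ← Ideal.map_map c]
  rw [← h2]
  refine hf.2.flat hfl ?_
  rw [h2]
  have ht : (maximalIdeal R).map (c.comp f) ≠ ⊤ :=
    flat_local_map_ne_top (maximalIdeal.isMaximal R).ne_top
  have := isLocalRing_quot ht
  rw [maximalIdeal_quot_span]
  exact (maximalIdeal.isMaximal _).ne_top

theorem E_half {A C0 C : Type u} [CommRing A] [CommRing C0] [CommRing C] [IsLocalRing A]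
    [IsLocalRing C0] [IsLocalRing C] [IsNoetherianRing A] [IsNoetherianRing C0]
    [IsNoetherianRing C] {p : A →+* C} (hp : Function.Surjective p) {c : C0 →+* C} (hc : Unr c) :
    ∃ g : AdicCompletion (maximalIdeal A) A →+* AdicCompletion (maximalIdeal C0) C0,
      Function.Surjective g ∧ RingHom.ker g = (RingHom.ker p).map (algebraMap A _) ∧
      ∀ a x, p a = c x → g (algebraMap _ _ a) = algebraMap _ _ x := by
  have hfg : (maximalIdeal C).FG := IsNoetherian.noetherian _
  obtain ⟨h1, h2, h3, h4⟩ := completion_package (maximalIdeal C) hfg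
  have hu : Unr (algebraMap C (AdicCompletion (maximalIdeal C) C)) := Unr.completion
  obtain ⟨g, hg, hgc, hgk⟩ := comp_lemma hp hu
  obtain ⟨e, he, hec, hek⟩ := comp_lemma (p := RingHom.id C0) Function.surjective_id (hc.comp hu)
  have hinj : Function.Injective e := by
    rw [RingHom.injective_iff_ker_eq_bot, hek]
    have : RingHom.ker (RingHom.id C0) = ⊥ :=
      (RingHom.injective_iff_ker_eq_bot _).1 Function.injective_id
    rw [this, Ideal.map_bot]
  let E := RingEquiv.ofBijective e ⟨hinj, he⟩
  refine ⟨(E.symm : _ →+* _).comp g, E.symm.surjective.comp hg, ?_, ?_⟩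
  · rw [← hgk]
    ext x
    simp [RingHom.mem_ker]
  · intro a x h
    rw [RingHom.comp_apply]
    have e1 : g (algebraMap _ _ a) = algebraMap _ _ (p a) :=
      congrArg (fun g : A →+* _ => g a) hgc
    have e2 : e (algebraMap _ _ x) = algebraMap _ _ (c x) :=
      congrArg (fun g : C0 →+* _ => g x) hec
    change E.symm _ = _
    rw [RingEquiv.symm_apply_eq]
    change _ = e _
    rw [e1, e2, h]

theorem E_rel2 {l n1 n2 : ℕ} {R A1 A2 C0 C1 C2 : Type u} [CommRing R] [CommRing A1] [CommRing A2]
    [CommRing C0] [CommRing C1] [CommRing C2]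
    [IsLocalRing R] [IsNoetherianRing R] [IsLocalRing A1] [IsNoetherianRing A1] [IsLocalRing A2]
    [IsNoetherianRing A2] [IsLocalRing C0] [IsNoetherianRing C0] [IsLocalRing C1]
    [IsNoetherianRing C1] [IsLocalRing C2] [IsNoetherianRing C2]
    {f1 : R →+* A1} {f2 : R →+* A2} [IsLocalHom f1] [IsLocalHom f2] (hf1 : WRn n1 f1) (hf2 : WRn n2 f2)
    {p1 : A1 →+* C1} {p2 : A2 →+* C2} (hp1 : Function.Surjective p1) (hp2 : Function.Surjective p2)
    {c1 : C0 →+* C1} {c2 : C0 →+* C2} (hc1 : Unr c1) (hc2 : Unr c2) (r : R →+* C0)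
    (h1 : p1.comp f1 = c1.comp r) (h2 : p2.comp f2 = c2.comp r) (h : GRSn l A1 (RingHom.ker p1)) :
    ∃ l', GRSn l' A2 (RingHom.ker p2) := by
  obtain ⟨a1, a2, a3, a4⟩ := completion_package (maximalIdeal A1) (IsNoetherian.noetherian _)
  obtain ⟨b1, b2, b3, b4⟩ := completion_package (maximalIdeal A2) (IsNoetherian.noetherian _)
  obtain ⟨d1, d2, d3, d4⟩ := completion_package (maximalIdeal C0) (IsNoetherian.noetherian _)
  have hu1 : Unr (algebraMap A1 (AdicCompletion (maximalIdeal A1) A1)) := Unr.completion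
  have hu2 : Unr (algebraMap A2 (AdicCompletion (maximalIdeal A2) A2)) := Unr.completion
  obtain ⟨g1, hg1, hk1, hgc1⟩ := E_half hp1 hc1
  obtain ⟨g2, hg2, hk2, hgc2⟩ := E_half hp2 hc2
  have := hu1.loc
  have := hu2.loc
  have h := h.flat hu1.flat (flat_local_map_ne_top h.ne_top)
  rw [← hk1] at h
  obtain ⟨l', hl'⟩ := E_rel (hf1.unr hu1) (hf2.unr hu2) hg1 hg2 (by
    ext x
    simp only [RingHom.comp_apply]
    rw [hgc1 (f1 x) (r x) (congrArg (fun g : R →+* _ => g x) h1),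
      hgc2 (f2 x) (r x) (congrArg (fun g : R →+* _ => g x) h2)]) h
  rw [hk2] at hl'
  exact ⟨l', hl'.desc hu2.flat⟩
end part13

section part14
theorem reg_GRS (d : ℕ) {A : Type u} [CommRing A] [IsLocalRing A] [IsNoetherianRing A]
    (rs : List A) (hl : rs.length = d) (hm : maximalIdeal A = Ideal.ofList rs)
    (hd : (d : WithBot ℕ∞) ≤ ringKrullDim A) : IsDomain A ∧ GRSn d A (maximalIdeal A) := by
  induction d generalizing A with
  | zero =>
    rw [List.length_eq_zero_iff] at hl
    subst hl
    rw [Ideal.ofList_nil] at hm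
    exact ⟨(isField_iff_maximalIdeal_eq.2 hm).isDomain, hm, inferInstance⟩
  | succ d ih =>
    have hdim : ringKrullDim A ≠ 0 := by
      intro h
      rw [h] at hd
      have : ((d + 1 : ℕ) : WithBot ℕ∞) ≤ ((0 : ℕ) : WithBot ℕ∞) := hd
      have h3 : d + 1 ≤ 0 := by exact_mod_cast this
      omega
    have hsq : ¬ maximalIdeal A ≤ maximalIdeal A ^ 2 := by
      intro h
      apply hdim
      apply ringKrullDim_eq_zero_of_isField
      rw [isField_iff_maximalIdeal_eq]
      apply Submodule.eq_bot_of_le_smul_of_le_jacobson_bot (maximalIdeal A) _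
        (IsNoetherian.noetherian _) _ (maximalIdeal_le_jacobson _)
      rw [smul_eq_mul, ← pow_two]
      exact h
    have hmin : ∀ p ∈ minimalPrimes A, ¬ maximalIdeal A ≤ p := by
      intro p hp hle
      have hpp : p.IsPrime := hp.1.1
      have : p = maximalIdeal A := le_antisymm (le_maximalIdeal hpp.ne_top) hle
      apply hdim
      rw [← maximalIdeal_height_eq_ringKrullDim]
      have := Ideal.height_eq_zero_iff.2 (this ▸ hp)
      rw [this]
      rfl
    obtain ⟨x, hx, hx2, hxp⟩ : ∃ x ∈ maximalIdeal A, x ∉ maximalIdeal A ^ 2 ∧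
        ∀ p ∈ minimalPrimes A, x ∉ p := by
      classical
      by_contra! hcon
      have hfin := minimalPrimes.finite_of_isNoetherianRing A
      have := (Ideal.subset_union_prime (s := insert (maximalIdeal A ^ 2) hfin.toFinset)
        (f := fun I : Ideal A => I) (maximalIdeal A ^ 2) (maximalIdeal A ^ 2)
        (I := maximalIdeal A) (by
          intro i hi h1 _
          rw [Finset.mem_insert] at hi
          rcases hi with hi | hi
          · exact absurd hi h1
          · exact (hfin.mem_toFinset.1 hi).1.1)).1 (by
          intro x hx
          simp only [Set.mem_iUnion]
          by_cases h2 : x ∈ maximalIdeal A ^ 2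
          · exact ⟨_, by simp, h2⟩
          · obtain ⟨p, hp, hxp⟩ := hcon x hx h2
            exact ⟨p, by simp [hp], hxp⟩)
      obtain ⟨i, hi, hle⟩ := this
      rw [Finset.mem_insert] at hi
      rcases hi with rfl | hi
      · exact hsq hle
      · exact hmin i (hfin.mem_toFinset.1 hi) hle
    obtain ⟨r, rs', a, hperm, ha, hv⟩ := exists_perm_unit rs x (hm ▸ hx) (by
      rw [← hm, ← pow_two]; exact hx2)
    have hxt : Ideal.span {x} ≠ ⊤ := by
      intro h
      apply (maximalIdeal.isMaximal A).ne_top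
      rw [eq_top_iff, ← h, Ideal.span_le, Set.singleton_subset_iff]
      exact hx
    have := isLocalRing_quot hxt
    let q := Ideal.Quotient.mk (Ideal.span {x})
    have hqx : q x = 0 := Ideal.Quotient.eq_zero_iff_mem.2 (Ideal.mem_span_singleton_self x)
    have hmq : maximalIdeal (A ⧸ Ideal.span {x}) = Ideal.ofList (rs'.map q) := by
      rw [← maximalIdeal_quot_span, hm, ofList_perm hperm, Ideal.map_ofList, List.map_cons,
        Ideal.ofList_cons]
      apply sup_eq_right.2
      rw [Ideal.span_le, Set.singleton_subset_iff]
      have h1 := Ideal.mem_map_of_mem q hv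
      rw [Ideal.map_ofList, map_sub, hqx, zero_sub, neg_mem_iff, map_mul] at h1
      exact ((Ideal.unit_mul_mem_iff_mem _ (ha.map q)).1 h1)
    have hd' : (d : WithBot ℕ∞) ≤ ringKrullDim (A ⧸ Ideal.span {x}) := by
      have h1 := ringKrullDim_le_ringKrullDim_quotient_add_card ({x} : Finset A) (by
        rw [ringJacobson_eq_maximalIdeal]; simpa using hx)
      rw [Finset.coe_singleton, Finset.card_singleton] at h1
      have h2 := hd.trans h1
      push_cast at h2
      generalize ringKrullDim (A ⧸ Ideal.span {x}) = y at h2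
      cases y with
      | bot =>
        rw [WithBot.bot_add, le_bot_iff] at h2
        exact absurd h2 WithBot.coe_ne_bot
      | coe n =>
        have h3 : (d : ℕ∞) + 1 ≤ n + 1 := WithBot.coe_le_coe.1 h2
        have h4 : (d : ℕ∞) ≤ n := (ENat.add_le_add_iff_right (by decide)).1 h3
        exact WithBot.coe_le_coe.2 h4
    obtain ⟨hdom, hG⟩ := ih (rs'.map q) (by
      have := hperm.length_eq
      rw [hl, List.length_cons] at this
      rw [List.length_map]; omega) hmq hd'
    have hpr : (Ideal.span {x}).IsPrime := (Ideal.Quotient.isDomain_iff_prime _).1 hdom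
    have hdomA : IsDomain A := by
      obtain ⟨p, hp, hple⟩ := Ideal.exists_minimalPrimes_le (bot_le (a := Ideal.span {x}))
      have hpp : p.IsPrime := hp.1.1
      have hbot : p = ⊥ := by
        apply Submodule.eq_bot_of_le_smul_of_le_jacobson_bot (maximalIdeal A) _
          (IsNoetherian.noetherian _) _ (maximalIdeal_le_jacobson _)
        intro y hy
        obtain ⟨z, rfl⟩ := Ideal.mem_span_singleton'.1 (hple hy)
        rcases hpp.mem_or_mem hy with h | h
        · rw [mul_comm]
          exact Submodule.smul_mem_smul hx h
        · exact absurd h (hxp p hp)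
      rw [hbot] at hpp
      exact IsDomain.of_bot_isPrime A
    refine ⟨hdomA, x, hx, ?_, ?_⟩
    · rw [isSMulRegular_iff_mul]
      intro b hb
      rcases mul_eq_zero.1 hb with h | h
      · exact absurd (h ▸ Ideal.zero_mem _) hx2
      · exact h
    · rw [maximalIdeal_quot_span]
      exact hG

theorem reg_local_GRS {A : Type u} [CommRing A] [IsRegularLocalRing A] :
    ∃ d, GRSn d A (maximalIdeal A) := by
  obtain ⟨s, hs1, hs2⟩ := Submodule.FG.exists_span_finset_card_eq_spanFinrank
    (IsNoetherian.noetherian (maximalIdeal A) : (maximalIdeal A).FG)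
  refine ⟨s.toList.length, (reg_GRS _ s.toList rfl ?_ ?_).2⟩
  · rw [Ideal.ofList, ← hs2]
    simp
  · rw [← IsRegularLocalRing.spanFinrank_maximalIdeal (R := A), Finset.length_toList, hs1]
end part14

section part15
section PLsec
variable {Ω : Type u} [Field Ω] {n : ℕ}

noncomputable abbrev PP {B : Type u} [CommRing B] (θ : B →+* Ω) (x : Fin n → Ω) :
    Ideal (MvPolynomial (Fin n) B) := RingHom.ker (MvPolynomial.eval₂Hom θ x)

instance PP_prime {B : Type u} [CommRing B] (θ : B →+* Ω) (x : Fin n → Ω) : (PP θ x).IsPrime :=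
  RingHom.ker_isPrime _

abbrev PL {B : Type u} [CommRing B] (θ : B →+* Ω) (x : Fin n → Ω) : Type u :=
  Localization.AtPrime (PP θ x)

noncomputable abbrev PLb {B : Type u} [CommRing B] (θ : B →+* Ω) (x : Fin n → Ω) : B →+* PL θ x :=
  (algebraMap (MvPolynomial (Fin n) B) (PL θ x)).comp MvPolynomial.C

theorem PL_comap {B B' : Type u} [CommRing B] [CommRing B'] {θ : B →+* Ω} {θ' : B' →+* Ω}
    (x : Fin n → Ω) {h : B →+* B'} (hθ : θ'.comp h = θ) :
    PP θ x = (PP θ' x).comap (MvPolynomial.map h) := by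
  unfold PP
  rw [RingHom.comap_ker]
  congr 1
  subst hθ
  apply MvPolynomial.ringHom_ext <;> simp

noncomputable def PLm {B B' : Type u} [CommRing B] [CommRing B'] {θ : B →+* Ω} {θ' : B' →+* Ω}
    (x : Fin n → Ω) {h : B →+* B'} (hθ : θ'.comp h = θ) : PL θ x →+* PL θ' x :=
  Localization.localRingHom (PP θ x) (PP θ' x) (MvPolynomial.map h) (PL_comap x hθ)

variable {B B' : Type u} [CommRing B] [CommRing B'] {θ : B →+* Ω} {θ' : B' →+* Ω}
    (x : Fin n → Ω) {h : B →+* B'} (hθ : θ'.comp h = θ)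

theorem PL_mem (hθ : θ'.comp h = θ) (p : MvPolynomial (Fin n) B) : p ∈ PP θ x ↔ MvPolynomial.map h p ∈ PP θ' x := by
  rw [PL_comap x hθ]; rfl

theorem PLm_alg (p : MvPolynomial (Fin n) B) : PLm x hθ (algebraMap _ _ p) = algebraMap _ _ (MvPolynomial.map h p) :=
  Localization.localRingHom_to_map _ _ _ _ _

theorem PLm_mk (p) (s : (PP θ x).primeCompl) : PLm x hθ (IsLocalization.mk' _ p s) =
    IsLocalization.mk' _ (MvPolynomial.map h p) (⟨MvPolynomial.map h s.1, fun hs => s.2 ((PL_mem x hθ _).2 hs)⟩ : (PP θ' x).primeCompl) :=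
  Localization.localRingHom_mk' _ _ _ _ _ _

theorem PLm_base : (PLm x hθ).comp (PLb θ x) = (PLb θ' x).comp h := by
  ext b
  simp [PLm_alg]

instance PLm_local : IsLocalHom (PLm x hθ) := Localization.isLocalHom_localRingHom _ _ _ _

theorem PLb_flat : (PLb θ x).Flat := by
  refine RingHom.Flat.comp (f := MvPolynomial.C) ?_ ?_
  · have : (algebraMap B (MvPolynomial (Fin n) B)).Flat :=
      RingHom.flat_algebraMap_iff.mpr inferInstance
    exact this
  · exact RingHom.flat_algebraMap_iff.mpr (IsLocalization.flat _ (PP θ x).primeCompl)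

theorem PLb_local [IsLocalHom θ] : IsLocalHom (PLb θ x) := by
  refine ⟨fun b hb => ?_⟩
  rw [RingHom.comp_apply, IsLocalization.AtPrime.isUnit_to_map_iff (PL θ x) (PP θ x)] at hb
  have h2 : θ b ≠ 0 := by simpa [PP, Ideal.primeCompl, RingHom.mem_ker] using hb
  exact isUnit_of_map_unit θ b h2.isUnit

theorem map_flat (hh : h.Flat) : (MvPolynomial.map (σ := Fin n) h).Flat := by
  letI := h.toAlgebra
  letI : Algebra (MvPolynomial (Fin n) B) (MvPolynomial (Fin n) B') :=
    MvPolynomial.algebraMvPolynomial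
  exact RingHom.Flat.isStableUnderBaseChange B B' (MvPolynomial (Fin n) B)
    (MvPolynomial (Fin n) B') hh

theorem PLm_flat (hh : h.Flat) : (PLm x hθ).Flat := (map_flat hh).localRingHom _ _ _

theorem PLm_surj (hh : Function.Surjective h) : Function.Surjective (PLm x hθ) := by
  intro y
  obtain ⟨p, s, rfl⟩ := IsLocalization.exists_mk'_eq (PP θ' x).primeCompl y
  obtain ⟨p, rfl⟩ := MvPolynomial.map_surjective h hh p
  obtain ⟨s, hs⟩ := s
  obtain ⟨s, rfl⟩ := MvPolynomial.map_surjective h hh s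
  exact ⟨IsLocalization.mk' _ p (⟨s, fun h1 => hs ((PL_mem x hθ _).1 h1)⟩ : (PP θ x).primeCompl), PLm_mk _ _ _ _⟩

theorem PLm_ker (hh : Function.Surjective h) :
    RingHom.ker (PLm x hθ) = (RingHom.ker h).map (PLb θ x) := by
  apply le_antisymm
  · intro y hy
    obtain ⟨p, s, rfl⟩ := IsLocalization.exists_mk'_eq (PP θ x).primeCompl y
    rw [RingHom.mem_ker, PLm_mk, IsLocalization.mk'_eq_zero_iff] at hy
    obtain ⟨⟨t, ht⟩, hy⟩ := hy
    obtain ⟨t, rfl⟩ := MvPolynomial.map_surjective h hh t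
    have ht' : t ∈ (PP θ x).primeCompl := fun h1 => ht ((PL_mem x hθ _).1 h1)
    have h1 : t * p ∈ (RingHom.ker h).map (MvPolynomial.C (σ := Fin n)) := by
      rw [← MvPolynomial.ker_map, RingHom.mem_ker, map_mul]; exact hy
    have h2 := Ideal.mem_map_of_mem (algebraMap _ (PL θ x)) h1
    rw [Ideal.map_map, map_mul] at h2
    rw [Ideal.unit_mul_mem_iff_mem _
      (IsLocalization.map_units (PL θ x) (⟨t, ht'⟩ : (PP θ x).primeCompl))] at h2
    rw [IsLocalization.mk'_eq_mul_mk'_one]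
    exact Ideal.mul_mem_right _ _ h2
  · rw [Ideal.map_le_iff_le_comap]
    intro b hb
    have := congrArg (fun g : B →+* _ => g b) (PLm_base x hθ)
    simp only [RingHom.comp_apply] at this
    rw [Ideal.mem_comap, RingHom.mem_ker, RingHom.comp_apply, this, (RingHom.mem_ker).1 hb,
      map_zero, map_zero]

theorem PP_le [IsLocalRing B] [IsLocalHom θ] :
    (maximalIdeal B).map (MvPolynomial.C (σ := Fin n)) ≤ PP θ x := by
  rw [Ideal.map_le_iff_le_comap]
  intro b hb
  rw [Ideal.mem_comap, RingHom.mem_ker, MvPolynomial.coe_eval₂Hom, MvPolynomial.eval₂_C]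
  by_contra h1
  exact hb (isUnit_of_map_unit θ b (Ne.isUnit h1))

theorem PL_approx [IsLocalRing B] [IsLocalRing B'] (hh : Unr h) (p : MvPolynomial (Fin n) B') :
    ∃ q : MvPolynomial (Fin n) B, p - MvPolynomial.map h q ∈
      (maximalIdeal B').map (MvPolynomial.C (σ := Fin n)) := by
  induction p using MvPolynomial.induction_on with
  | C a =>
    obtain ⟨b, hb⟩ := hh.res a
    refine ⟨MvPolynomial.C b, ?_⟩
    rw [MvPolynomial.map_C, ← map_sub]
    exact Ideal.mem_map_of_mem _ hb
  | add p q hp hq =>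
    obtain ⟨p1, hp⟩ := hp
    obtain ⟨q1, hq⟩ := hq
    refine ⟨p1 + q1, ?_⟩
    rw [map_add, add_sub_add_comm]
    exact Ideal.add_mem _ hp hq
  | mul_X p i hp =>
    obtain ⟨p1, hp⟩ := hp
    refine ⟨p1 * MvPolynomial.X i, ?_⟩
    rw [map_mul, MvPolynomial.map_X, ← sub_mul]
    exact Ideal.mul_mem_right _ _ hp

theorem PLm_unr [IsLocalRing B] [IsLocalRing B'] [IsLocalHom θ] [IsLocalHom θ'] (hh : Unr h) :
    Unr (PLm x hθ) := by
  have key : (PP θ x).map (MvPolynomial.map h) = PP θ' x := by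
    apply le_antisymm
    · rw [Ideal.map_le_iff_le_comap, ← PL_comap x hθ]
    · intro p hp
      obtain ⟨q, hq⟩ := PL_approx hh p
      have h1 : MvPolynomial.map h q ∈ PP θ' x := by
        have := Ideal.sub_mem _ hp (PP_le x hq)
        rwa [sub_sub_cancel] at this
      have h2 : q ∈ PP θ x := by rw [PL_comap x hθ]; exact h1
      have h3 : p - MvPolynomial.map h q ∈ (PP θ x).map (MvPolynomial.map h) := by
        rw [← hh.map_eq, Ideal.map_map, ← MvPolynomial.map_comp_C, ← Ideal.map_map] at hq
        exact Ideal.map_mono (PP_le x) hq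
      have := Ideal.add_mem _ h3 (Ideal.mem_map_of_mem (MvPolynomial.map h) h2)
      rwa [sub_add_cancel] at this
  refine ⟨PLm_flat x hθ hh.flat, inferInstance, ?_, fun y => ?_⟩
  · rw [← Localization.AtPrime.map_eq_maximalIdeal, ← Localization.AtPrime.map_eq_maximalIdeal]
    have h1 := congrArg (Ideal.map (algebraMap _ (PL θ' x))) key
    rw [← h1, Ideal.map_map, Ideal.map_map]
    congr 1
    refine RingHom.ext fun p => ?_
    exact PLm_alg x hθ p
  · obtain ⟨p, s, rfl⟩ := IsLocalization.exists_mk'_eq (PP θ' x).primeCompl y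
    obtain ⟨q, hq⟩ := PL_approx hh p
    obtain ⟨t, ht⟩ := PL_approx hh s.1
    replace hq := PP_le (θ := θ') x hq
    replace ht := PP_le (θ := θ') x ht
    have ht' : t ∈ (PP θ x).primeCompl := fun h1 => s.2 (by
      have := Ideal.add_mem _ ht ((PL_mem x hθ _).1 h1)
      rwa [sub_add_cancel] at this)
    refine ⟨IsLocalization.mk' _ q (⟨t, ht'⟩ : (PP θ x).primeCompl), ?_⟩
    rw [PLm_mk, ← IsLocalization.mk'_sub, IsLocalization.AtPrime.mk'_mem_maximal_iff (PL θ' x) (PP θ' x)]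
    have : p * MvPolynomial.map h t - MvPolynomial.map h q * s.1 =
      (p - MvPolynomial.map h q) * MvPolynomial.map h t -
      MvPolynomial.map h q * (s.1 - MvPolynomial.map h t) := by ring
    change p * MvPolynomial.map h t - MvPolynomial.map h q * s.1 ∈ _
    rw [this]
    exact Ideal.sub_mem _ (Ideal.mul_mem_right _ _ hq) (Ideal.mul_mem_left _ _ ht)

theorem PLb_WR [IsLocalRing B] [IsLocalHom θ] : ∃ d, WRn d (PLb θ x) := by
  let θ1 : ResidueField B →+* Ω := ResidueField.lift θ
  have h1 : θ1.comp (residue B) = θ := ResidueField.lift_comp_residue θ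
  have hr : IsRegularLocalRing (PL θ1 x) :=
    IsRegularRing.isRegularLocalRing_localization (PP θ1 x)
  obtain ⟨d, hd⟩ := reg_local_GRS (A := PL θ1 x)
  have hs := PLm_surj x h1 residue_surjective
  refine ⟨d, WRn.of_fibre (PLb_flat x) hs ?_ ?_⟩
  · rw [PLm_ker x h1 residue_surjective, ker_residue]
  · rw [map_maximalIdeal_of_surjective _ hs]
    convert hd
end PLsec
end part15

section part16
theorem common_field {R S W : Type u} [CommRing R] [CommRing S] [CommRing W] [IsLocalRing R]
    [IsLocalRing S] [IsLocalRing W] (f : R →+* S) (g : R →+* W) [IsLocalHom f] [IsLocalHom g] :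
    ∃ (Ω : Type u) (_ : Field Ω) (τ : S →+* Ω) (ω : W →+* Ω), IsLocalHom τ ∧ IsLocalHom ω ∧
      τ.comp f = ω.comp g := by
  letI := (ResidueField.map f).toAlgebra
  letI := (ResidueField.map g).toAlgebra
  let T := ResidueField S ⊗[ResidueField R] ResidueField W
  obtain ⟨M, hM⟩ := Ideal.exists_maximal T
  let i1 : ResidueField S →+* T := Algebra.TensorProduct.includeLeftRingHom
  let i2 : ResidueField W →+* T :=
    (Algebra.TensorProduct.includeRight : ResidueField W →ₐ[ResidueField R] T).toRingHom
  letI := Ideal.Quotient.field M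
  refine ⟨T ⧸ M, inferInstance, ((Ideal.Quotient.mk M).comp i1).comp (residue S),
    ((Ideal.Quotient.mk M).comp i2).comp (residue W), inferInstance, inferInstance, ?_⟩
  ext r
  simp only [RingHom.comp_apply]
  congr 1
  have h1 : i1 (algebraMap (ResidueField R) (ResidueField S) (residue R r)) =
    i2 (algebraMap (ResidueField R) (ResidueField W) (residue R r)) :=
    (Algebra.TensorProduct.tmul_one_eq_one_tmul (residue R r))
  exact h1

theorem eft_surj {R S Ω : Type u} [CommRing R] [CommRing S] [Field Ω] [IsLocalRing S] [Algebra R S]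
    [Algebra.EssFiniteType R S] (τ : S →+* Ω) [IsLocalHom τ] :
    ∃ (n : ℕ) (y : Fin n → S) (π : PL (τ.comp (algebraMap R S)) (fun i => τ (y i)) →+* S),
      Function.Surjective π ∧ ∀ p : MvPolynomial (Fin n) R, π (algebraMap _ _ p) = MvPolynomial.aeval y p := by
  obtain ⟨σ, hσ⟩ := (Algebra.essFiniteType_iff R S).1 inferInstance
  let y : Fin σ.card → S := fun i => (σ.equivFin.symm i : S)
  have hy : Set.range y = (σ : Set S) := by
    ext s
    constructor
    · rintro ⟨i, rfl⟩
      exact (σ.equivFin.symm i).2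
    · intro hs
      exact ⟨σ.equivFin ⟨s, hs⟩, by simp [y]⟩
  rw [← hy, Algebra.adjoin_range_eq_range_aeval] at hσ
  let x := fun i => τ (y i)
  let θ := τ.comp (algebraMap R S)
  have hcomp : τ.comp ((MvPolynomial.aeval y : _ →ₐ[R] S) : MvPolynomial (Fin σ.card) R →+* S) =
      MvPolynomial.eval₂Hom θ x := by
    apply MvPolynomial.ringHom_ext <;> simp [θ, x]
  have hc : ∀ p : MvPolynomial (Fin σ.card) R, τ (MvPolynomial.aeval y p) =
      MvPolynomial.eval₂Hom θ x p := fun p =>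
    congrArg (fun g : MvPolynomial (Fin σ.card) R →+* Ω => g p) hcomp
  have hu : ∀ s : (PP θ x).primeCompl, IsUnit
      (((MvPolynomial.aeval y : _ →ₐ[R] S) : MvPolynomial (Fin σ.card) R →+* S) s) := by
    rintro ⟨s, hs⟩
    have h1 : MvPolynomial.eval₂Hom θ x s ≠ 0 := hs
    rw [← hc] at h1
    exact isUnit_of_map_unit τ _ h1.isUnit
  let π : PL θ x →+* S := IsLocalization.lift hu
  have hπ : ∀ p : MvPolynomial (Fin σ.card) R, π (algebraMap _ _ p) = MvPolynomial.aeval y p := fun p =>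
    IsLocalization.lift_eq hu p
  refine ⟨σ.card, y, π, fun s => ?_, hπ⟩
  obtain ⟨t, ⟨q, hq⟩, ht, ⟨p, hp⟩⟩ := hσ s
  have hq' : q ∈ (PP θ x).primeCompl := by
    intro h1
    have h2 : MvPolynomial.eval₂Hom θ x q = 0 := h1
    rw [← hc] at h2
    have h3 : τ t = 0 := by rw [← hq]; exact h2
    exact (ht.map τ).ne_zero h3
  refine ⟨IsLocalization.mk' _ p ⟨q, hq'⟩, ?_⟩
  rw [IsLocalization.lift_mk'_spec]
  change MvPolynomial.aeval y p = MvPolynomial.aeval y q * s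
  change MvPolynomial.aeval y p = s * t at hp
  change MvPolynomial.aeval y q = t at hq
  rw [hp, hq, mul_comm]
end part16

section part17
section FD
variable {Q : Type u} [CommRing Q]
  {K P F : Type u} [AddCommGroup K] [AddCommGroup P] [AddCommGroup F]
  [Module Q K] [Module Q P] [Module Q F]

theorem flat_of_ker {i : K →ₗ[Q] P} {f : P →ₗ[Q] F} (hi : Function.Injective i)
    (hf : Function.Surjective f) (h : Function.Exact i f) (hP : Module.Flat Q P)
    (hF : Module.Flat Q F) : Module.Flat Q K := by
  rw [Module.Flat.iff_rTensor_preserves_injective_linearMap]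
  intro X Y _ _ _ _ g hg
  have h1 : Function.Injective (i.lTensor X) :=
    LinearMap.lTensor_injective_of_exact_of_flat f hf i hi h X
  have h2 : Function.Injective (g.rTensor P) := Module.Flat.rTensor_preserves_injective_linearMap g hg
  have h3 : (g.rTensor P).comp (i.lTensor X) = (i.lTensor Y).comp (g.rTensor K) := by
    rw [LinearMap.rTensor_comp_lTensor, LinearMap.lTensor_comp_rTensor]
  have h4 := h2.comp h1
  rw [← LinearMap.coe_comp, h3, LinearMap.coe_comp] at h4
  exact h4.of_comp

theorem flat_of_ext {i : K →ₗ[Q] P} {f : P →ₗ[Q] F} (hi : Function.Injective i)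
    (hf : Function.Surjective f) (h : Function.Exact i f) (hK : Module.Flat Q K)
    (hF : Module.Flat Q F) : Module.Flat Q P := by
  rw [Module.Flat.iff_rTensor_preserves_injective_linearMap]
  intro X Y _ _ _ _ g hg
  rw [injective_iff_map_eq_zero]
  intro z hz
  have h1 : Function.Injective (i.lTensor Y) :=
    LinearMap.lTensor_injective_of_exact_of_flat f hf i hi h Y
  have h2 : Function.Injective (g.rTensor F) := Module.Flat.rTensor_preserves_injective_linearMap g hg
  have h3 : Function.Injective (g.rTensor K) := Module.Flat.rTensor_preserves_injective_linearMap g hg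
  have c1 : (g.rTensor P).comp (i.lTensor X) = (i.lTensor Y).comp (g.rTensor K) := by
    rw [LinearMap.rTensor_comp_lTensor, LinearMap.lTensor_comp_rTensor]
  have c2 : (g.rTensor F).comp (f.lTensor X) = (f.lTensor Y).comp (g.rTensor P) := by
    rw [LinearMap.rTensor_comp_lTensor, LinearMap.lTensor_comp_rTensor]
  have e1 : f.lTensor X z = 0 := by
    apply h2
    have := LinearMap.congr_fun c2 z
    simp only [LinearMap.comp_apply] at this
    rw [this, hz, map_zero, map_zero]
  obtain ⟨w, rfl⟩ := (lTensor_exact X h hf z).1 e1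
  have := LinearMap.congr_fun c1 w
  simp only [LinearMap.comp_apply] at this
  rw [this] at hz
  have e2 : w = 0 := h3 (by rw [h1 (hz.trans (map_zero _).symm), map_zero])
  rw [e2, map_zero]

theorem FlatDimLE.equiv {n : ℕ} {N N' : Type u} [AddCommGroup N] [AddCommGroup N'] [Module Q N]
    [Module Q N'] (h : FlatDimLE Q n N) (e : N ≃ₗ[Q] N') : FlatDimLE Q n N' := by
  cases n with
  | zero =>
    have : Module.Flat Q N := h
    exact Module.Flat.of_linearEquiv e.symm
  | succ n =>
    obtain ⟨F, _, _, f, h1, h2, h3⟩ := h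
    refine ⟨F, inferInstance, inferInstance, e.toLinearMap.comp f, h1, e.surjective.comp h2, ?_⟩
    have : LinearMap.ker (e.toLinearMap.comp f) = LinearMap.ker f := LinearEquiv.ker_comp e f
    rw [this]
    exact h3

theorem FlatDimLE.cons {n : ℕ} {i : K →ₗ[Q] P} {f : P →ₗ[Q] F} (hi : Function.Injective i)
    (hf : Function.Surjective f) (h : Function.Exact i f) (hP : Module.Flat Q P)
    (hK : FlatDimLE Q n K) : FlatDimLE Q (n + 1) F := by
  refine ⟨P, inferInstance, inferInstance, f, hP, hf, ?_⟩
  refine hK.equiv (LinearEquiv.ofInjective i hi ≪≫ₗ LinearEquiv.ofEq _ _ ?_)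
  exact (LinearMap.exact_iff.1 h).symm

theorem FlatDimLE.ker {n : ℕ} {i : K →ₗ[Q] P} {f : P →ₗ[Q] F} (hi : Function.Injective i)
    (hf : Function.Surjective f) (h : Function.Exact i f) (hF : Module.Flat Q F)
    (hP : FlatDimLE Q n P) : FlatDimLE Q n K := by
  cases n with
  | zero => exact flat_of_ker hi hf h hP hF
  | succ n =>
    obtain ⟨H, _, _, g, h1, h2, h3⟩ := hP
    have hKK : Module.Flat Q (LinearMap.ker (f.comp g)) :=
      flat_of_ker (Submodule.injective_subtype _) (hf.comp h2)
        (LinearMap.exact_subtype_ker_map (f.comp g)) h1 hF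
    have hr : LinearMap.range i = LinearMap.ker f := (LinearMap.exact_iff.1 h).symm
    let e : K ≃ₗ[Q] LinearMap.ker f := LinearEquiv.ofInjective i hi ≪≫ₗ LinearEquiv.ofEq _ _ hr
    let g' : LinearMap.ker (f.comp g) →ₗ[Q] LinearMap.ker f :=
      g.restrict (fun x hx => by simpa using hx)
    let j : LinearMap.ker g →ₗ[Q] LinearMap.ker (f.comp g) :=
      Submodule.inclusion (LinearMap.ker_le_ker_comp g f)
    refine FlatDimLE.equiv ?_ e.symm
    refine FlatDimLE.cons (i := j) (f := g') (Submodule.inclusion_injective _) ?_ ?_ hKK h3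
    · rintro ⟨y, hy⟩
      obtain ⟨x, rfl⟩ := h2 y
      exact ⟨⟨x, by simpa using hy⟩, rfl⟩
    · rintro ⟨x, hx⟩
      constructor
      · intro h4
        have h5 : g x = 0 := congrArg Subtype.val h4
        exact ⟨⟨x, h5⟩, rfl⟩
      · rintro ⟨⟨y, hy⟩, h4⟩
        have h5 : y = x := congrArg Subtype.val h4
        subst h5
        exact Subtype.ext hy

theorem FlatDimLE.ext {n : ℕ} {K P F : Type u} [AddCommGroup K] [AddCommGroup P] [AddCommGroup F]
    [Module Q K] [Module Q P] [Module Q F] {i : K →ₗ[Q] P} {f : P →ₗ[Q] F}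
    (hi : Function.Injective i)
    (hf : Function.Surjective f) (h : Function.Exact i f) (hF : Module.Flat Q F)
    (hK : FlatDimLE Q n K) : FlatDimLE Q n P := by
  induction n generalizing K P F with
  | zero => exact flat_of_ext hi hf h hK hF
  | succ n ih =>
    obtain ⟨H, _, _, g, h1, h2, h3⟩ := hK
    let F0 := F →₀ Q
    let a : F0 →ₗ[Q] F := Finsupp.linearCombination Q id
    have ha : Function.Surjective a := Finsupp.linearCombination_id_surjective Q F
    obtain ⟨b, hb⟩ := Module.projective_lifting_property f a hf
    have hb' : ∀ x, f (b x) = a x := fun x => LinearMap.congr_fun hb x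
    have hfi : ∀ x, f (i x) = 0 := fun x => h.apply_apply_eq_zero x
    let c : H × F0 →ₗ[Q] P := (i.comp g).coprod b
    have hc : Function.Surjective c := by
      intro p
      obtain ⟨x, hx⟩ := ha (f p)
      obtain ⟨k, hk⟩ := (h (p - b x)).1 (by rw [map_sub, hb', hx, sub_self])
      obtain ⟨y, rfl⟩ := h2 k
      exact ⟨(y, x), by simp [c, hk]⟩
    have hak : Module.Flat Q (LinearMap.ker a) :=
      flat_of_ker (Submodule.injective_subtype _) ha (LinearMap.exact_subtype_ker_map a)
        inferInstance hF
    have hHF : Module.Flat Q (H × F0) :=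
      flat_of_ext (i := LinearMap.inl Q H F0) (f := LinearMap.snd Q H F0) LinearMap.inl_injective
        LinearMap.snd_surjective (Function.Exact.inl_snd) h1 inferInstance
    refine ⟨H × F0, inferInstance, inferInstance, c, hHF, hc, ?_⟩
    let u : LinearMap.ker g →ₗ[Q] LinearMap.ker c :=
      (LinearMap.inl Q H F0).restrict (fun x hx => by
        rw [LinearMap.mem_ker] at hx ⊢; simp [c, hx])
    let v : LinearMap.ker c →ₗ[Q] LinearMap.ker a :=
      (LinearMap.snd Q H F0).restrict (fun x hx => by
        rw [LinearMap.mem_ker] at hx ⊢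
        have := congrArg f hx
        simpa [c, hb', hfi] using this)
    refine ih (K := LinearMap.ker g) (P := LinearMap.ker c) (F := LinearMap.ker a) (i := u) (f := v)
      ?_ ?_ ?_ hak h3
    · rintro ⟨x, hx⟩ ⟨y, hy⟩ hxy
      have := congrArg (fun z : LinearMap.ker c => z.1.1) hxy
      exact Subtype.ext this
    · rintro ⟨x, hx⟩
      obtain ⟨k, hk⟩ := (h (b x)).1 (by rw [hb']; exact hx)
      obtain ⟨y, rfl⟩ := h2 k
      exact ⟨⟨(-y, x), by simp [c, hk]⟩, rfl⟩
    · rintro ⟨⟨x, y⟩, hxy⟩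
      constructor
      · intro h4
        have h5 : y = 0 := congrArg Subtype.val h4
        subst h5
        have h6 : i (g x) = 0 := by simpa [c] using hxy
        exact ⟨⟨x, hi (h6.trans (map_zero i).symm)⟩, rfl⟩
      · rintro ⟨⟨z, hz⟩, h4⟩
        have h5 : (0 : F0) = y := congrArg (fun z : LinearMap.ker c => z.1.2) h4
        exact Subtype.ext h5.symm

theorem FlatDimLE.schanuel {n : ℕ} {i : K →ₗ[Q] P} {f : P →ₗ[Q] F} (hi : Function.Injective i)
    (hf : Function.Surjective f) (h : Function.Exact i f) (hP : Module.Flat Q P)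
    (hF : FlatDimLE Q (n + 1) F) : FlatDimLE Q n K := by
  obtain ⟨G, _, _, g, h1, h2, h3⟩ := hF
  let T : Submodule Q (P × G) := LinearMap.ker (f.coprod (-g))
  have hT : ∀ x : T, f x.1.1 = g x.1.2 := fun x => by
    have := x.2
    simp only [T, LinearMap.mem_ker, LinearMap.coprod_apply, LinearMap.neg_apply] at this
    exact add_neg_eq_zero.1 this
  have hT' : ∀ x y, f x = g y → (x, y) ∈ T := fun x y hxy => by
    simp [T, hxy]
  let p1 : T →ₗ[Q] P := (LinearMap.fst Q P G).comp T.subtype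
  let p2 : T →ₗ[Q] G := (LinearMap.snd Q P G).comp T.subtype
  have hfi : ∀ x, f (i x) = 0 := fun x => h.apply_apply_eq_zero x
  let j1 : LinearMap.ker g →ₗ[Q] T := ((LinearMap.inr Q P G).comp (LinearMap.ker g).subtype).codRestrict T
    (fun x => hT' _ _ (by have := x.2; rw [LinearMap.mem_ker] at this; simp [this]))
  let j2 : K →ₗ[Q] T := ((LinearMap.inl Q P G).comp i).codRestrict T
    (fun x => hT' _ _ (by simp [hfi]))
  have hTd : FlatDimLE Q n T := by
    refine FlatDimLE.ext (i := j1) (f := p1) ?_ ?_ ?_ hP h3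
    · intro x y hxy
      exact Subtype.ext (congrArg (fun z : T => z.1.2) hxy)
    · intro x
      obtain ⟨y, hy⟩ := h2 (f x)
      exact ⟨⟨(x, y), hT' _ _ hy.symm⟩, rfl⟩
    · rintro ⟨⟨x, y⟩, hxy⟩
      constructor
      · intro h4
        have h5 : x = 0 := h4
        subst h5
        have h6 := hT ⟨_, hxy⟩
        exact ⟨⟨y, by rw [LinearMap.mem_ker]; simpa using h6.symm⟩, rfl⟩
      · rintro ⟨z, h4⟩
        exact (congrArg (fun z : T => z.1.1) h4).symm
  refine FlatDimLE.ker (i := j2) (f := p2) ?_ ?_ ?_ h1 hTd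
  · intro x y hxy
    exact hi (congrArg (fun z : T => z.1.1) hxy)
  · intro y
    obtain ⟨x, hx⟩ := hf (g y)
    exact ⟨⟨(x, y), hT' _ _ hx⟩, rfl⟩
  · rintro ⟨⟨x, y⟩, hxy⟩
    constructor
    · intro h4
      have h5 : y = 0 := h4
      subst h5
      have h6 := hT ⟨_, hxy⟩
      obtain ⟨k, rfl⟩ := (h x).1 (by simpa using h6)
      exact ⟨k, rfl⟩
    · rintro ⟨z, h4⟩
      exact (congrArg (fun z : T => z.1.2) h4).symm
end FD
end part17

section part18
theorem FlatDimLE.baseChange {A B : Type u} [CommRing A] [CommRing B] [Algebra A B] [Module.Flat A B]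
    {n : ℕ} {N : Type u} [AddCommGroup N] [Module A N] (h : FlatDimLE A n N) :
    FlatDimLE B n (B ⊗[A] N) := by
  induction n generalizing N with
  | zero =>
    have : Module.Flat A N := h
    exact (inferInstance : Module.Flat B (B ⊗[A] N))
  | succ n ih =>
    obtain ⟨F, _, _, f, h1, h2, h3⟩ := h
    refine ⟨B ⊗[A] F, inferInstance, inferInstance, AlgebraTensorModule.lTensor B B f,
      inferInstance, LinearMap.lTensor_surjective B h2, ?_⟩
    exact (ih h3).equiv (LinearMap.tensorKerEquiv B B f)

section poly
open Polynomial
variable {Q : Type u} [CommRing Q]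

theorem poly_smul_of {E E' : Type u} [AddCommGroup E] [AddCommGroup E'] [Module Q E] [Module Q E']
    [Module Q[X] E] [Module Q[X] E'] [IsScalarTower Q Q[X] E] [IsScalarTower Q Q[X] E']
    (l : E →ₗ[Q] E') (hX : ∀ e, l ((X : Q[X]) • e) = (X : Q[X]) • l e) (t : Q[X]) (e : E) :
    l (t • e) = t • l e := by
  induction t using Polynomial.induction_on' generalizing e with
  | add p q hp hq => rw [add_smul, add_smul, map_add, hp, hq]
  | monomial n a =>
    have : ∀ e, l ((X ^ n : Q[X]) • e) = (X ^ n : Q[X]) • l e := by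
      induction n with
      | zero => simp
      | succ n ih => intro e; rw [pow_succ, mul_smul, mul_smul, ih, hX]
    rw [← mul_one a, ← smul_eq_mul, ← smul_monomial, smul_assoc, smul_assoc, map_smul,
      monomial_one_right_eq_X_pow, this]

theorem fd_poly_flat {N : Type u} [AddCommGroup N] [Module Q N]
    [Module Q[X] N] [IsScalarTower Q Q[X] N] (h : Module.Flat Q N) : FlatDimLE Q[X] 1 N := by
  let E := PolynomialModule Q N
  have hE : Module.Flat Q[X] E :=
    Module.Flat.of_linearEquiv (PolynomialModule.polynomialTensorProductLEquivPolynomialModule (R := Q) (M := N)).symm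
  let xm : N →ₗ[Q] N :=
    { toFun := fun m => (X : Q[X]) • m
      map_add' := fun a b => smul_add _ _ _
      map_smul' := fun r a => smul_comm _ _ _ }
  let ε0 : E →ₗ[Q] N := (Finsupp.lsum Q (fun i => xm ^ i)).comp
    (PolynomialModule.coeffLinearEquiv Q Q).toLinearMap
  have hxm : ∀ (i : ℕ) m, (xm ^ i) m = (X ^ i : Q[X]) • m := by
    intro i m
    induction i with
    | zero => simp
    | succ i ih => rw [pow_succ', Module.End.mul_apply, ih, pow_succ', mul_smul]; rfl
  have hε0 : ∀ i m, ε0 (PolynomialModule.single Q i m) = (X ^ i : Q[X]) • m := by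
    intro i m
    rw [← hxm]
    change (Finsupp.lsum Q (fun i => xm ^ i)) (Finsupp.single i m) = _
    simp
  have hXs : ∀ i (m : N), (X : Q[X]) • PolynomialModule.single Q i m =
      PolynomialModule.single Q (i + 1) m := by
    intro i m
    rw [← monomial_one_one_eq_X, PolynomialModule.monomial_smul_single, one_smul, add_comm]
  let δ0 : E →ₗ[Q] E := PolynomialModule.map Q xm
  have hδ0 : ∀ i m, δ0 (PolynomialModule.single Q i m) =
      PolynomialModule.single Q i ((X : Q[X]) • m) := fun i m => PolynomialModule.map_single _ _ _ _
  let ε : E →ₗ[Q[X]] N :=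
    { ε0 with
      map_smul' := poly_smul_of ε0 (by
        intro e
        induction e using PolynomialModule.induction_linear with
        | zero => simp
        | add a b ha hb => rw [smul_add, map_add, ha, hb, map_add, smul_add]
        | single i m => rw [hXs, hε0, hε0, pow_succ', mul_smul]) }
  let δ1 : E →ₗ[Q[X]] E :=
    { δ0 with
      map_smul' := poly_smul_of δ0 (by
        intro e
        induction e using PolynomialModule.induction_linear with
        | zero => simp
        | add a b ha hb => rw [smul_add, map_add, ha, hb, map_add, smul_add]
        | single i m => rw [hXs, hδ0, hδ0, hXs]) }
  let δ : E →ₗ[Q[X]] E := (X : Q[X]) • LinearMap.id - δ1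
  have hδ : ∀ i m, δ (PolynomialModule.single Q i m) = PolynomialModule.single Q (i + 1) m -
      PolynomialModule.single Q i ((X : Q[X]) • m) := by
    intro i m
    rw [← hδ0, ← hXs]; rfl
  have hc : ∀ (e : E) i, (δ e).coeff (i + 1) = e.coeff i - (X : Q[X]) • e.coeff (i + 1) := by
    intro e i
    induction e using PolynomialModule.induction_linear with
    | zero => simp
    | add a b ha hb =>
      rw [map_add δ, PolynomialModule.coeff_add, Finsupp.add_apply, ha, hb,
        PolynomialModule.coeff_add, Finsupp.add_apply, Finsupp.add_apply, smul_add]; abel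
    | single j m =>
      rw [hδ]
      have e1 : (PolynomialModule.single Q (j + 1) m -
          PolynomialModule.single Q j ((X : Q[X]) • m)).coeff =
          Finsupp.single (j + 1) m - Finsupp.single j ((X : Q[X]) • m) := rfl
      rw [e1, Finsupp.sub_apply, PolynomialModule.coeff_single, Finsupp.single_apply,
        Finsupp.single_apply, Finsupp.single_apply, Finsupp.single_apply]
      congr 1
      · simp
      · split_ifs <;> simp
  have hεs : Function.Surjective ε := fun m =>
    ⟨PolynomialModule.single Q 0 m, (hε0 0 m).trans (by simp)⟩
  have hεδ : ∀ e, ε (δ e) = 0 := by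
    intro e
    induction e using PolynomialModule.induction_linear with
    | zero => simp
    | add a b ha hb => rw [map_add, map_add, ha, hb, add_zero]
    | single i m =>
      rw [hδ, map_sub, sub_eq_zero]
      exact (hε0 _ _).trans ((hε0 _ _).trans (by rw [pow_succ, mul_smul])).symm
  have hmod : ∀ e : E, ∃ e', e = PolynomialModule.single Q 0 (ε e) + δ e' := by
    intro e
    induction e using PolynomialModule.induction_linear with
    | zero => exact ⟨0, by simp⟩
    | add a b ha hb =>
      obtain ⟨a', ha⟩ := ha
      obtain ⟨b', hb⟩ := hb
      refine ⟨a' + b', ?_⟩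
      rw [map_add, map_add, PolynomialModule.single_add]
      nth_rw 1 [ha, hb]; abel
    | single i m =>
      induction i generalizing m with
      | zero => exact ⟨0, by rw [show ε _ = _ from hε0 0 m]; simp⟩
      | succ i ih =>
        obtain ⟨e', he⟩ := ih ((X : Q[X]) • m)
        refine ⟨e' + PolynomialModule.single Q i m, ?_⟩
        have : ε (PolynomialModule.single Q (i + 1) m) =
            ε (PolynomialModule.single Q i ((X : Q[X]) • m)) :=
          (hε0 _ _).trans ((hε0 _ _).trans (by rw [pow_succ, mul_smul])).symm
        rw [this, map_add, ← add_assoc, ← he, hδ]; abel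
  refine FlatDimLE.cons (i := δ) (f := ε) ?_ hεs ?_ hE hE
  · rw [injective_iff_map_eq_zero]
    intro e he
    have h1 : ∀ i, e.coeff i = (X : Q[X]) • e.coeff (i + 1) := fun i => by
      have := hc e i
      rw [he] at this
      exact (sub_eq_zero.1 this.symm)
    have h2 : ∀ j i, e.coeff i = (X ^ j : Q[X]) • e.coeff (i + j) := by
      intro j
      induction j with
      | zero => simp
      | succ j ih => intro i; rw [ih, h1, smul_smul, ← pow_succ, add_assoc]
    obtain ⟨B, hB⟩ := e.coeff.support.exists_nat_subset_range
    refine PolynomialModule.coeff_injective (Finsupp.ext fun i => ?_)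
    rw [h2 B i, Finsupp.notMem_support_iff.1 (fun hh => by
      have := Finset.mem_range.1 (hB hh); omega), smul_zero]
    rfl
  · intro e
    constructor
    · intro h
      obtain ⟨e', he⟩ := hmod e
      exact ⟨e', by rw [he, h]; simp⟩
    · rintro ⟨e', rfl⟩
      exact hεδ e'
end poly
end part18

section part19
section poly
open Polynomial

theorem fd_poly {Q : Type u} [CommRing Q] {d : ℕ} {N : Type u} [AddCommGroup N] [Module Q N]
    [Module Q[X] N] [IsScalarTower Q Q[X] N] (h : FlatDimLE Q d N) : FlatDimLE Q[X] (d + 1) N := by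
  induction d generalizing N with
  | zero => exact fd_poly_flat h
  | succ d ih =>
    let F := N →₀ Q[X]
    let a : F →ₗ[Q[X]] N := Finsupp.linearCombination Q[X] id
    have ha : Function.Surjective a := Finsupp.linearCombination_id_surjective Q[X] N
    have hF : Module.Flat Q F := inferInstance
    refine ⟨F, inferInstance, inferInstance, a, inferInstance, ha, ih ?_⟩
    exact FlatDimLE.schanuel (i := (LinearMap.ker a).subtype.restrictScalars Q)
      (f := a.restrictScalars Q) (Submodule.injective_subtype _) ha
      (LinearMap.exact_subtype_ker_map a) hF h

end poly

/-- finite flat dimension goes up along `φ` -/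
def FDup {Q T : Type u} [CommRing Q] [CommRing T] (φ : Q →+* T) : Prop :=
  ∀ (N : Type u) [AddCommGroup N] [Module Q N] [Module T N], (∀ q (n : N), φ q • n = q • n) →
    FlatDimFinite Q N → FlatDimFinite T N

theorem FDup.comp {Q T V : Type u} [CommRing Q] [CommRing T] [CommRing V] {φ : Q →+* T}
    {ψ : T →+* V} (hφ : FDup φ) (hψ : FDup ψ) : FDup (ψ.comp φ) := by
  intro N _ _ _ h1 h2
  letI : Module T N := Module.compHom N ψ
  exact hψ N (fun _ _ => rfl) (hφ N h1 h2)

theorem FDup.C (Q : Type u) [CommRing Q] : FDup (Polynomial.C : Q →+* Polynomial Q) := by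
  intro N _ _ _ h1 ⟨n, h2⟩
  haveI : IsScalarTower Q (Polynomial Q) N := ⟨fun a b c => by
    rw [Polynomial.smul_eq_C_mul, mul_smul, h1]⟩
  exact ⟨_, fd_poly h2⟩

theorem FlatDimLE.of_ringEquiv {Q T : Type u} [CommRing Q] [CommRing T] (e : Q ≃+* T) {n : ℕ}
    {N : Type u} [AddCommGroup N] [Module Q N] [Module T N] (h : ∀ q (x : N), e q • x = q • x)
    (hN : FlatDimLE Q n N) : FlatDimLE T n N := by
  letI := (e : Q →+* T).toAlgebra
  have hfl : Module.Flat Q T := Module.Flat.of_linearEquiv (M := Q)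
    (LinearEquiv.symm { e with map_smul' := fun a b => map_mul e a b })
  haveI : IsScalarTower Q T N := ⟨fun a b c => by
    rw [Algebra.smul_def, mul_smul]; exact h a _⟩
  have h1 : FlatDimLE T n (T ⊗[Q] N) := hN.baseChange
  refine h1.equiv (LinearEquiv.ofBijective (LinearMap.liftBaseChange T (LinearMap.id : N →ₗ[Q] N)) ?_)
  refine ⟨?_, fun x => ⟨1 ⊗ₜ x, by simp⟩⟩
  have key : ∀ z : T ⊗[Q] N, z = 1 ⊗ₜ[Q] (LinearMap.liftBaseChange T (LinearMap.id : N →ₗ[Q] N) z) := by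
    intro z
    induction z with
    | zero => simp
    | add x y hx hy => rw [map_add, tmul_add, ← hx, ← hy]
    | tmul t x =>
      rw [LinearMap.liftBaseChange_tmul, LinearMap.id_apply]
      obtain ⟨q, rfl⟩ := e.surjective t
      rw [h, tmul_smul, smul_tmul', Algebra.smul_def, mul_one]
      rfl
  intro x y hxy
  rw [key x, key y, hxy]

theorem FDup.equiv {Q T : Type u} [CommRing Q] [CommRing T] (e : Q ≃+* T) :
    FDup (e : Q →+* T) := by
  intro N _ _ _ h ⟨n, hn⟩
  exact ⟨n, hn.of_ringEquiv e h⟩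

theorem FDup.mv (n : ℕ) (Q : Type u) [CommRing Q] :
    FDup (MvPolynomial.C : Q →+* MvPolynomial (Fin n) Q) := by
  induction n with
  | zero =>
    have := FDup.equiv (MvPolynomial.isEmptyAlgEquiv Q (Fin 0)).symm.toRingEquiv
    convert this
    ext x
    simp
  | succ n ih =>
    have := ((ih).comp (FDup.C _)).comp
      (FDup.equiv (MvPolynomial.finSuccEquiv Q n).symm.toRingEquiv)
    convert this
    refine RingHom.ext fun x => ?_
    apply (MvPolynomial.finSuccEquiv Q n).injective
    simp [MvPolynomial.finSuccEquiv_apply]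
end part19

section part20
theorem tensor_desc {A B C : Type u} [CommRing A] [CommRing B] [CommRing C] [Algebra A B]
    {q : C →+* B} (hq : Function.Surjective q) {M P : Type u} [AddCommGroup M] [Module A M]
    [AddCommGroup P] [Module C P] (μ : M →+ P) (h1 : ∀ c, q c = 0 → ∀ m, c • μ m = 0)
    (h2 : ∀ a m c, q c = algebraMap A B a → c • μ m = μ (a • m)) :
    ∃ Ψ : B ⊗[A] M →+ P, ∀ c m, Ψ (q c ⊗ₜ m) = c • μ m := by
  have key : ∀ c d m, q c = q d → c • μ m = d • μ m := fun c d m h => by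
    rw [← sub_eq_zero, ← sub_smul]
    exact h1 _ (by rw [map_sub, h, sub_self]) _
  let s := Function.surjInv hq
  have hs : ∀ b, q (s b) = b := Function.surjInv_eq hq
  let F : B →+ (M →+ P) := AddMonoidHom.mk' (fun b => AddMonoidHom.mk' (fun m => s b • μ m)
    (fun m m' => by rw [map_add, smul_add])) (fun b b' => by
      ext m
      change s (b + b') • μ m = s b • μ m + s b' • μ m
      rw [← add_smul]
      exact key _ _ _ (by simp [hs]))
  refine ⟨TensorProduct.liftAddHom F ?_, fun c m => ?_⟩
  · intro a b m
    change s (a • b) • μ m = s b • μ (a • m)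
    obtain ⟨c, hc⟩ := hq (algebraMap A B a)
    rw [← h2 a m c hc, smul_smul]
    exact key _ _ _ (by rw [hs, map_mul, hs, hc, Algebra.smul_def, mul_comm])
  · rw [TensorProduct.liftAddHom_tmul]
    exact key _ _ _ (hs _)

section act
variable {R S R' Q : Type u} [CommRing R] [CommRing S] [CommRing R'] [CommRing Q] [Algebra R S]
  [Algebra R R'] (g : Q →+* R') {n : ℕ} (y : Fin n → S) (M : Type u) [AddCommGroup M]
  [Module R M] [Module S M] [IsScalarTower R S M]

theorem act_exists : ∃ _ : Module (MvPolynomial (Fin n) Q) (R' ⊗[R] M),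
    (∀ a (r : R') (m : M), (MvPolynomial.C a : MvPolynomial (Fin n) Q) • (r ⊗ₜ[R] m) =
      (g a * r) ⊗ₜ m) ∧
    (∀ i (r : R') (m : M), (MvPolynomial.X i : MvPolynomial (Fin n) Q) • (r ⊗ₜ[R] m) =
      r ⊗ₜ (y i • m)) ∧
    (∀ (p : MvPolynomial (Fin n) Q) (p' : MvPolynomial (Fin n) R),
      MvPolynomial.map g p = MvPolynomial.map (algebraMap R R') p' → ∀ m : M,
      p • ((1 : R') ⊗ₜ[R] m) = 1 ⊗ₜ (MvPolynomial.aeval y p' • m)) := by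
  let ρ : S →ₐ[R] Module.End R' (R' ⊗[R] M) :=
    (Module.End.baseChangeHom R R' M).comp (Algebra.lsmul R R M)
  let l : R' ⊗[R] S →ₐ[R'] Module.End R' (R' ⊗[R] M) :=
    Algebra.TensorProduct.lift (Algebra.ofId R' _) ρ (fun a b => Algebra.commutes a (ρ b))
  have hl : ∀ a s r m, l (a ⊗ₜ s) (r ⊗ₜ m) = (a * r) ⊗ₜ (s • m) := by
    intro a s r m
    rw [show l (a ⊗ₜ s) = _ from Algebra.TensorProduct.lift_tmul _ _ _ a s, Module.End.mul_apply]
    change a • (r ⊗ₜ[R] (s • m)) = _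
    rw [smul_tmul', smul_eq_mul]
  let τ : MvPolynomial (Fin n) R' →+* R' ⊗[R] S :=
    MvPolynomial.eval₂Hom Algebra.TensorProduct.includeLeftRingHom (fun i => 1 ⊗ₜ y i)
  let σ : MvPolynomial (Fin n) Q →+* Module.End R' (R' ⊗[R] M) :=
    (l : _ →+* _).comp (τ.comp (MvPolynomial.map g))
  have hτ : ∀ p : MvPolynomial (Fin n) R, τ (MvPolynomial.map (algebraMap R R') p) =
      1 ⊗ₜ (MvPolynomial.aeval y p) := by
    intro p
    have : τ.comp (MvPolynomial.map (algebraMap R R')) =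
        (Algebra.TensorProduct.includeRight : S →ₐ[R] R' ⊗[R] S).toRingHom.comp
          (MvPolynomial.aeval y : _ →ₐ[R] S).toRingHom := by
      apply MvPolynomial.ringHom_ext
      · intro r
        simp [τ, Algebra.TensorProduct.algebraMap_apply]
      · intro i; simp [τ]
    exact RingHom.congr_fun this p
  refine ⟨Module.compHom _ σ, ?_, ?_, ?_⟩
  · intro a r m
    change σ _ _ = _
    simp [σ, τ, hl]
  · intro a r m
    change σ _ _ = _
    simp [σ, τ, hl]
  · intro p p' h m
    change l (τ _) _ = _
    rw [h, hτ, hl, one_mul]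
end act

section core
variable {Ω : Type u} [Field Ω] {n : ℕ} (x : Fin n → Ω)
variable {R S R' Q S' : Type u} [CommRing R] [CommRing S] [CommRing R'] [CommRing Q] [CommRing S']
  [Algebra R S] [Algebra R R'] [Algebra S S'] {g : Q →+* R'}
  {θR : R →+* Ω} {θR' : R' →+* Ω} {θQ : Q →+* Ω}

theorem fd_final (hg : Function.Surjective g) (hR : θR'.comp (algebraMap R R') = θR)
    (hQ : θR'.comp g = θQ) (y : Fin n → S) (π : PL θR x →+* S) (hπs : Function.Surjective π)
    (hπ : ∀ p : MvPolynomial (Fin n) R, π (algebraMap _ _ p) = MvPolynomial.aeval y p)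
    (q : PL θR' x →+* S') (hq : Function.Surjective q)
    (hqk : RingHom.ker q = (RingHom.ker π).map (PLm x hR))
    (hc : (algebraMap S S').comp π = q.comp (PLm x hR))
    (M : Type u) [AddCommGroup M] [Module R M] [Module S M] [IsScalarTower R S M]
    (hfd : letI : Module Q (R' ⊗[R] M) := Module.compHom _ g
      FlatDimFinite Q (R' ⊗[R] M)) :
    letI : Module (PL θQ x) (S' ⊗[S] M) := Module.compHom _ (q.comp (PLm x hQ))
    FlatDimFinite (PL θQ x) (S' ⊗[S] M) := by
  obtain ⟨_, ha, hb, hd⟩ := act_exists (R := R) (R' := R') g y M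
  letI : Module Q (R' ⊗[R] M) := Module.compHom _ g
  letI : Module (PL θQ x) (S' ⊗[S] M) := Module.compHom _ (q.comp (PLm x hQ))
  obtain ⟨d, hN⟩ := FDup.mv n Q (R' ⊗[R] M) (by
    intro a z
    induction z with
    | zero => simp
    | add u v hu hv => rw [smul_add, smul_add, hu, hv]
    | tmul r m => rw [ha]; rfl) hfd
  refine ⟨d, (hN.baseChange (B := PL θQ x)).equiv ?_⟩
  let κ : PL θQ x →+* S' := q.comp (PLm x hQ)
  have hκ : Function.Surjective κ := hq.comp (PLm_surj x hQ hg)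
  have hsm : ∀ c (z : (S' ⊗[S] M)), c • z = κ c • z := fun _ _ => rfl
  letI : Module (MvPolynomial (Fin n) Q) (S' ⊗[S] M) := Module.compHom (S' ⊗[S] M) (κ.comp (algebraMap (MvPolynomial (Fin n) Q) (PL θQ x)))
  haveI : IsScalarTower (MvPolynomial (Fin n) Q) (PL θQ x) (S' ⊗[S] M) := ⟨fun a b c => by
    rw [Algebra.smul_def, mul_smul]; rfl⟩
  have hsm' : ∀ (c : (MvPolynomial (Fin n) Q)) (z : (S' ⊗[S] M)), c • z = κ (algebraMap _ _ c) • z := fun _ _ => rfl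
  have hcc : ∀ p, algebraMap S S' (π p) = q (PLm x hR p) := fun p => RingHom.congr_fun hc p
  -- the map Φ0
  let F : R' →+ (M →+ (S' ⊗[S] M)) := AddMonoidHom.mk' (fun r => AddMonoidHom.mk'
    (fun m => (q (PLb θR' x r)) ⊗ₜ[S] m) (fun m m' => tmul_add _ _ _)) (fun r r' => by
      ext m
      change (q (PLb θR' x (r + r'))) ⊗ₜ[S] m = (q (PLb θR' x r)) ⊗ₜ[S] m + (q (PLb θR' x r')) ⊗ₜ[S] m
      rw [map_add, map_add, add_tmul])
  have hbase : ∀ r : R, q (PLb θR' x (algebraMap R R' r)) = algebraMap S S' (algebraMap R S r) := by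
    intro r
    have h1 := RingHom.congr_fun (PLm_base x hR) r
    simp only [RingHom.comp_apply] at h1 ⊢
    rw [← h1, ← hcc, hπ, MvPolynomial.aeval_C]
  let Φ0 : (R' ⊗[R] M) →+ (S' ⊗[S] M) := TensorProduct.liftAddHom F (by
    intro r r' m
    change (q (PLb θR' x (r • r'))) ⊗ₜ[S] m = (q (PLb θR' x r')) ⊗ₜ[S] (r • m)
    rw [Algebra.smul_def, map_mul, map_mul, hbase, ← Algebra.smul_def, smul_tmul, algebraMap_smul])
  have hΦ0 : ∀ r m, Φ0 (r ⊗ₜ m) = (q (PLb θR' x r)) ⊗ₜ[S] m := fun r m => by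
    rw [TensorProduct.liftAddHom_tmul]; rfl
  have hlin : ∀ (p : (MvPolynomial (Fin n) Q)) z, Φ0 (p • z) = p • Φ0 z := by
    intro p
    induction p using MvPolynomial.induction_on with
    | C a =>
      intro z
      induction z with
      | zero => simp
      | add u v hu hv => rw [smul_add, map_add, hu, hv, map_add, smul_add]
      | tmul r m =>
        rw [ha, hΦ0, hΦ0, hsm', smul_tmul', smul_eq_mul]
        congr 1
        simp only [κ, RingHom.comp_apply, PLm_alg, MvPolynomial.map_C, map_mul]
    | add u v hu hv => intro z; rw [add_smul, add_smul, map_add, hu, hv]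
    | mul_X p i hp =>
      intro z
      rw [mul_smul, hp, mul_smul]
      congr 1
      induction z with
      | zero => simp
      | add u v hu hv => rw [smul_add, map_add, hu, hv, map_add, smul_add]
      | tmul r m =>
        rw [hb, hΦ0, hΦ0, hsm', smul_tmul', smul_eq_mul, ← smul_tmul, Algebra.smul_def]
        congr 2
        have := hcc (algebraMap (MvPolynomial (Fin n) R) _ (MvPolynomial.X i))
        rw [hπ, MvPolynomial.aeval_X, PLm_alg, MvPolynomial.map_X] at this
        rw [this]
        simp only [κ, RingHom.comp_apply, PLm_alg, MvPolynomial.map_X]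
  let Φ1 : (R' ⊗[R] M) →ₗ[MvPolynomial (Fin n) Q] (S' ⊗[S] M) := { Φ0 with map_smul' := hlin }
  let Φ : PL θQ x ⊗[MvPolynomial (Fin n) Q] (R' ⊗[R] M) →ₗ[PL θQ x] (S' ⊗[S] M) := LinearMap.liftBaseChange _ Φ1
  have hΦ : ∀ c r m, Φ (c ⊗ₜ (r ⊗ₜ m)) = c • ((q (PLb θR' x r)) ⊗ₜ[S] m) := fun c r m => by
    rw [← hΦ0]; exact LinearMap.liftBaseChange_tmul ..
  let μ : M →+ PL θQ x ⊗[MvPolynomial (Fin n) Q] (R' ⊗[R] M) := AddMonoidHom.mk' (fun m : M => (1 : PL θQ x) ⊗ₜ[MvPolynomial (Fin n) Q] ((1 : R') ⊗ₜ[R] m))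
    (fun m m' => by rw [tmul_add, tmul_add])
  have hμ : ∀ m, μ m = 1 ⊗ₜ[MvPolynomial (Fin n) Q] ((1 : R') ⊗ₜ[R] m) := fun m => rfl
  have hμp : ∀ (p : (MvPolynomial (Fin n) Q)) (p' : MvPolynomial (Fin n) R),
      MvPolynomial.map g p = MvPolynomial.map (algebraMap R R') p' → ∀ m : M,
      algebraMap (MvPolynomial (Fin n) Q) (PL θQ x) p • μ m = μ (π (algebraMap _ _ p') • m) := by
    intro p p' h m
    rw [algebraMap_smul, hμ, ← tmul_smul, hd p p' h, hπ, hμ]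
  have h1 : ∀ c, κ c = 0 → ∀ m, c • μ m = 0 := by
    let 𝔞 : Ideal (PL θQ x) := ⨅ m, LinearMap.ker (LinearMap.toSpanSingleton (PL θQ x) _ (μ m))
    have h𝔞 : ∀ c, c ∈ 𝔞 ↔ ∀ m, c • μ m = 0 := fun c => by simp [𝔞]
    have hle : RingHom.ker q ≤ 𝔞.map (PLm x hQ) := by
      rw [hqk, Ideal.map_le_iff_le_comap]
      intro a haI
      obtain ⟨p, s, rfl⟩ := IsLocalization.exists_mk'_eq (PP θR x).primeCompl a
      obtain ⟨p', hp'⟩ := MvPolynomial.map_surjective g hg (MvPolynomial.map (algebraMap R R') p)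
      have hp0 : π (algebraMap _ _ p) = 0 := by
        rw [← IsLocalization.mk'_spec (PL θR x) p s, map_mul, RingHom.mem_ker.1 haI, zero_mul]
      rw [Ideal.mem_comap]
      have hu := IsLocalization.map_units (PL θR x) s
      rw [← Ideal.mul_unit_mem_iff_mem _ (hu.map (PLm x hR)), ← map_mul, IsLocalization.mk'_spec,
        PLm_alg, ← hp', ← PLm_alg x hQ]
      refine Ideal.mem_map_of_mem _ ((h𝔞 _).2 fun m => ?_)
      rw [hμp p' p hp', hp0, zero_smul, map_zero]
    have hker : RingHom.ker (PLm x hQ) ≤ 𝔞 := by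
      rw [PLm_ker x hQ hg, Ideal.map_le_iff_le_comap]
      intro a haK
      refine (h𝔞 _).2 fun m => ?_
      rw [RingHom.comp_apply, algebraMap_smul, hμ, ← tmul_smul, ha, RingHom.mem_ker.1 haK, zero_mul,
        zero_tmul, tmul_zero]
    intro c hc0
    have h2 : PLm x hQ c ∈ 𝔞.map (PLm x hQ) := hle hc0
    rw [← Ideal.mem_comap, Ideal.comap_map_of_surjective' _ (PLm_surj x hQ hg), sup_eq_left.2 hker] at h2
    exact (h𝔞 c).1 h2
  refine LinearEquiv.ofBijective Φ ?_
  obtain ⟨Ψ, hΨ⟩ := tensor_desc (A := S) hκ μ h1 (by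
    intro a m c hca
    obtain ⟨b, rfl⟩ := hπs a
    obtain ⟨p, s, rfl⟩ := IsLocalization.exists_mk'_eq (PP θR x).primeCompl b
    obtain ⟨p', hp'⟩ := MvPolynomial.map_surjective g hg (MvPolynomial.map (algebraMap R R') p)
    obtain ⟨s', hs'⟩ := MvPolynomial.map_surjective g hg (MvPolynomial.map (algebraMap R R') s.1)
    have hsu : IsUnit (algebraMap (MvPolynomial (Fin n) Q) (PL θQ x) s') := by
      refine IsLocalization.map_units (PL θQ x) (⟨s', fun h => s.2 ?_⟩ : (PP θQ x).primeCompl)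
      refine (PL_mem x hR _).2 ?_
      rw [← hs', ← PL_mem x hQ]
      exact h
    refine (hsu.smul_left_cancel (x := c • μ m) (y := μ (π (IsLocalization.mk' (PL θR x) p s) • m))).1 ?_
    rw [hμp s' s.1 hs', smul_smul, smul_smul, ← map_mul, mul_comm _ (IsLocalization.mk' _ _ _),
      IsLocalization.mk'_spec, ← hμp p' p hp', ← sub_eq_zero]
    refine (sub_smul _ _ (μ m)).symm.trans (h1 _ ?_ m)
    rw [map_sub, map_mul, hca, hcc, sub_eq_zero]
    simp only [κ, RingHom.comp_apply]
    rw [PLm_alg, hs', PLm_alg, hp', ← PLm_alg x hR, ← map_mul, ← map_mul, mul_comm,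
      IsLocalization.mk'_spec, PLm_alg])
  refine ⟨?_, ?_⟩
  · have : ∀ z, Ψ (Φ z) = z := by
      intro z
      induction z with
      | zero => simp
      | add u v hu hv => rw [map_add, map_add, hu, hv]
      | tmul c z =>
        induction z with
        | zero => simp
        | add u v hu hv => rw [tmul_add, map_add, map_add, hu, hv]
        | tmul r m =>
          obtain ⟨a, rfl⟩ := hg r
          have e1 : q (PLb θR' x (g a)) = κ (PLb θQ x a) := by
            simp only [κ, RingHom.comp_apply, PLm_alg, MvPolynomial.map_C]
          rw [hΦ, hsm, smul_tmul', smul_eq_mul, e1, ← map_mul, hΨ, mul_smul, RingHom.comp_apply,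
            algebraMap_smul, hμ, ← tmul_smul, ha, smul_tmul', smul_eq_mul, mul_one, mul_one]
    exact Function.LeftInverse.injective this
  · intro z
    induction z with
    | zero => exact ⟨0, map_zero _⟩
    | add u v hu hv =>
      obtain ⟨u, rfl⟩ := hu
      obtain ⟨v, rfl⟩ := hv
      exact ⟨u + v, map_add _ _ _⟩
    | tmul s m =>
      obtain ⟨c, rfl⟩ := hκ s
      refine ⟨c ⊗ₜ (1 ⊗ₜ m), ?_⟩
      rw [hΦ, map_one, map_one, hsm, smul_tmul', smul_eq_mul, mul_one]
end core
end part20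

section part21
theorem ProjDimLE_of_cat {Q : Type u} [CommRing Q] {n : ℕ} {N : Type u} [AddCommGroup N] [Module Q N]
    (h : CategoryTheory.HasProjectiveDimensionLT (ModuleCat.of Q N) (n + 1)) : ProjDimLE Q n N := by
  induction n generalizing N with
  | zero =>
    have h1 := CategoryTheory.projective_iff_hasProjectiveDimensionLT_one.2 h
    exact (IsProjective.iff_projective (P := N)).2 h1
  | succ n ih =>
    have ha := Finsupp.linearCombination_id_surjective Q N
    refine ⟨N →₀ Q, inferInstance, inferInstance, _, inferInstance, ha, ih ?_⟩
    exact ((LinearMap.shortExact_shortComplexKer ha).hasProjectiveDimensionLT_X₃_iff n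
      ((IsProjective.iff_projective (P := N →₀ Q)).1 inferInstance)).1 h

theorem ProjDimFinite_of_GRS {Q B : Type u} [CommRing Q] [IsLocalRing Q] [IsNoetherianRing Q]
    [CommRing B] (g : Q →+* B) (hg : Function.Surjective g)
    (h : GeneratedByRegularSequence Q (RingHom.ker g)) :
    letI := g.toAlgebra; ProjDimFinite Q B := by
  letI := g.toAlgebra
  obtain ⟨rs, h1, h2⟩ := h
  have h3 := ModuleCat.projectiveDimension_quotient_eq_length.{u} rs h1
  refine ⟨rs.length, ProjDimLE_of_cat ?_⟩
  have h4 : CategoryTheory.HasProjectiveDimensionLT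
      (ModuleCat.of Q (Shrink.{u} (Q ⧸ Ideal.ofList rs))) (rs.length + 1) := by
    apply (CategoryTheory.projectiveDimension_lt_iff).1
    rw [h3]
    exact_mod_cast Nat.lt_succ_self _
  have hk : Ideal.ofList rs = LinearMap.ker (Algebra.linearMap Q B) := by
    ext z
    rw [LinearMap.mem_ker]
    change z ∈ Ideal.span _ ↔ z ∈ RingHom.ker g
    rw [h2]
  let e : Shrink.{u} (Q ⧸ Ideal.ofList rs) ≃ₗ[Q] B := (Shrink.linearEquiv Q _).trans
    ((Submodule.quotEquivOfEq _ _ hk).trans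
      (LinearMap.quotKerEquivOfSurjective (Algebra.linearMap Q B) hg))
  exact CategoryTheory.hasProjectiveDimensionLT_of_iso e.toModuleIso _
end part21

section part22
theorem local_le {R B : Type u} [CommRing R] [CommRing B] [IsLocalRing R] [IsLocalRing B]
    (f : R →+* B) [h : IsLocalHom f] : (maximalIdeal R).map f ≤ maximalIdeal B :=
  ((local_hom_TFAE f).out 0 2).1 h

theorem quot_fac {B B1 C : Type u} [CommRing B] [CommRing B1] [CommRing C] {p : B →+* B1}
    (hp : Function.Surjective p) (k : B →+* C) (h : RingHom.ker p ≤ RingHom.ker k) :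
    ∃ c : B1 →+* C, c.comp p = k :=
  ⟨RingHom.liftOfSurjective p hp ⟨k, h⟩, RingHom.liftOfRightInverse_comp _ _ _ _⟩

theorem ker_fac {B B1 C : Type u} [CommRing B] [CommRing B1] [CommRing C] {p : B →+* B1}
    (hp : Function.Surjective p) {k : B →+* C} {c : B1 →+* C} (h : c.comp p = k) :
    RingHom.ker c = (RingHom.ker k).map p := by
  subst h
  rw [← RingHom.comap_ker, Ideal.map_comap_of_surjective _ hp]

theorem ker_mk_comp {B C : Type u} [CommRing B] [CommRing C] {p : B →+* C}
    (hp : Function.Surjective p) (I : Ideal B) :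
    RingHom.ker ((Ideal.Quotient.mk (I.map p)).comp p) = I ⊔ RingHom.ker p := by
  rw [← RingHom.comap_ker, Ideal.mk_ker, Ideal.comap_map_of_surjective' _ hp]

theorem flat_mk_ker {R B C : Type u} [CommRing R] [CommRing B] [CommRing C] {f : R →+* B}
    {p : B →+* C} (hp : Function.Surjective p) (h : (p.comp f).Flat) :
    ((Ideal.Quotient.mk (RingHom.ker p)).comp f).Flat := by
  have h1 := h.comp (flat_equiv (RingHom.quotientKerEquivOfSurjective hp).symm)
  convert h1 using 1
  ext x
  change _ = (RingHom.quotientKerEquivOfSurjective hp).symm (p (f x))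
  rw [RingEquiv.eq_symm_apply]
  rfl

theorem WRn_field {n : ℕ} {K B : Type u} [CommRing K] [IsLocalRing K] (hK : IsField K) [CommRing B]
    [IsLocalRing B] (h : GRSn n B (maximalIdeal B)) (f : K →+* B) : WRn n f := by
  refine WRn.of_fibre (p := RingHom.id B) (RingHom.Flat.of_isField hK f) (fun x => ⟨x, rfl⟩) ?_ ?_
  · rw [(isField_iff_maximalIdeal_eq).1 hK, Ideal.map_bot]
    exact (RingHom.injective_iff_ker_eq_bot _).1 (fun _ _ h => h)
  · rwa [Ideal.map_id]

theorem local_field {K B : Type u} [CommRing K] (hK : IsField K) [CommRing B] [Nontrivial B]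
    (f : K →+* B) : IsLocalHom f := by
  letI := hK.toField
  infer_instance

theorem WRn.comp {n m : ℕ} {R B C : Type u} [CommRing R] [CommRing B] [CommRing C] [IsLocalRing R]
    [IsLocalRing B] [IsLocalRing C] {f : R →+* B} {g : B →+* C} [IsLocalHom f] [IsLocalHom g]
    (hf : WRn n f) (hg : WRn m g) : WRn (n + m) (g.comp f) := by
  have hgf : (g.comp f).Flat := hf.1.comp hg.1
  refine ⟨hgf, ?_⟩
  obtain ⟨g1, hg1⟩ := quot_fac (p := Ideal.Quotient.mk ((maximalIdeal R).map f))
    Ideal.Quotient.mk_surjective ((Ideal.Quotient.mk ((maximalIdeal R).map (g.comp f))).comp g) (by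
      rw [Ideal.mk_ker, ← RingHom.comap_ker, Ideal.mk_ker, ← Ideal.map_map]
      exact Ideal.le_comap_map)
  have hfl : g1.Flat := flat_square hg.1 Ideal.Quotient.mk_surjective Ideal.Quotient.mk_surjective hg1
    (by rw [Ideal.mk_ker, Ideal.mk_ker, Ideal.map_map])
  have hle : (maximalIdeal R).map (g.comp f) ≤ (maximalIdeal B).map g := by
    rw [← Ideal.map_map]
    exact Ideal.map_mono (local_le f)
  have hleC : (maximalIdeal B).map g ≤ maximalIdeal C := local_le g
  obtain ⟨q, hq⟩ := quot_fac (p := Ideal.Quotient.mk ((maximalIdeal R).map (g.comp f)))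
    Ideal.Quotient.mk_surjective (Ideal.Quotient.mk ((maximalIdeal B).map g)) (by
      rw [Ideal.mk_ker, Ideal.mk_ker]; exact hle)
  have hqs : Function.Surjective q := by
    apply Function.Surjective.of_comp (g := Ideal.Quotient.mk ((maximalIdeal R).map (g.comp f)))
    rw [← RingHom.coe_comp, hq]
    exact Ideal.Quotient.mk_surjective
  have hqk : RingHom.ker q = ((maximalIdeal B).map (Ideal.Quotient.mk ((maximalIdeal R).map f))).map g1 := by
    rw [ker_fac Ideal.Quotient.mk_surjective hq, Ideal.mk_ker, Ideal.map_map, Ideal.map_map, hg1]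
  have h1 : GRSn n _ (RingHom.ker q) := by
    rw [hqk]
    refine hf.2.flat hfl ?_
    rw [← hqk]
    have := hg.2.ne_top
    have : Nontrivial (C ⧸ (maximalIdeal B).map g) :=
      Ideal.Quotient.nontrivial_iff.2 (fun h => (maximalIdeal.isMaximal C).ne_top (top_le_iff.1 (h ▸ hleC)))
    exact RingHom.ker_ne_top q
  have h2 := GRSn.concat hqs h1 hg.2
  convert h2 using 1
  apply Ideal.comap_injective_of_surjective _ Ideal.Quotient.mk_surjective
  rw [Ideal.comap_comap, hq, Ideal.comap_map_of_surjective' _ Ideal.Quotient.mk_surjective,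
    Ideal.comap_map_of_surjective' _ Ideal.Quotient.mk_surjective, Ideal.mk_ker, Ideal.mk_ker,
    sup_eq_left.2 hleC, sup_eq_left.2 (hle.trans hleC)]

theorem ci_fibre {n1 n2 l : ℕ} {R A B C D : Type u} [CommRing R] [CommRing A] [CommRing B] [CommRing C]
    [CommRing D] [IsLocalRing R] [IsLocalRing A] [IsLocalRing B] [IsLocalRing C] [IsLocalRing D]
    [IsNoetherianRing C] [IsNoetherianRing D]
    {a : R →+* A} {b : A →+* B} {c : B →+* C} {d : R →+* D} {s : D →+* C} [IsLocalHom a]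
    [IsLocalHom b] [IsLocalHom c] [IsLocalHom d]
    (ha : WRn n1 a) (hb : b.Flat) (hc : c.Flat) (hd : WRn n2 d) (hs : Function.Surjective s)
    (hcomm : s.comp d = (c.comp b).comp a) (hG : GRSn l D (RingHom.ker s))
    (p1 : D ⧸ (maximalIdeal R).map d →+* C ⧸ (maximalIdeal A).map (c.comp b))
    (hp1 : p1.comp (Ideal.Quotient.mk _) = (Ideal.Quotient.mk _).comp s) :
    ∃ l', GRSn l' _ (RingHom.ker p1) := by
  have hcb : (c.comp b).Flat := hb.comp hc
  have hfl : (s.comp d).Flat := by rw [hcomm]; exact ha.1.comp hcb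
  have hle : (maximalIdeal R).map (s.comp d) ≤ (maximalIdeal A).map (c.comp b) := by
    rw [hcomm, ← Ideal.map_map]
    exact Ideal.map_mono (local_le a)
  have hleC : (maximalIdeal A).map (c.comp b) ≤ maximalIdeal C :=
    local_le (c.comp b)
  have htop : (maximalIdeal A).map (c.comp b) ≠ ⊤ :=
    fun h => (maximalIdeal.isMaximal C).ne_top (top_le_iff.1 (h ▸ hleC))
  have htop' : (maximalIdeal R).map (s.comp d) ≠ ⊤ := fun h => htop (top_le_iff.1 (h ▸ hle))
  have : Nontrivial (C ⧸ (maximalIdeal A).map (c.comp b)) := Ideal.Quotient.nontrivial_iff.2 htop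
  have : Nontrivial (C ⧸ (maximalIdeal R).map (s.comp d)) := Ideal.Quotient.nontrivial_iff.2 htop'
  obtain ⟨t, ht⟩ := quot_fac (p := Ideal.Quotient.mk ((maximalIdeal R).map d))
    Ideal.Quotient.mk_surjective ((Ideal.Quotient.mk ((maximalIdeal R).map (s.comp d))).comp s) (by
      rw [Ideal.mk_ker, ← RingHom.comap_ker, Ideal.mk_ker, ← Ideal.map_map]
      exact Ideal.le_comap_map)
  have hts : Function.Surjective t := by
    apply Function.Surjective.of_comp (g := Ideal.Quotient.mk ((maximalIdeal R).map d))
    rw [← RingHom.coe_comp, ht]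
    exact Ideal.Quotient.mk_surjective.comp hs
  have htk : RingHom.ker t = (RingHom.ker s).map (Ideal.Quotient.mk ((maximalIdeal R).map d)) := by
    rw [ker_fac Ideal.Quotient.mk_surjective ht, ← Ideal.map_map, ker_mk_comp hs, Ideal.map_sup]
    simp
  have h1 : GRSn l _ (RingHom.ker t) := by
    have := (flat_of_flat_GRSn hG (flat_mk_ker hs hfl)).2 (maximalIdeal R) _
      (Ideal.Quotient.mk ((maximalIdeal R).map d)) Ideal.Quotient.mk_surjective Ideal.mk_ker
    rw [← htk] at this
    exact this (RingHom.ker_ne_top t)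
  obtain ⟨e, he⟩ := quot_fac (p := Ideal.Quotient.mk ((maximalIdeal R).map a))
    Ideal.Quotient.mk_surjective ((Ideal.Quotient.mk ((maximalIdeal R).map (s.comp d))).comp (c.comp b)) (by
      rw [Ideal.mk_ker, ← RingHom.comap_ker, Ideal.mk_ker, hcomm, ← Ideal.map_map]
      exact Ideal.le_comap_map)
  have hef : e.Flat := flat_square hcb Ideal.Quotient.mk_surjective Ideal.Quotient.mk_surjective he
    (by rw [Ideal.mk_ker, Ideal.mk_ker, Ideal.map_map, hcomm])
  obtain ⟨q, hq⟩ := quot_fac (p := Ideal.Quotient.mk ((maximalIdeal R).map (s.comp d)))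
    Ideal.Quotient.mk_surjective (Ideal.Quotient.mk ((maximalIdeal A).map (c.comp b))) (by
      rw [Ideal.mk_ker, Ideal.mk_ker]; exact hle)
  have hqk : RingHom.ker q = ((maximalIdeal A).map (Ideal.Quotient.mk ((maximalIdeal R).map a))).map e := by
    rw [ker_fac Ideal.Quotient.mk_surjective hq, Ideal.mk_ker, Ideal.map_map, Ideal.map_map, he]
  have h2 : GRSn n1 _ (RingHom.ker q) := by
    have := ha.2.flat hef
    rw [← hqk] at this
    exact this (RingHom.ker_ne_top q)
  have h3 := GRSn.concat hts h1 h2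
  have h4 : p1 = q.comp t := by
    apply Ideal.Quotient.ringHom_ext
    rw [hp1, RingHom.comp_assoc, ht, ← RingHom.comp_assoc, hq]
  rw [RingHom.comap_ker, ← h4] at h3
  exact ⟨_, h3⟩
end part22

section part23
theorem WRn.wr {n : ℕ} {A B : Type u} [CommRing A] [CommRing B] [IsLocalRing A] [IsLocalRing B]
    [IsNoetherianRing B] {f : A →+* B} [hl : IsLocalHom f] (h : WRn n f) :
    IsWeaklyRegularHom A B f := by
  have := isLocalRing_quot (flat_local_map_ne_top (f := f) (maximalIdeal.isMaximal A).ne_top)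
  refine ⟨hl, h.1, inferInstance, this, GRS_iff.2 ⟨n, ?_⟩⟩
  rw [← maximalIdeal_quot_span]
  exact h.2

theorem wr_WRn {A B : Type u} [CommRing A] [CommRing B] [IsLocalRing A] [IsLocalRing B]
    {f : A →+* B} (h : IsWeaklyRegularHom A B f) : ∃ n, WRn n f := by
  obtain ⟨_, h1, _, h2, h3⟩ := h
  obtain ⟨n, h4⟩ := GRS_iff.1 h3
  rw [← maximalIdeal_quot_span] at h4
  exact ⟨n, h1, h4⟩

theorem ci_kernel {n1 n2 l n : ℕ} {R A B C D S S' S2 T : Type u} [CommRing R] [CommRing A] [CommRing B]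
    [CommRing C] [CommRing D] [CommRing S] [CommRing S'] [CommRing S2] [CommRing T] [IsLocalRing R]
    [IsLocalRing A] [IsLocalRing B] [IsLocalRing C] [IsLocalRing D] [IsLocalRing S] [IsLocalRing S']
    [IsLocalRing S2] [IsLocalRing T] [IsNoetherianRing S2] [IsNoetherianRing T]
    [IsNoetherianRing S] [IsNoetherianRing S'] [IsNoetherianRing B]
    [IsNoetherianRing C] [IsNoetherianRing D]
    {a : R →+* A} {b : A →+* B} {c : B →+* C} {d : R →+* D} {s : D →+* C} [IsLocalHom a]
    [IsLocalHom b] [IsLocalHom d]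
    (ha : WRn n1 a) (hb : b.Flat) (hc : Unr c) (hd : WRn n2 d) (hs : Function.Surjective s)
    (hcomm : s.comp d = (c.comp b).comp a) (hG : GRSn l D (RingHom.ker s))
    {π : A →+* S} (hπ : Function.Surjective π) {q : B →+* S'} (hq : Function.Surjective q)
    (h : S →+* S') [IsLocalHom h] (hsq : h.comp π = q.comp b)
    (hqk : RingHom.ker q = (RingHom.ker π).map b) {u : S' →+* T} (hu : Unr u)
    {f : S →+* S2} [IsLocalHom f] (hf : WRn n f) {g : S2 →+* T} (hg : Function.Surjective g)
    (hgf : g.comp f = u.comp h) : ∃ l', GRSn l' S2 (RingHom.ker g) := by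
  have := hc.loc
  have := hu.loc
  have := IsLocalHom.of_surjective π hπ
  have := IsLocalHom.of_surjective q hq
  have hhf : h.Flat := flat_square hb hπ hq hsq hqk
  have hgfl : (g.comp f).Flat := by rw [hgf]; exact hhf.comp hu.flat
  have mm := fun {X Y : Type u} [CommRing X] [CommRing Y] [IsLocalRing X] [IsLocalRing Y]
    (f : X →+* Y) [IsLocalHom f] => flat_local_map_ne_top (f := f) (maximalIdeal.isMaximal X).ne_top
  have l1 := isLocalRing_quot (mm d)
  have l2 := isLocalRing_quot (mm (c.comp b))
  have l3 := isLocalRing_quot (mm h)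
  have l4 := isLocalRing_quot (mm f)
  have l5 := isLocalRing_quot (mm (u.comp h))
  have hπm : (maximalIdeal A).map π = maximalIdeal S := map_maximalIdeal_of_surjective π hπ
  have hkπ : RingHom.ker π ≤ maximalIdeal A := IsLocalRing.le_maximalIdeal (RingHom.ker_ne_top π)
  -- the maps
  obtain ⟨p1, hp1⟩ := quot_fac (p := Ideal.Quotient.mk ((maximalIdeal R).map d))
    Ideal.Quotient.mk_surjective ((Ideal.Quotient.mk ((maximalIdeal A).map (c.comp b))).comp s) (by
      rw [Ideal.mk_ker, ← RingHom.comap_ker, Ideal.mk_ker, ← Ideal.map_le_iff_le_comap,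
        Ideal.map_map, hcomm, ← Ideal.map_map]
      exact Ideal.map_mono (local_le a))
  obtain ⟨l', hl'⟩ := ci_fibre ha hb hc.flat hd hs hcomm hG p1 hp1
  have hp1s : Function.Surjective p1 := by
    apply Function.Surjective.of_comp (g := Ideal.Quotient.mk ((maximalIdeal R).map d))
    rw [← RingHom.coe_comp, hp1]
    exact Ideal.Quotient.mk_surjective.comp hs
  obtain ⟨p2, hp2⟩ := quot_fac (p := Ideal.Quotient.mk ((maximalIdeal S).map f))
    Ideal.Quotient.mk_surjective ((Ideal.Quotient.mk ((maximalIdeal S).map (u.comp h))).comp g) (by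
      rw [Ideal.mk_ker, ← RingHom.comap_ker, Ideal.mk_ker, ← Ideal.map_le_iff_le_comap,
        Ideal.map_map, hgf])
  have hp2s : Function.Surjective p2 := by
    apply Function.Surjective.of_comp (g := Ideal.Quotient.mk ((maximalIdeal S).map f))
    rw [← RingHom.coe_comp, hp2]
    exact Ideal.Quotient.mk_surjective.comp hg
  have hq0s : Function.Surjective ((Ideal.Quotient.mk ((maximalIdeal S).map h)).comp q) :=
    Ideal.Quotient.mk_surjective.comp hq
  have hq0k : RingHom.ker ((Ideal.Quotient.mk ((maximalIdeal S).map h)).comp q) =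
      (maximalIdeal A).map b := by
    have : (maximalIdeal S).map h = ((maximalIdeal A).map b).map q := by
      rw [← hπm, Ideal.map_map, hsq, ← Ideal.map_map]
    rw [this, ker_mk_comp hq, hqk]
    exact sup_eq_left.2 (Ideal.map_mono hkπ)
  obtain ⟨c1, hc1⟩ := quot_fac hq0s
    ((Ideal.Quotient.mk ((maximalIdeal A).map (c.comp b))).comp c) (by
      rw [hq0k, ← RingHom.comap_ker, Ideal.mk_ker, ← Ideal.map_map]
      exact Ideal.le_comap_map)
  have hc1u : Unr c1 := hc.quot hq0s Ideal.Quotient.mk_surjective hc1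
    (by rw [Ideal.mk_ker, hq0k, Ideal.map_map])
  obtain ⟨c2, hc2⟩ := quot_fac (p := Ideal.Quotient.mk ((maximalIdeal S).map h))
    Ideal.Quotient.mk_surjective ((Ideal.Quotient.mk ((maximalIdeal S).map (u.comp h))).comp u) (by
      rw [Ideal.mk_ker, ← RingHom.comap_ker, Ideal.mk_ker, ← Ideal.map_map]
      exact Ideal.le_comap_map)
  have hc2u : Unr c2 := hu.quot Ideal.Quotient.mk_surjective Ideal.Quotient.mk_surjective hc2
    (by rw [Ideal.mk_ker, Ideal.mk_ker, Ideal.map_map])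
  -- base field
  have hK : IsField (ResidueField R) := Field.toIsField _
  obtain ⟨f1, hf1⟩ := quot_fac (residue_surjective (R := R))
    ((Ideal.Quotient.mk ((maximalIdeal R).map d)).comp d) (by
      rw [ker_residue, ← RingHom.comap_ker, Ideal.mk_ker]
      exact Ideal.le_comap_map)
  have hbot : ∀ {X : Type u} [CommRing X] [IsLocalRing X] (k : S →+* X) (_ : (maximalIdeal S).map k = ⊥),
      ∃ k' : ResidueField R →+* X, k'.comp (residue R) = k.comp (π.comp a) := by
    intro X _ _ k hk
    refine quot_fac (residue_surjective (R := R)) _ ?_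
    rw [ker_residue]
    intro x hx
    rw [RingHom.mem_ker, ← Ideal.mem_bot, ← hk]
    exact Ideal.mem_map_of_mem k (local_le (π.comp a) (Ideal.mem_map_of_mem _ hx))
  obtain ⟨f2, hf2⟩ := hbot ((Ideal.Quotient.mk ((maximalIdeal S).map f)).comp f) (by
    rw [← Ideal.map_map, Ideal.map_quotient_self])
  obtain ⟨r, hr⟩ := hbot ((Ideal.Quotient.mk ((maximalIdeal S).map h)).comp h) (by
    rw [← Ideal.map_map, Ideal.map_quotient_self])
  have hw1 : WRn n2 f1 := WRn_field hK (by rw [← maximalIdeal_quot_span]; exact hd.2) f1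
  have hw2 : WRn n f2 := WRn_field hK (by rw [← maximalIdeal_quot_span]; exact hf.2) f2
  have := local_field hK f1
  have := local_field hK f2
  have ext : ∀ {X : Type u} [CommRing X] (k k' : ResidueField R →+* X),
      k.comp (residue R) = k'.comp (residue R) → k = k' := fun k k' hkk =>
    (RingHom.cancel_right residue_surjective).1 hkk
  obtain ⟨l2, hl2⟩ := E_rel2 hw1 hw2 hp1s hp2s hc1u hc2u r (by
      apply ext
      refine RingHom.ext fun x => ?_
      have e1 := DFunLike.congr_fun hf1 x
      have e2 := DFunLike.congr_fun hp1 (d x)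
      have e3 := DFunLike.congr_fun hcomm x
      have e4 := DFunLike.congr_fun hr x
      have e5 := DFunLike.congr_fun hsq (a x)
      have e6 := DFunLike.congr_fun hc1 (b (a x))
      simp only [RingHom.comp_apply] at e1 e2 e3 e4 e5 e6 ⊢
      rw [e1, e2, e3, e4, e5, e6]) (by
      apply ext
      refine RingHom.ext fun x => ?_
      have e1 := DFunLike.congr_fun hf2 x
      have e2 := DFunLike.congr_fun hp2 (f (π (a x)))
      have e4 := DFunLike.congr_fun hr x
      have e5 := DFunLike.congr_fun hgf (π (a x))
      have e6 := DFunLike.congr_fun hc2 (h (π (a x)))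
      simp only [RingHom.comp_apply] at e1 e2 e4 e5 e6 ⊢
      rw [e1, e2, e4, e5, e6]) hl'
  refine ⟨l2, GRSn.lift hf.1 (flat_mk_ker hg hgfl) Ideal.Quotient.mk_surjective Ideal.mk_ker ?_⟩
  convert hl2 using 1
  rw [ker_fac Ideal.Quotient.mk_surjective hp2, ← hgf, ← Ideal.map_map, ker_mk_comp hg, Ideal.map_sup]
  simp

theorem ci_main {n1 n2 l : ℕ} {R A B C D S S' : Type u} [CommRing R] [CommRing A] [CommRing B]
    [CommRing C] [CommRing D] [CommRing S] [CommRing S'] [IsLocalRing R] [IsLocalRing A]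
    [IsLocalRing B] [IsLocalRing C] [IsLocalRing D] [IsLocalRing S] [IsLocalRing S']
    [IsNoetherianRing S] [IsNoetherianRing S'] [IsNoetherianRing B]
    [IsNoetherianRing C] [IsNoetherianRing D]
    {a : R →+* A} {b : A →+* B} {c : B →+* C} {d : R →+* D} {s : D →+* C} [IsLocalHom a]
    [IsLocalHom b] [IsLocalHom d]
    (ha : WRn n1 a) (hb : b.Flat) (hc : Unr c) (hd : WRn n2 d) (hs : Function.Surjective s)
    (hcomm : s.comp d = (c.comp b).comp a) (hG : GRSn l D (RingHom.ker s))
    {π : A →+* S} (hπ : Function.Surjective π) {q : B →+* S'} (hq : Function.Surjective q)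
    (h : S →+* S') [IsLocalHom h] (hsq : h.comp π = q.comp b)
    (hqk : RingHom.ker q = (RingHom.ker π).map b) : IsCIAt S S' h (maximalIdeal S') := by
  have := hc.loc
  have := IsLocalHom.of_surjective π hπ
  have := IsLocalHom.of_surjective q hq
  have hhf : h.Flat := flat_square hb hπ hq hsq hqk
  obtain ⟨t1, t2, t3, t4⟩ := completion_package (maximalIdeal S') (IsNoetherian.noetherian _)
  have hu : Unr (algebraMap S' (AdicCompletion (maximalIdeal S') S')) := Unr.completion
  have := hu.loc
  obtain ⟨S2, i1, i2, i3, f, g, n, j1, j2, hf, hg, hgf⟩ :=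
    cohen_exists ((algebraMap S' (AdicCompletion (maximalIdeal S') S')).comp h)
  have hgl := IsLocalHom.of_surjective g hg
  refine ⟨S2, i1, f, g, ⟨hgf, i2, ⟨i3, j1⟩, hf.wr, hg, hgl⟩, GRS_iff.2 ?_⟩
  exact ci_kernel ha hb hc hd hs hcomm hG hπ hq h hsq hqk hu hf hg hgf
end part23

section part24
theorem ci_ker {n : ℕ} {R S A : Type u} [CommRing R] [CommRing S] [CommRing A] [IsLocalRing R]
    [IsLocalRing S] [IsLocalRing A] [IsNoetherianRing R] [IsNoetherianRing S] [IsNoetherianRing A]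
    {φ : R →+* S} (hci : IsCIAt R S φ (maximalIdeal S)) {a : R →+* A} [IsLocalHom a]
    (ha : WRn n a) {π : A →+* S} (hπ : Function.Surjective π) (h : π.comp a = φ) :
    ∃ l, GRSn l A (RingHom.ker π) := by
  obtain ⟨P, iP, f, g, ⟨hcomp, nP, ⟨lP, cP⟩, hwr, sg, lg⟩, GP⟩ := hci
  obtain ⟨t1, t2, t3, t4⟩ := completion_package (maximalIdeal S) (IsNoetherian.noetherian _)
  obtain ⟨n1, hf⟩ := wr_WRn hwr
  obtain ⟨l, hl⟩ := GRS_iff.1 GP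
  have := hwr.1
  exact E_rel2 hf ha sg hπ Unr.completion Unr.id φ hcomp h hl

theorem main_core {lP lQ nφ n : ℕ} {R S R' Q P W Ω : Type u} (M : Type u) [CommRing R] [CommRing S]
    [CommRing R'] [CommRing Q] [CommRing P] [CommRing W] [Field Ω]
    [IsLocalRing R] [IsLocalRing S] [IsLocalRing R'] [IsLocalRing Q] [IsLocalRing P] [IsLocalRing W]
    [IsNoetherianRing R] [IsNoetherianRing S] [IsNoetherianRing R'] [IsNoetherianRing Q]
    [IsNoetherianRing P] [IsNoetherianRing W] [Algebra R S] [Algebra R R']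
    [IsLocalHom (algebraMap R S)] [IsLocalHom (algebraMap R R')]
    [AddCommGroup M] [Module R M] [Module S M] [IsScalarTower R S M]
    (hci : IsCIAt R S (algebraMap R S) (maximalIdeal S))
    {g : Q →+* R'} [IsLocalHom g] (sg : Function.Surjective g) (hlQ : GRSn lQ Q (RingHom.ker g))
    (hff : (algebraMap R R').Flat)
    (hfd : letI : Module Q (R' ⊗[R] M) := Module.compHom _ g; FlatDimFinite Q (R' ⊗[R] M))
    {u : R' →+* W} (hu : Unr u) {φ : R →+* P} [IsLocalHom φ] (hφ : WRn nφ φ) {γ : P →+* W}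
    (sγ : Function.Surjective γ) (hlP : GRSn lP P (RingHom.ker γ))
    (hcomp : γ.comp φ = u.comp (algebraMap R R'))
    (ω : W →+* Ω) [IsLocalHom ω] {θR : R →+* Ω} (hR : (ω.comp u).comp (algebraMap R R') = θR)
    (x : Fin n → Ω) (y : Fin n → S) (π : PL θR x →+* S) (hπs : Function.Surjective π)
    (hπ : ∀ p : MvPolynomial (Fin n) R, π (algebraMap _ _ p) = MvPolynomial.aeval y p) :
    HasFiniteCIQDDim S M := by
  have := hu.loc
  have : IsLocalHom θR := by rw [← hR]; infer_instance
  have lγ := IsLocalHom.of_surjective γ sγ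
  have := PLb_local (θ := θR) x
  have := PLb_local (θ := ω.comp γ) x
  have := PLb_local (θ := (ω.comp u).comp g) x
  have nn : ∀ {B : Type u} [CommRing B] [IsNoetherianRing B] (θ : B →+* Ω), IsNoetherianRing (PL θ x) :=
    fun θ => IsLocalization.isNoetherianRing (PP θ x).primeCompl _ inferInstance
  have := nn θR
  have := nn (ω.comp u)
  have := nn ω
  have := nn (ω.comp γ)
  have := nn ((ω.comp u).comp g)
  obtain ⟨n1, ha⟩ := PLb_WR (θ := θR) x
  obtain ⟨n2, hd0⟩ := PLb_WR (θ := ω.comp γ) x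
  have hd := hφ.comp hd0
  have hπa : π.comp (PLb θR x) = algebraMap R S := by
    ext r
    rw [RingHom.comp_apply, RingHom.comp_apply, hπ, MvPolynomial.aeval_C]
  obtain ⟨lI, hI⟩ := ci_ker hci ha hπs hπa
  have hb : (PLm x hR).Flat := PLm_flat x hR hff
  have hc : Unr (PLm x (h := u) (θ' := ω) rfl) := PLm_unr x rfl hu
  have hs : Function.Surjective (PLm x (h := γ) (θ' := ω) rfl) := PLm_surj x rfl sγ
  have hker : RingHom.ker π ≠ ⊤ := RingHom.ker_ne_top π
  have hkerb : (RingHom.ker π).map (PLm x hR) ≠ ⊤ := flat_local_map_ne_top hker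
  obtain ⟨S', iS', q, hq, hqk⟩ : ∃ (S' : Type u) (_ : CommRing S') (q : PL (ω.comp u) x →+* S'),
      Function.Surjective q ∧ RingHom.ker q = (RingHom.ker π).map (PLm x hR) :=
    ⟨PL (ω.comp u) x ⧸ (RingHom.ker π).map (PLm x hR), inferInstance, Ideal.Quotient.mk _,
      Ideal.Quotient.mk_surjective, Ideal.mk_ker⟩
  have : Nontrivial S' := by
    by_contra hn
    rw [not_nontrivial_iff_subsingleton] at hn
    exact hkerb (by rw [← hqk, Ideal.eq_top_iff_one]; exact Subsingleton.elim _ _)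
  have lS' := IsLocalRing.of_surjective' q hq
  have nS' := isNoetherianRing_of_surjective _ _ q hq
  have lq := IsLocalHom.of_surjective q hq
  have lπ := IsLocalHom.of_surjective π hπs
  obtain ⟨h, hsq⟩ := quot_fac hπs (q.comp (PLm x hR))
    (by rw [← RingHom.comap_ker, hqk]; exact Ideal.le_comap_map)
  have lh : IsLocalHom h := by
    refine ⟨fun z hz => ?_⟩
    obtain ⟨z, rfl⟩ := hπs z
    rw [← RingHom.comp_apply, hsq] at hz
    exact (isUnit_of_map_unit _ _ hz).map π
  have hhf : h.Flat := flat_square hb hπs hq hsq hqk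
  have hQs : Function.Surjective (PLm x (h := g) (θ' := ω.comp u) rfl) := PLm_surj x rfl sg
  have hgs : Function.Surjective (q.comp
    (PLm x (h := g) (θ' := ω.comp u) rfl)) := hq.comp hQs
  have hGQ : GeneratedByRegularSequence _ (RingHom.ker
      (q.comp
        (PLm x (h := g) (θ' := ω.comp u) rfl))) := by
    rw [← RingHom.comap_ker, hqk]
    refine GRS_iff.2 ⟨_, GRSn.concat (n := lQ) hQs ?_ (hI.flat hb hkerb)⟩
    have h1 := PLm_ker x (h := g) (θ' := ω.comp u) rfl sg
    rw [h1]
    refine hlQ.flat (PLb_flat x) ?_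
    rw [← h1]
    exact RingHom.ker_ne_top _
  have hcomm : (PLm x (h := γ) (θ' := ω) rfl).comp ((PLb (ω.comp γ) x).comp φ) =
      ((PLm x (h := u) (θ' := ω) rfl).comp (PLm x hR)).comp (PLb θR x) := by
    refine RingHom.ext fun r => ?_
    have e1 := DFunLike.congr_fun hcomp r
    simp only [RingHom.comp_apply, PLm_alg, MvPolynomial.map_C] at e1 ⊢
    rw [e1]
  have hG : GRSn lP _ (RingHom.ker (PLm x (h := γ) (θ' := ω) rfl)) := by
    have h1 := PLm_ker x (h := γ) (θ' := ω) rfl sγ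
    rw [h1]
    refine hlP.flat (PLb_flat x) ?_
    rw [← h1]
    exact RingHom.ker_ne_top _
  refine ⟨S', PL ((ω.comp u).comp g) x, inferInstance, inferInstance, lS', h, _,
    ⟨lS', inferInstance, inferInstance, inferInstance, lh, inferInstance, hhf, hgs, hGQ⟩,
    ci_main ha hb hc hd hs hcomm hG hπs hq h hsq hqk, ?_, ProjDimFinite_of_GRS _ hgs hGQ⟩
  letI := h.toAlgebra
  exact fd_final x sg hR rfl y π hπs hπ _ hq hqk hsq M hfd

theorem main_aux (R S M : Type u) [CommRing R] [CommRing S]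
    [IsLocalRing R] [IsLocalRing S] [IsNoetherianRing R] [IsNoetherianRing S]
    [Algebra R S] [IsLocalHom (algebraMap R S)]
    [AddCommGroup M] [Module R M] [Module S M] [IsScalarTower R S M]
    [Algebra.EssFiniteType R S]
    (hci : IsCIAt R S (algebraMap R S) (maximalIdeal S))
    (hfd : HasFiniteCIQDDim R M) : HasFiniteCIQDDim S M := by
  obtain ⟨R', Q, iR', iQ, hR', f, g, hqd, hci', hfd, -⟩ := hfd
  obtain ⟨-, hQl, nR', nQ, lf, lg, ff, sg, GQ⟩ := hqd
  obtain ⟨P, iP, φ, γ, ⟨hcomp, nP, ⟨lP, cP⟩, hwr, sγ, lγ⟩, GP⟩ := hci'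
  obtain ⟨t1, t2, t3, t4⟩ := completion_package (maximalIdeal R') (IsNoetherian.noetherian _)
  have hu : Unr (algebraMap R' (AdicCompletion (maximalIdeal R') R')) := Unr.completion
  have := hu.loc
  have := hwr.1
  obtain ⟨nφ, hφ⟩ := wr_WRn hwr
  obtain ⟨lP, hlP⟩ := GRS_iff.1 GP
  obtain ⟨lQ, hlQ⟩ := GRS_iff.1 GQ
  have hff : f.Flat := ff
  letI := f.toAlgebra
  have : IsLocalHom (algebraMap R R') := lf
  obtain ⟨Ω, iΩ, τ, ω, lτ, lω, hτ⟩ := common_field (algebraMap R S)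
    ((algebraMap R' (AdicCompletion (maximalIdeal R') R')).comp f)
  obtain ⟨n, y, π, hπs, hπ⟩ := eft_surj (R := R) τ
  have hR : (ω.comp (algebraMap R' (AdicCompletion (maximalIdeal R') R'))).comp (algebraMap R R') =
    τ.comp (algebraMap R S) := hτ.symm
  exact main_core M hci sg hlQ hff hfd hu hφ sγ hlP hcomp ω hR _ y π hπs hπ
end part24

variable (R S M : Type u) [CommRing R] [CommRing S]
  [IsLocalRing R] [IsLocalRing S] [IsNoetherianRing R] [IsNoetherianRing S]
  [Algebra R S] [IsLocalHom (algebraMap R S)]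
  [AddCommGroup M] [Module R M] [Module S M] [IsScalarTower R S M] [Module.Finite S M]

/-- Ascent of complete intersection flat dimension. -/
theorem ascent_cidimfd_of_flat_eft_ci [Module.Flat R S] [Algebra.EssFiniteType R S]
    (hci : IsCIAt R S (algebraMap R S) (maximalIdeal S))
    
    (hfd : HasFiniteCIQDDim R M) :
    HasFiniteCIQDDim S M := by
  exact main_aux R S M hci hfd
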